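/- Let Ω ⊂ ℝ^d be a bounded domain with boundary of class C^{2,γ} and let T > 0. (1) Let a ∈ L^∞(Ω×(0,T)) and b ∈ L^∞(Ω×(0,T))^d, and let v be a classical solution on Ω×(0,T), continuous up to ∂Ω with v = 0 on ∂Ω×(0,T), of the linear parabolic equation ∂_t v = Δv + a v + b·∇v, continuous on cl(Ω)×(0,T], C¹ in t and C² in x. Then v(·,T) ≡ 0 on Ω if and only if v vanishes identically on Ω×(0,T). (2) Assume additionally that the first-order spatial derivatives of b are in L^∞(Ω×(0,T))^d, and let ψ be a classical solution with ψ = 0 on ∂Ω×(0,T) of the adjoint equation ∂_s ψ = −Δψ − a ψ + div(b ψ) on Ω×(0,T). Then ψ(·,0) ≡ 0 on Ω if and only if ψ vanishes identically on Ω×(0,T). -/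

import Mathlib

open Set MeasureTheory

/-- The partial derivative of `f` in the `i`-th coordinate direction. -/
noncomputable def pd {d : ℕ} (i : Fin d) (f : (Fin d → ℝ) → ℝ) (x : Fin d → ℝ) : ℝ :=
  fderiv ℝ f x (Pi.single i 1)

/-- The Laplacian of `f`. -/
noncomputable def lap {d : ℕ} (f : (Fin d → ℝ) → ℝ) (x : Fin d → ℝ) : ℝ :=
  ∑ i, pd i (pd i f) x

/-- `Ω` is a domain with boundary of class `C^{2,γ}`: it admits a global defining
function `φ` of class `C²` whose second derivative is `γ`-Hölder continuous, with
nonvanishing gradient on the boundary. -/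
def HasC2HolderBoundary {d : ℕ} (Ω : Set (Fin d → ℝ)) (γ : NNReal) : Prop :=
  ∃ (φ : (Fin d → ℝ) → ℝ) (C : NNReal),
    ContDiff ℝ 2 φ ∧ HolderWith C γ (iteratedFDeriv ℝ 2 φ) ∧
    Ω = {x | φ x < 0} ∧ ∀ x ∈ frontier Ω, fderiv ℝ φ x ≠ 0

namespace BU

open Filter Topology

variable {d : ℕ}

lemma hasDerivAt_line (x e : Fin d → ℝ) (s : ℝ) :
    HasDerivAt (fun s : ℝ => x + s • e) e s := by
  simpa using ((hasDerivAt_id s).smul_const e).const_add x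

lemma hasDerivAt_comp_line {f : (Fin d → ℝ) → ℝ} (i : Fin d) (x : Fin d → ℝ) (s : ℝ)
    (hf : DifferentiableAt ℝ f (x + s • Pi.single i 1)) :
    HasDerivAt (fun s : ℝ => f (x + s • Pi.single i 1)) (pd i f (x + s • Pi.single i 1)) s :=
  hf.hasFDerivAt.comp_hasDerivAt s (hasDerivAt_line x _ s)

lemma pd_differentiableAt {f : (Fin d → ℝ) → ℝ} (i : Fin d) {x : Fin d → ℝ}
    (hf : ContDiffAt ℝ 2 f x) : ContDiffAt ℝ 1 (pd i f) x := by
  have h : ContDiffAt ℝ 1 (fderiv ℝ f) x := hf.fderiv_right (m := 1) (by norm_num)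
  exact h.clm_apply contDiffAt_const

lemma pd_eq_zero_of_isLocalMax {f : (Fin d → ℝ) → ℝ} (i : Fin d) {x : Fin d → ℝ}
    (hm : IsLocalMax f x) : pd i f x = 0 := by
  unfold pd; rw [hm.fderiv_eq_zero]; rfl

lemma pd_pd_nonpos_of_isLocalMax {f : (Fin d → ℝ) → ℝ} (i : Fin d) {x : Fin d → ℝ}
    (hf : ContDiffAt ℝ 2 f x) (hm : IsLocalMax f x) : pd i (pd i f) x ≤ 0 := by
  by_contra hpos
  push Not at hpos
  set φ : ℝ → ℝ := fun s => f (x + s • Pi.single i 1) with hφ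
  have hline : Tendsto (fun s : ℝ => x + s • (Pi.single i 1 : Fin d → ℝ)) (𝓝 0) (𝓝 x) := by
    have := (hasDerivAt_line x (Pi.single i 1) 0).continuousAt.tendsto
    simpa using this
  have hx0 : x + (0:ℝ) • (Pi.single i 1 : Fin d → ℝ) = x := by simp
  have hdiff : ∀ᶠ y in 𝓝 x, DifferentiableAt ℝ f y := by
    have := hf.eventually (by simp)
    filter_upwards [this] with y hy using hy.differentiableAt (by norm_num)
  have hd1 : deriv φ =ᶠ[𝓝 0] fun s => pd i f (x + s • Pi.single i 1) := by
    filter_upwards [hline.eventually hdiff] with s hs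
    exact (hasDerivAt_comp_line i x s hs).deriv
  have hd2 : deriv (deriv φ) 0 = pd i (pd i f) x := by
    rw [hd1.deriv_eq]
    have := hasDerivAt_comp_line (f := pd i f) i x 0
      (by rw [hx0]; exact (pd_differentiableAt i hf).differentiableAt (by norm_num))
    rw [hx0] at this
    exact this.deriv
  have hmax : IsLocalMax φ 0 := by
    have := hline.eventually hm
    simpa [IsLocalMax, IsMaxFilter, hφ] using this
  have hmin : IsLocalMin φ 0 := by
    apply isLocalMin_of_deriv_deriv_pos
    · rw [hd2]; exact hpos
    · exact hmax.deriv_eq_zero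
    · have := hasDerivAt_comp_line (f := f) i x 0 (by rw [hx0]; exact hf.differentiableAt (by norm_num))
      exact this.continuousAt
  have hconst : φ =ᶠ[𝓝 0] fun _ => φ 0 := by
    filter_upwards [hmax, hmin] with s h1 h2
    exact le_antisymm h1 h2
  have h1 : deriv φ =ᶠ[𝓝 0] deriv (fun _ => φ 0) := hconst.deriv
  have h2 := h1.deriv_eq
  rw [hd2] at h2
  simp at h2
  linarith

lemma pd_comb {f g : (Fin d → ℝ) → ℝ} (i : Fin d) {x x0 : Fin d → ℝ} (N : ℝ)
    (hf : DifferentiableAt ℝ f x) (hg : DifferentiableAt ℝ g x) :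
    pd i (fun y => f y - g y - N * ∑ j, (y j - x0 j) ^ 2) x
      = pd i f x - pd i g x - 2 * N * (x i - x0 i) := by
  have h1 : HasFDerivAt (fun y : Fin d → ℝ => N * ∑ j, (y j - x0 j) ^ 2)
      (N • ∑ j, (2 * (x j - x0 j)) • (ContinuousLinearMap.proj j : (Fin d → ℝ) →L[ℝ] ℝ)) x := by
    apply HasFDerivAt.const_mul
    apply HasFDerivAt.fun_sum
    intro j _
    have := ((hasFDerivAt_apply (𝕜 := ℝ) j x).sub_const (x0 j)).pow 2
    simpa using this
  have := ((hf.hasFDerivAt.sub hg.hasFDerivAt).sub h1).fderiv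
  unfold pd
  have e : (fun y => f y - g y - N * ∑ j, (y j - x0 j) ^ 2) =
    (f - g - fun y : Fin d → ℝ => N * ∑ j, (y j - x0 j) ^ 2) := by ext; simp
  rw [e, this]
  simp [Pi.single_apply]
  ring

lemma pd_pd_comb {f g : (Fin d → ℝ) → ℝ} (i : Fin d) {x x0 : Fin d → ℝ} (N : ℝ)
    (hf : ContDiffAt ℝ 2 f x) (hg : ContDiffAt ℝ 2 g x) :
    pd i (pd i (fun y => f y - g y - N * ∑ j, (y j - x0 j) ^ 2)) x
      = pd i (pd i f) x - pd i (pd i g) x - 2 * N := by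
  have hev : pd i (fun y => f y - g y - N * ∑ j, (y j - x0 j) ^ 2) =ᶠ[𝓝 x]
      fun y => pd i f y - pd i g y - 2 * N * (y i - x0 i) := by
    filter_upwards [hf.eventually (by simp), hg.eventually (by simp)] with y h1 h2
    exact pd_comb i N (h1.differentiableAt (by norm_num)) (h2.differentiableAt (by norm_num))
  have h1 : HasFDerivAt (fun y : Fin d → ℝ => 2 * N * (y i - x0 i))
      ((2 * N) • (ContinuousLinearMap.proj i : (Fin d → ℝ) →L[ℝ] ℝ)) x := by
    apply HasFDerivAt.const_mul
    exact (hasFDerivAt_apply (𝕜 := ℝ) i x).sub_const (x0 i)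
  have hf' := (pd_differentiableAt i hf).differentiableAt (by norm_num)
  have hg' := (pd_differentiableAt i hg).differentiableAt (by norm_num)
  have := ((hf'.hasFDerivAt.sub hg'.hasFDerivAt).sub h1).fderiv
  conv_lhs => unfold pd
  have e2 := hev.fderiv_eq (𝕜 := ℝ)
  have e : (fun y => pd i f y - pd i g y - 2 * N * (y i - x0 i)) =
    (pd i f - pd i g - fun y : Fin d → ℝ => 2 * N * (y i - x0 i)) := by ext; simp
  rw [e, this] at e2
  unfold pd at e2 ⊢
  rw [e2]
  simp

/-- Classical solutions of the differential inequality, vanishing at the final time. -/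
structure Sol (Ω : Set (Fin d → ℝ)) (T C : ℝ) (v : (Fin d → ℝ) → ℝ → ℝ) : Prop where
  op : IsOpen Ω
  bdd : Bornology.IsBounded Ω
  T0 : 0 < T
  C0 : 0 ≤ C
  cont : ContinuousOn (fun q : (Fin d → ℝ) × ℝ => v q.1 q.2) (closure Ω ×ˢ Set.Ioc 0 T)
  c2 : ∀ t ∈ Set.Ioo (0:ℝ) T, ContDiffOn ℝ 2 (fun x => v x t) Ω
  dt : ∀ x ∈ Ω, ∀ t ∈ Set.Ioo (0:ℝ) T, DifferentiableAt ℝ (v x) t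
  bd : ∀ x ∈ frontier Ω, ∀ t ∈ Set.Ioc (0:ℝ) T, v x t = 0
  eq : ∀ x ∈ Ω, ∀ t ∈ Set.Ioo (0:ℝ) T,
    |deriv (v x) t - lap (fun y => v y t) x| ≤ C * (|v x t| + ∑ i, |pd i (fun y => v y t) x|)
  fin : ∀ x ∈ closure Ω, v x T = 0

variable {Ω : Set (Fin d → ℝ)} {T C : ℝ} {v : (Fin d → ℝ) → ℝ → ℝ}

lemma pd_neg (i : Fin d) (f : (Fin d → ℝ) → ℝ) :
    pd i (fun y => -f y) = fun y => - pd i f y := by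
  ext y; unfold pd; rw [fderiv_fun_neg]; rfl

lemma lap_neg (f : (Fin d → ℝ) → ℝ) (x : Fin d → ℝ) : lap (fun y => -f y) x = - lap f x := by
  unfold lap; simp only [pd_neg]; simp

lemma Sol.neg (h : Sol Ω T C v) : Sol Ω T C (fun x t => - v x t) where
  op := h.op
  bdd := h.bdd
  T0 := h.T0
  C0 := h.C0
  cont := h.cont.neg
  c2 t ht := (h.c2 t ht).neg
  dt x hx t ht := (h.dt x hx t ht).fun_neg
  bd x hx t ht := by simp [h.bd x hx t ht]
  eq x hx t ht := by
    have := h.eq x hx t ht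
    rw [lap_neg]
    simp only [pd_neg, abs_neg]
    have e : deriv (fun t => -v x t) t = - deriv (v x) t := by simp
    rw [e, show -deriv (v x) t - -lap (fun y => v y t) x
      = -(deriv (v x) t - lap (fun y => v y t) x) by ring, abs_neg]
    exact this
  fin x hx := by simp [h.fin x hx]

lemma Sol.bound (h : Sol Ω T C v) {t0 : ℝ} (h0 : 0 < t0) :
    ∃ M, 0 < M ∧ ∀ x ∈ closure Ω, ∀ t ∈ Icc t0 T, |v x t| ≤ M := by
  have hc : IsCompact (closure Ω ×ˢ Icc t0 T) := h.bdd.isCompact_closure.prod isCompact_Icc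
  have hcont := h.cont.mono (t := closure Ω ×ˢ Icc t0 T)
    (prod_mono subset_rfl (fun t ht => ⟨lt_of_lt_of_le h0 ht.1, ht.2⟩))
  obtain ⟨M, hM⟩ := hc.exists_bound_of_continuousOn hcont
  refine ⟨max M 1, by positivity, fun x hx t ht => ?_⟩
  exact (hM (x, t) ⟨hx, ht⟩).trans (le_max_left _ _)

lemma Sol.c2At (h : Sol Ω T C v) {x : Fin d → ℝ} (hx : x ∈ Ω) {t : ℝ} (ht : t ∈ Ioo 0 T) :
    ContDiffAt ℝ 2 (fun y => v y t) x := (h.c2 t ht).contDiffAt (h.op.mem_nhds hx)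

/-- One-sided forward Lipschitz bound, by comparison with a quadratic barrier. -/
lemma Sol.forward_lip_aux (h : Sol Ω T C v) {t0 : ℝ} (ht0 : t0 ∈ Ioo 0 T)
    {K : Set (Fin d → ℝ)} (hK : IsCompact K) (hKΩ : K ⊆ Ω) :
    ∃ L, 0 ≤ L ∧ ∀ x ∈ K, ∀ t ∈ Ico t0 T, v x t - v x t0 ≤ L * (t - t0) := by
  obtain ⟨R, hR, hRΩ⟩ := hK.exists_cthickening_subset_open h.op hKΩ
  have hK' : IsCompact (Metric.cthickening R K) := hK.cthickening
  obtain ⟨M, hM0, hM⟩ := h.bound ht0.1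
  have hpdc : ∀ i, ContinuousOn (pd i (fun y => v y t0)) Ω := fun i x hx =>
    (pd_differentiableAt i (h.c2At hx ht0)).continuousAt.continuousWithinAt
  have hlapc : ContinuousOn (lap (fun y => v y t0)) Ω := by
    unfold lap
    apply continuousOn_finsetSum
    intro i _ x hx
    have h1 := pd_differentiableAt i (h.c2At hx ht0)
    have : ContDiffAt ℝ 0 (fderiv ℝ (pd i fun y => v y t0)) x := h1.fderiv_right (m := 0) (by norm_num)
    exact (this.continuousAt.clm_apply continuousAt_const).continuousWithinAt
  obtain ⟨A, hA⟩ := hK'.exists_bound_of_continuousOn (hlapc.mono hRΩ)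
  have hsum : ContinuousOn (fun x => ∑ i, |pd i (fun y => v y t0) x|) Ω :=
    continuousOn_finsetSum _ (fun i _ => (hpdc i).abs)
  obtain ⟨B, hB⟩ := hK'.exists_bound_of_continuousOn (hsum.mono hRΩ)
  set N := 2 * M / R ^ 2 with hN
  have hN0 : 0 < N := by positivity
  set L := |A| + 2 * N * d + C * (M + |B| + 2 * N * R * d) + 1 with hL
  have hC0 := h.C0
  refine ⟨L, by positivity, fun x0 hx0 t1 ht1 => ?_⟩
  by_contra hcon
  push Not at hcon
  have hballK : Metric.closedBall x0 R ⊆ Metric.cthickening R K :=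
    Metric.closedBall_subset_cthickening hx0 R
  have hball : Metric.closedBall x0 R ⊆ Ω := hballK.trans hRΩ
  have ht01 : t0 ≤ t1 := ht1.1
  -- the compared function
  let Φ : (Fin d → ℝ) × ℝ → ℝ := fun z =>
    v z.1 z.2 - v z.1 t0 - N * ∑ j, (z.1 j - x0 j) ^ 2 - L * (z.2 - t0)
  have hS : IsCompact (Metric.closedBall x0 R ×ˢ Icc t0 t1) :=
    (isCompact_closedBall x0 R).prod isCompact_Icc
  have hΦc : ContinuousOn Φ (Metric.closedBall x0 R ×ˢ Icc t0 t1) := by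
    have c1 : ContinuousOn (fun q : (Fin d → ℝ) × ℝ => v q.1 q.2)
        (Metric.closedBall x0 R ×ˢ Icc t0 t1) := h.cont.mono
      (prod_mono (hball.trans subset_closure)
        (fun t ht => ⟨lt_of_lt_of_le ht0.1 ht.1, ht.2.trans ht1.2.le⟩))
    have c2 : ContinuousOn (fun q : (Fin d → ℝ) × ℝ => v q.1 t0)
        (Metric.closedBall x0 R ×ˢ Icc t0 t1) := by
      have := c1.comp (f := fun q : (Fin d → ℝ) × ℝ => (q.1, t0)) (s := Metric.closedBall x0 R ×ˢ Icc t0 t1)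
        (by fun_prop) (fun q hq => ⟨hq.1, left_mem_Icc.2 ht01⟩)
      exact this
    refine ((c1.sub c2).sub (by fun_prop)).sub (by fun_prop)
  obtain ⟨⟨x, t⟩, ⟨hx, ht⟩, hmax⟩ := hS.exists_isMaxOn
    ⟨(x0, t0), Metric.mem_closedBall_self hR.le, left_mem_Icc.2 ht01⟩ hΦc
  simp only at hx ht
  have hpos : 0 < Φ (x, t) := by
    have := hmax (show (x0, t1) ∈ _ from ⟨Metric.mem_closedBall_self hR.le, right_mem_Icc.2 ht01⟩)
    refine lt_of_lt_of_le ?_ this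
    simp [Φ]; linarith
  have hxΩ : x ∈ Ω := hball hx
  have httIcc : t ∈ Icc t0 T := ⟨ht.1, ht.2.trans ht1.2.le⟩
  have ht_ne : t0 < t := by
    rcases ht.1.lt_or_eq with h1 | h1
    · exact h1
    · exfalso
      subst h1
      simp [Φ] at hpos
      have : 0 ≤ N * ∑ j, (x j - x0 j) ^ 2 := by positivity
      linarith
  have htI : t ∈ Ioo 0 T := ⟨ht0.1.trans ht_ne, lt_of_le_of_lt ht.2 ht1.2⟩
  have hxint : x ∈ Metric.ball x0 R := by
    by_contra hnot
    have hdist : dist x x0 = R := le_antisymm hx (by simpa using hnot)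
    have : ∃ j, |x j - x0 j| = R := by
      by_contra hno
      push Not at hno
      have : dist x x0 < R := by
        rw [dist_pi_lt_iff hR]
        intro j
        refine lt_of_le_of_ne ((dist_le_pi_dist x x0 j).trans hdist.le) ?_
        rw [Real.dist_eq]; exact hno j
      linarith
    obtain ⟨j, hj⟩ := this
    have h1 : R ^ 2 ≤ ∑ j, (x j - x0 j) ^ 2 := by
      rw [← hj, sq_abs]
      exact Finset.single_le_sum (f := fun j => (x j - x0 j) ^ 2) (fun i _ => sq_nonneg _) (Finset.mem_univ j)
    have h2 : 2 * M ≤ N * ∑ j, (x j - x0 j) ^ 2 := by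
      calc 2 * M = N * R ^ 2 := by rw [hN]; field_simp
        _ ≤ _ := by gcongr
    have h3 := abs_le.1 (hM x (subset_closure hxΩ) t httIcc)
    have h4 := abs_le.1 (hM x (subset_closure hxΩ) t0 ⟨le_rfl, ht0.2.le⟩)
    have h5 : 0 ≤ L * (t - t0) := mul_nonneg (by positivity) (by linarith)
    simp only [Φ] at hpos
    linarith
  -- spatial maximum
  set u : (Fin d → ℝ) → ℝ := fun y => v y t - v y t0 - N * ∑ j, (y j - x0 j) ^ 2 with hu
  have humax : IsLocalMax u x := by
    filter_upwards [Metric.isOpen_ball.mem_nhds hxint] with y hy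
    have := hmax (show (y, t) ∈ _ from ⟨Metric.ball_subset_closedBall hy, ht⟩)
    simp only [Φ, mem_ofPred_eq] at this
    simp only [hu]; linarith
  have hcv := h.c2At hxΩ htI
  have hcv0 := h.c2At hxΩ ht0
  have hcu : ContDiffAt ℝ 2 u x := by
    refine (hcv.sub hcv0).sub ?_
    fun_prop
  have hxR : ∀ i, |x i - x0 i| ≤ R := fun i => by
    rw [← Real.dist_eq]; exact (dist_le_pi_dist x x0 i).trans hx
  have hg : ∀ i, pd i (fun y => v y t) x = pd i (fun y => v y t0) x + 2 * N * (x i - x0 i) := by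
    intro i
    have h1 := pd_eq_zero_of_isLocalMax i humax
    rw [hu, pd_comb i N (hcv.differentiableAt (by norm_num)) (hcv0.differentiableAt (by norm_num))] at h1
    linarith
  have hl : lap (fun y => v y t) x ≤ lap (fun y => v y t0) x + 2 * N * d := by
    unfold lap
    have : ∀ i ∈ Finset.univ, pd i (pd i (fun y => v y t)) x ≤ pd i (pd i (fun y => v y t0)) x + 2 * N := by
      intro i _
      have h1 := pd_pd_nonpos_of_isLocalMax i hcu humax
      rw [hu, pd_pd_comb i N hcv hcv0] at h1
      linarith
    refine (Finset.sum_le_sum this).trans ?_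
    rw [Finset.sum_add_distrib]
    simp [mul_comm]
  have hgs : ∑ i, |pd i (fun y => v y t) x| ≤ |B| + 2 * N * R * d := by
    calc ∑ i, |pd i (fun y => v y t) x| ≤ ∑ i, (|pd i (fun y => v y t0) x| + 2 * N * R) := by
          apply Finset.sum_le_sum
          intro i _
          rw [hg i]
          refine (abs_add_le _ _).trans ?_
          gcongr
          rw [abs_mul, abs_of_nonneg (by positivity : (0:ℝ) ≤ 2 * N)]
          gcongr
          exact hxR i
      _ = ∑ i, |pd i (fun y => v y t0) x| + 2 * N * R * d := by
          rw [Finset.sum_add_distrib]; simp; ring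
      _ ≤ _ := by
          gcongr
          exact ((le_abs_self _).trans (hB x (hballK hx))).trans (le_abs_self _)
  have hA' : lap (fun y => v y t0) x ≤ |A| :=
    ((le_abs_self _).trans (hA x (hballK hx))).trans (le_abs_self _)
  -- time derivative
  have hdt : L ≤ deriv (v x) t := by
    have hder := (h.dt x hxΩ t htI).hasDerivAt
    have hder2 : HasDerivAt (fun s => v x s - L * s) (deriv (v x) t - L * 1) t :=
      hder.sub ((hasDerivAt_id t).const_mul L)
    by_contra hlt
    push Not at hlt
    have hneg : deriv (v x) t - L * 1 < 0 := by linarith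
    have h1 : ∀ᶠ s in 𝓝[<] t, (v x t - L * t) < v x s - L * s := by
      have := hder2.hasDerivWithinAt (s := Iio t)
      rw [hasDerivWithinAt_iff_tendsto_slope] at this
      have h2 := this.eventually (gt_mem_nhds hneg)
      have e : Iio t \ {t} = Iio t := by ext s; simp
      rw [e] at h2
      filter_upwards [h2, self_mem_nhdsWithin] with s hs hst
      rw [slope_def_field] at hs
      have hst' : s < t := hst
      rw [div_neg_iff] at hs
      rcases hs with hs | hs
      · linarith [hs.1]
      · linarith [hs.2]
    have h3 : ∀ᶠ s in 𝓝[<] t, t0 < s := by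
      filter_upwards [Ioo_mem_nhdsLT ht_ne] with s hs using hs.1
    obtain ⟨s, hs1, hs2, hs3⟩ := (h1.and (h3.and self_mem_nhdsWithin)).exists
    have := hmax (show (x, s) ∈ _ from ⟨hx, hs2.le, (le_of_lt hs3).trans ht.2⟩)
    simp only [Φ, mem_ofPred_eq] at this
    linarith
  have heq := (abs_le.1 (h.eq x hxΩ t htI)).2
  have hMx := hM x (subset_closure hxΩ) t httIcc
  have : C * (|v x t| + ∑ i, |pd i (fun y => v y t) x|) ≤ C * (M + |B| + 2 * N * R * d) := by
    apply mul_le_mul_of_nonneg_left _ hC0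
    linarith
  linarith

lemma Sol.forward_lip (h : Sol Ω T C v) {t0 : ℝ} (ht0 : t0 ∈ Ioo 0 T)
    {K : Set (Fin d → ℝ)} (hK : IsCompact K) (hKΩ : K ⊆ Ω) :
    ∃ L, 0 ≤ L ∧ ∀ x ∈ K, ∀ t ∈ Ico t0 T, |v x t - v x t0| ≤ L * (t - t0) := by
  obtain ⟨L1, hL1, h1⟩ := h.forward_lip_aux ht0 hK hKΩ
  obtain ⟨L2, hL2, h2⟩ := h.neg.forward_lip_aux ht0 hK hKΩ
  refine ⟨max L1 L2, le_max_of_le_left hL1, fun x hx t ht => ?_⟩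
  have ht' : 0 ≤ t - t0 := by linarith [ht.1]
  have a1 := mul_le_mul_of_nonneg_right (le_max_left L1 L2) ht'
  have a2 := mul_le_mul_of_nonneg_right (le_max_right L1 L2) ht'
  have := h1 x hx t ht
  have := h2 x hx t ht
  rw [abs_le]; constructor <;> linarith

end BU

namespace BU

open Filter Topology

variable {d : ℕ}
variable {Ω : Set (Fin d → ℝ)} {T C : ℝ} {v : (Fin d → ℝ) → ℝ → ℝ}

/-- extension of `v` by zero -/
noncomputable def V (Ω : Set (Fin d → ℝ)) (T : ℝ) (v : (Fin d → ℝ) → ℝ → ℝ)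
    (x : Fin d → ℝ) (t : ℝ) : ℝ :=
  (Ω ×ˢ Ioo 0 T).indicator (fun z => v z.1 z.2) (x, t)

/-- extension of the gradient by zero -/
noncomputable def P (Ω : Set (Fin d → ℝ)) (T : ℝ) (v : (Fin d → ℝ) → ℝ → ℝ) (i : Fin d)
    (x : Fin d → ℝ) (t : ℝ) : ℝ :=
  (Ω ×ˢ Ioo 0 T).indicator (fun z => pd i (fun y => v y z.2) z.1) (x, t)

/-- extension of the right-hand side by zero -/
noncomputable def F (Ω : Set (Fin d → ℝ)) (T : ℝ) (v : (Fin d → ℝ) → ℝ → ℝ)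
    (x : Fin d → ℝ) (t : ℝ) : ℝ :=
  (Ω ×ˢ Ioo 0 T).indicator (fun z => deriv (v z.1) z.2 - lap (fun y => v y z.2) z.1) (x, t)

lemma V_eq {x : Fin d → ℝ} {t : ℝ} (hx : x ∈ Ω) (ht : t ∈ Ioo 0 T) : V Ω T v x t = v x t :=
  indicator_of_mem (show (x, t) ∈ Ω ×ˢ Ioo 0 T from ⟨hx, ht⟩) _
lemma P_eq {x : Fin d → ℝ} {t : ℝ} (hx : x ∈ Ω) (ht : t ∈ Ioo 0 T) (i : Fin d) :
    P Ω T v i x t = pd i (fun y => v y t) x :=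
  indicator_of_mem (show (x, t) ∈ Ω ×ˢ Ioo 0 T from ⟨hx, ht⟩) _
lemma F_eq {x : Fin d → ℝ} {t : ℝ} (hx : x ∈ Ω) (ht : t ∈ Ioo 0 T) :
    F Ω T v x t = deriv (v x) t - lap (fun y => v y t) x :=
  indicator_of_mem (show (x, t) ∈ Ω ×ˢ Ioo 0 T from ⟨hx, ht⟩) _
lemma V_out {x : Fin d → ℝ} {t : ℝ} (hx : x ∉ Ω) : V Ω T v x t = 0 :=
  indicator_of_notMem (fun hh => hx hh.1) _
lemma P_out {x : Fin d → ℝ} {t : ℝ} (hx : x ∉ Ω) (i : Fin d) : P Ω T v i x t = 0 :=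
  indicator_of_notMem (fun hh => hx hh.1) _
lemma F_out {x : Fin d → ℝ} {t : ℝ} (hx : x ∉ Ω) : F Ω T v x t = 0 :=
  indicator_of_notMem (fun hh => hx hh.1) _
lemma V_out' {x : Fin d → ℝ} {t : ℝ} (ht : t ∉ Ioo 0 T) : V Ω T v x t = 0 :=
  indicator_of_notMem (fun hh => ht hh.2) _
lemma P_out' {x : Fin d → ℝ} {t : ℝ} (ht : t ∉ Ioo 0 T) (i : Fin d) : P Ω T v i x t = 0 :=
  indicator_of_notMem (fun hh => ht hh.2) _
lemma F_out' {x : Fin d → ℝ} {t : ℝ} (ht : t ∉ Ioo 0 T) : F Ω T v x t = 0 :=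
  indicator_of_notMem (fun hh => ht hh.2) _

lemma meas_of_deriv {U : Set ((Fin d → ℝ) × ℝ)} (hU : MeasurableSet U)
    {f g : (Fin d → ℝ) × ℝ → ℝ} (hf : Measurable f) (w : (Fin d → ℝ) × ℝ)
    (h : ∀ z ∈ U, HasDerivAt (fun s : ℝ => f (z + s • w)) (g z) 0) :
    Measurable (U.indicator g) := by
  let S : ℕ → (Fin d → ℝ) × ℝ → ℝ := fun n =>
    U.indicator (fun z => ((n : ℝ) + 1) * (f (z + (1 / ((n:ℝ) + 1)) • w) - f z))
  refine measurable_of_tendsto_metrizable (f := S) ?_ ?_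
  · intro n
    refine Measurable.indicator ?_ hU
    exact ((hf.comp (by fun_prop)).sub hf).const_mul _
  · rw [tendsto_pi_nhds]
    intro z
    by_cases hz : z ∈ U
    · simp only [S, indicator_of_mem hz]
      have h1 := (h z hz)
      rw [hasDerivAt_iff_tendsto_slope_zero] at h1
      have h2 : Tendsto (fun n : ℕ => 1 / ((n:ℝ) + 1)) atTop (𝓝[≠] 0) := by
        rw [tendsto_nhdsWithin_iff]
        refine ⟨tendsto_one_div_add_atTop_nhds_zero_nat, Eventually.of_forall fun n => ?_⟩
        have : (0:ℝ) < 1 / ((n:ℝ) + 1) := by positivity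
        exact this.ne'
      have h3 := h1.comp h2
      refine h3.congr fun n => ?_
      simp
    · simp [S, indicator_of_notMem hz]

lemma line_ev {U : Set ((Fin d → ℝ) × ℝ)} (hU : IsOpen U) {z : (Fin d → ℝ) × ℝ} (hz : z ∈ U)
    (w : (Fin d → ℝ) × ℝ) : ∀ᶠ s : ℝ in 𝓝 0, z + s • w ∈ U := by
  have : Tendsto (fun s : ℝ => z + s • w) (𝓝 0) (𝓝 z) := by
    have : Continuous (fun s : ℝ => z + s • w) := by fun_prop
    simpa using this.tendsto 0
  exact this.eventually (hU.mem_nhds hz)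

lemma Sol.opU (h : Sol Ω T C v) : IsOpen (Ω ×ˢ Ioo 0 T) := h.op.prod isOpen_Ioo

lemma Sol.measV (h : Sol Ω T C v) : Measurable (fun z : (Fin d → ℝ) × ℝ => V Ω T v z.1 z.2) := by
  have hc : ContinuousOn (fun q : (Fin d → ℝ) × ℝ => v q.1 q.2) (Ω ×ˢ Ioo 0 T) :=
    h.cont.mono (prod_mono subset_closure Ioo_subset_Ioc_self)
  classical
  have := hc.measurable_piecewise (g := (0 : (Fin d → ℝ) × ℝ → ℝ)) continuous_zero.continuousOn h.opU.measurableSet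
  rw [piecewise_eq_indicator] at this
  exact this

lemma Sol.measP (h : Sol Ω T C v) (i : Fin d) :
    Measurable (fun z : (Fin d → ℝ) × ℝ => P Ω T v i z.1 z.2) := by
  refine meas_of_deriv h.opU.measurableSet h.measV (Pi.single i 1, 0) (fun z hz => ?_)
  have h1 := hasDerivAt_comp_line (f := fun y => v y z.2) i z.1 0
    (by simpa using (h.c2At hz.1 hz.2).differentiableAt (by norm_num))
  simp only [zero_smul, add_zero] at h1
  refine h1.congr_of_eventuallyEq ?_
  filter_upwards [line_ev h.opU hz (Pi.single i 1, 0)] with s hs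
  rw [V_eq hs.1 hs.2]; simp

lemma Sol.measF (h : Sol Ω T C v) :
    Measurable (fun z : (Fin d → ℝ) × ℝ => F Ω T v z.1 z.2) := by
  have h1 : Measurable ((Ω ×ˢ Ioo 0 T).indicator
      (fun z : (Fin d → ℝ) × ℝ => deriv (v z.1) z.2)) := by
    refine meas_of_deriv h.opU.measurableSet h.measV (0, 1) (fun z hz => ?_)
    have h1 : HasDerivAt (fun s => v z.1 (z.2 + s)) (deriv (v z.1) z.2) 0 := by
      have := (h.dt z.1 hz.1 z.2 hz.2).hasDerivAt
      exact HasDerivAt.comp_const_add z.2 0 (by simpa using this)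
    refine h1.congr_of_eventuallyEq ?_
    filter_upwards [line_ev h.opU hz (0, 1)] with s hs
    rw [V_eq hs.1 hs.2]; simp
  have h2 : ∀ i, Measurable ((Ω ×ˢ Ioo 0 T).indicator
      (fun z : (Fin d → ℝ) × ℝ => pd i (pd i (fun y => v y z.2)) z.1)) := by
    intro i
    refine meas_of_deriv h.opU.measurableSet (h.measP i) (Pi.single i 1, 0) (fun z hz => ?_)
    have h1 := hasDerivAt_comp_line (f := pd i (fun y => v y z.2)) i z.1 0
      (by simpa using (pd_differentiableAt i (h.c2At hz.1 hz.2)).differentiableAt (by norm_num))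
    simp only [zero_smul, add_zero] at h1
    refine h1.congr_of_eventuallyEq ?_
    filter_upwards [line_ev h.opU hz (Pi.single i 1, 0)] with s hs
    rw [P_eq hs.1 hs.2]; simp
  have h3 := h1.sub (Finset.measurable_fun_sum Finset.univ (fun i _ => h2 i))
  convert h3 using 1
  ext z
  by_cases hz : z ∈ Ω ×ˢ Ioo 0 T
  · rw [F_eq hz.1 hz.2]
    simp [indicator_of_mem hz, lap]
  · have : F Ω T v z.1 z.2 = 0 := indicator_of_notMem hz _
    simp [this, indicator_of_notMem hz]

lemma Sol.F_bound (h : Sol Ω T C v) (x : Fin d → ℝ) (t : ℝ) :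
    |F Ω T v x t| ≤ C * (|V Ω T v x t| + ∑ i, |P Ω T v i x t|) := by
  by_cases hz : (x, t) ∈ Ω ×ˢ Ioo 0 T
  · rw [F_eq hz.1 hz.2, V_eq hz.1 hz.2]
    simp only [P_eq hz.1 hz.2]
    exact h.eq x hz.1 t hz.2
  · have : F Ω T v x t = 0 := indicator_of_notMem hz _
    rw [this, abs_zero]
    have := h.C0
    positivity

lemma Sol.exists_compact (h : Sol Ω T C v) {t0 κ : ℝ} (h0 : 0 < t0) (hκ : 0 < κ) :
    ∃ K, IsCompact K ∧ K ⊆ Ω ∧ ∀ x ∈ closure Ω, ∀ t ∈ Icc t0 T, κ ≤ |v x t| → x ∈ K := by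
  have hsub : closure Ω ×ˢ Icc t0 T ⊆ closure Ω ×ˢ Ioc 0 T :=
    prod_mono subset_rfl (fun t ht => ⟨lt_of_lt_of_le h0 ht.1, ht.2⟩)
  have hc : IsCompact (closure Ω ×ˢ Icc t0 T) := h.bdd.isCompact_closure.prod isCompact_Icc
  have hcont := (h.cont.mono hsub).abs
  have hcl := hcont.preimage_isClosed_of_isClosed hc.isClosed (isClosed_Ici (a := κ))
  have hcc := hc.of_isClosed_subset hcl inter_subset_left
  refine ⟨Prod.fst '' (closure Ω ×ˢ Icc t0 T ∩ (fun q : (Fin d → ℝ) × ℝ => |v q.1 q.2|) ⁻¹' Ici κ),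
    hcc.image continuous_fst, ?_, ?_⟩
  · rintro _ ⟨⟨x, t⟩, ⟨hz, hk⟩, rfl⟩
    by_contra hx
    have hfr : x ∈ frontier Ω := by
      rw [frontier, h.op.interior_eq]; exact ⟨hz.1, hx⟩
    have hk' : κ ≤ |v x t| := hk
    rw [h.bd x hfr t (hsub hz).2] at hk'
    simp at hk'; linarith
  · intro x hx t ht hk
    exact ⟨(x, t), ⟨⟨hx, ht⟩, hk⟩, rfl⟩

/-! truncation functions -/

noncomputable def gam (n : ℕ) (s : ℝ) : ℝ := min 1 (max 0 (n * |s| - 1))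
noncomputable def gg (n : ℕ) (s : ℝ) : ℝ := ∫ u in (0:ℝ)..s, gam n u
noncomputable def GG (n : ℕ) (s : ℝ) : ℝ := ∫ u in (0:ℝ)..s, gg n u

lemma gam_cont (n : ℕ) : Continuous (gam n) := by unfold gam; fun_prop
lemma gam_nonneg (n : ℕ) (s : ℝ) : 0 ≤ gam n s := le_min zero_le_one (le_max_left _ _)
lemma gam_le_one (n : ℕ) (s : ℝ) : gam n s ≤ 1 := min_le_left _ _
lemma gam_zero {n : ℕ} {s : ℝ} (h : n * |s| ≤ 1) : gam n s = 0 := by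
  unfold gam; rw [max_eq_left (by linarith)]; simp
lemma gam_mono {n : ℕ} {s s' : ℝ} (h : |s| ≤ |s'|) : gam n s ≤ gam n s' := by
  unfold gam; gcongr
lemma gam_tendsto {s : ℝ} (hs : s ≠ 0) : Tendsto (fun n => gam n s) atTop (𝓝 1) := by
  have hs' : 0 < |s| := abs_pos.2 hs
  obtain ⟨N, hN⟩ := exists_nat_ge (2 / |s|)
  refine tendsto_const_nhds.congr' ?_
  filter_upwards [eventually_ge_atTop N] with n hn
  have h1 : 2 ≤ n * |s| := by
    have : 2 / |s| ≤ n := hN.trans (by exact_mod_cast hn)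
    rwa [div_le_iff₀ hs'] at this
  unfold gam
  rw [max_eq_right (by linarith), min_eq_left (by linarith)]

lemma gg_deriv (n : ℕ) (s : ℝ) : HasDerivAt (gg n) (gam n s) s :=
  intervalIntegral.integral_hasDerivAt_right ((gam_cont n).intervalIntegrable _ _)
    ((gam_cont n).stronglyMeasurableAtFilter _ _) (gam_cont n).continuousAt
lemma gg_cont (n : ℕ) : Continuous (gg n) :=
  continuous_iff_continuousAt.2 fun s => (gg_deriv n s).continuousAt
lemma GG_deriv (n : ℕ) (s : ℝ) : HasDerivAt (GG n) (gg n s) s :=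
  intervalIntegral.integral_hasDerivAt_right ((gg_cont n).intervalIntegrable _ _)
    ((gg_cont n).stronglyMeasurableAtFilter _ _) (gg_cont n).continuousAt
lemma GG_cont (n : ℕ) : Continuous (GG n) :=
  continuous_iff_continuousAt.2 fun s => (GG_deriv n s).continuousAt
lemma gg_contDiff (n : ℕ) : ContDiff ℝ 1 (gg n) := by
  rw [contDiff_one_iff_deriv]
  refine ⟨fun s => (gg_deriv n s).differentiableAt, ?_⟩
  have : deriv (gg n) = gam n := funext fun s => (gg_deriv n s).deriv
  rw [this]; exact gam_cont n
lemma abs_le_of_uIoc {u s : ℝ} (hu : u ∈ Set.uIoc 0 s) : |u| ≤ |s| := by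
  rcases le_total 0 s with h | h
  · rw [uIoc_of_le h] at hu
    rw [abs_of_pos hu.1, abs_of_nonneg h]; exact hu.2
  · rw [uIoc_of_ge h] at hu
    rw [abs_of_nonpos hu.2, abs_of_nonpos h]; linarith [hu.1]
lemma gg_le (n : ℕ) (s : ℝ) : |gg n s| ≤ |s| * gam n s := by
  have := intervalIntegral.norm_integral_le_of_norm_le_const (a := 0) (b := s) (f := gam n)
    (C := gam n s) (fun u hu => by
      rw [Real.norm_eq_abs, abs_of_nonneg (gam_nonneg n u)]
      exact gam_mono (abs_le_of_uIoc hu))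
  simp only [sub_zero, Real.norm_eq_abs] at this
  unfold gg; linarith
lemma gg_le' (n : ℕ) (s : ℝ) : |gg n s| ≤ |s| :=
  (gg_le n s).trans (mul_le_of_le_one_right (abs_nonneg _) (gam_le_one n s))
lemma gg_zero {n : ℕ} {s : ℝ} (h : n * |s| ≤ 1) : gg n s = 0 := by
  have := gg_le n s
  rw [gam_zero h, mul_zero] at this
  exact abs_nonpos_iff.1 this
lemma gg_tendsto (s : ℝ) : Tendsto (fun n => gg n s) atTop (𝓝 s) := by
  have h : Tendsto (fun n => ∫ u in (0:ℝ)..s, gam n u) atTop (𝓝 (∫ u in (0:ℝ)..s, (1:ℝ))) := by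
    apply intervalIntegral.tendsto_integral_filter_of_dominated_convergence (fun _ => (1:ℝ))
    · exact Eventually.of_forall fun n => (gam_cont n).aestronglyMeasurable
    · refine Eventually.of_forall fun n => Eventually.of_forall fun u _ => ?_
      rw [Real.norm_eq_abs, abs_of_nonneg (gam_nonneg n u)]; exact gam_le_one n u
    · simp
    · have : ∀ᵐ u : ℝ, u ≠ 0 := by simp [ae_iff]
      filter_upwards [this] with u hu _ using gam_tendsto hu
  simpa [gg] using h
lemma GG_zero (n : ℕ) : GG n 0 = 0 := by simp [GG]
lemma GG_bounds (n : ℕ) (s : ℝ) : 0 ≤ GG n s ∧ GG n s ≤ s ^ 2 / 2 := by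
  have hsign : ∀ u, 0 ≤ u → 0 ≤ gg n u := fun u hu =>
    intervalIntegral.integral_nonneg hu (fun w _ => gam_nonneg n w)
  have hsign' : ∀ u, u ≤ 0 → gg n u ≤ 0 := fun u hu => by
    unfold gg; rw [intervalIntegral.integral_symm]
    have := intervalIntegral.integral_nonneg (μ := volume) hu (fun w _ => gam_nonneg n w)
    linarith
  have hid : ∀ a b : ℝ, IntervalIntegrable (fun u : ℝ => u) volume a b := fun a b =>
    continuous_id.intervalIntegrable a b
  rcases le_total 0 s with hs | hs
  · constructor
    · exact intervalIntegral.integral_nonneg hs (fun u hu => hsign u hu.1)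
    · have : GG n s ≤ ∫ u in (0:ℝ)..s, u := by
        refine intervalIntegral.integral_mono_on hs ((gg_cont n).intervalIntegrable _ _) (hid _ _) ?_
        intro u hu
        have := (le_abs_self _).trans (gg_le' n u)
        rwa [abs_of_nonneg hu.1] at this
      simpa using this
  · have e : GG n s = ∫ u in s..0, - gg n u := by
      unfold GG; rw [intervalIntegral.integral_symm, intervalIntegral.integral_neg]
    rw [e]
    constructor
    · exact intervalIntegral.integral_nonneg hs (fun u hu => by linarith [hsign' u hu.2])
    · have : ∫ u in s..0, - gg n u ≤ ∫ u in s..0, -u := by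
        refine intervalIntegral.integral_mono_on hs ((gg_cont n).neg.intervalIntegrable _ _)
          (continuous_neg.intervalIntegrable _ _) ?_
        intro u hu
        have := (neg_le_abs _).trans (gg_le' n u)
        rwa [abs_of_nonpos hu.2] at this
      refine this.trans (le_of_eq ?_)
      rw [intervalIntegral.integral_neg, integral_id]
      ring

end BU

namespace BU

open Filter Topology

variable {d : ℕ}
variable {Ω : Set (Fin d → ℝ)} {T C : ℝ} {v : (Fin d → ℝ) → ℝ → ℝ}

lemma Sol.contX (h : Sol Ω T C v) {t : ℝ} (ht : t ∈ Ioc 0 T) :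
    ContinuousOn (fun x => v x t) (closure Ω) :=
  h.cont.comp (f := fun x : Fin d → ℝ => (x, t)) (by fun_prop) (fun _ hx => ⟨hx, ht⟩)

lemma Sol.contT (h : Sol Ω T C v) {x : Fin d → ℝ} (hx : x ∈ closure Ω) :
    ContinuousOn (fun t => v x t) (Ioc 0 T) :=
  h.cont.comp (f := fun t : ℝ => (x, t)) (by fun_prop) (fun _ ht => ⟨hx, ht⟩)

lemma Sol.contInt (h : Sol Ω T C v) {t0 : ℝ} (h0 : 0 < t0) {K : Set (Fin d → ℝ)}
    (hK : IsCompact K) (hKΩ : K ⊆ Ω) {f : ℝ → ℝ} (hf : Continuous f)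
    {ζ : (Fin d → ℝ) → ℝ} (hζ : ContinuousOn ζ K) :
    ContinuousOn (fun t => ∫ x in K, f (v x t) * ζ x) (Icc t0 T) := by
  have hKc : K ⊆ closure Ω := hKΩ.trans subset_closure
  obtain ⟨M, hM0, hM⟩ := h.bound h0
  obtain ⟨A, hA⟩ := (isCompact_Icc (a := -M) (b := M)).exists_bound_of_continuousOn hf.continuousOn
  obtain ⟨B, hB⟩ := hK.exists_bound_of_continuousOn hζ
  have hsub : ∀ t ∈ Icc t0 T, t ∈ Ioc 0 T := fun t ht => ⟨lt_of_lt_of_le h0 ht.1, ht.2⟩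
  apply continuousOn_of_dominated (bound := fun _ => |A| * |B|)
  · intro t ht
    refine ContinuousOn.aestronglyMeasurable ?_ hK.measurableSet
    exact (hf.comp_continuousOn ((h.contX (hsub t ht)).mono hKc)).mul hζ
  · intro t ht
    refine (ae_restrict_iff' hK.measurableSet).2 (Eventually.of_forall fun x hx => ?_)
    rw [norm_mul]
    have h1 := hA (v x t) (abs_le.1 (hM x (hKc hx) t ht))
    have h2 := hB x hx
    exact mul_le_mul (h1.trans (le_abs_self _)) (h2.trans (le_abs_self _)) (norm_nonneg _) (abs_nonneg _)
  · exact integrableOn_const hK.measure_lt_top.ne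
  · refine (ae_restrict_iff' hK.measurableSet).2 (Eventually.of_forall fun x hx => ?_)
    exact (hf.comp_continuousOn ((h.contT (hKc hx)).mono hsub)).mul continuousOn_const

lemma Sol.right_deriv (h : Sol Ω T C v) {t0 : ℝ} (ht0 : t0 ∈ Ioo 0 T) {K : Set (Fin d → ℝ)}
    (hK : IsCompact K) (hKΩ : K ⊆ Ω) {f f' : ℝ → ℝ} (hf : ∀ s, HasDerivAt f (f' s) s)
    (hf' : Continuous f')
    {ζ : (Fin d → ℝ) → ℝ} (hζ : ContinuousOn ζ K) :
    HasDerivWithinAt (fun t => ∫ x in K, f (v x t) * ζ x)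
      (∫ x in K, f' (v x t0) * deriv (v x) t0 * ζ x) (Ioi t0) t0 := by
  have hKc : K ⊆ closure Ω := hKΩ.trans subset_closure
  have hfc : Continuous f := continuous_iff_continuousAt.2 fun s => (hf s).continuousAt
  obtain ⟨M, hM0, hM⟩ := h.bound ht0.1
  obtain ⟨A, hA⟩ := (isCompact_Icc (a := -M) (b := M)).exists_bound_of_continuousOn hf'.continuousOn
  obtain ⟨B, hB⟩ := hK.exists_bound_of_continuousOn hζ
  obtain ⟨L, hL0, hL⟩ := h.forward_lip ht0 hK hKΩ
  have hIntg : ∀ t ∈ Ioc 0 T, IntegrableOn (fun x => f (v x t) * ζ x) K := fun t ht =>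
    ((hfc.comp_continuousOn ((h.contX ht).mono hKc)).mul hζ).integrableOn_compact hK
  rw [hasDerivWithinAt_iff_tendsto_slope]
  have e : Ioi t0 \ {t0} = Ioi t0 := by ext s; simp
  rw [e]
  have hnear : ∀ᶠ t in 𝓝[>] t0, t ∈ Ioo t0 T := Ioo_mem_nhdsGT ht0.2
  have key : Tendsto (fun t => ∫ x in K, slope (fun t => f (v x t) * ζ x) t0 t) (𝓝[>] t0)
      (𝓝 (∫ x in K, f' (v x t0) * deriv (v x) t0 * ζ x)) := by
    apply tendsto_integral_filter_of_dominated_convergence (fun _ => |A| * L * |B|)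
    · filter_upwards [hnear] with t ht
      simp only [slope_def_field]
      refine ContinuousOn.aestronglyMeasurable ?_ hK.measurableSet
      have a1 := (hfc.comp_continuousOn ((h.contX (t := t) ⟨ht0.1.trans ht.1, ht.2.le⟩).mono hKc)).mul hζ
      have a2 := (hfc.comp_continuousOn ((h.contX (t := t0) ⟨ht0.1, ht0.2.le⟩).mono hKc)).mul hζ
      exact (a1.sub a2).div_const _
    · filter_upwards [hnear] with t ht
      refine (ae_restrict_iff' hK.measurableSet).2 (Eventually.of_forall fun x hx => ?_)
      rw [slope_def_field, ← sub_mul, Real.norm_eq_abs, abs_div, abs_mul]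
      have htp : 0 < t - t0 := by linarith [ht.1]
      rw [abs_of_pos htp, div_le_iff₀ htp]
      have h1 : |f (v x t) - f (v x t0)| ≤ |A| * |v x t - v x t0| := by
        have := (convex_Icc (-M) M).norm_image_sub_le_of_norm_hasDerivWithin_le (f := f) (f' := f')
          (C := |A|) (x := v x t0) (y := v x t)
          (fun s _ => (hf s).hasDerivWithinAt) (fun s hs => (hA s hs).trans (le_abs_self _))
          (abs_le.1 (hM x (hKc hx) t0 ⟨le_rfl, ht0.2.le⟩))
          (abs_le.1 (hM x (hKc hx) t ⟨ht.1.le, ht.2.le⟩))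
        simpa using this
      have h2 := hL x hx t ⟨ht.1.le, ht.2⟩
      have h3 := (hB x hx).trans (le_abs_self B)
      rw [Real.norm_eq_abs] at h3
      calc |f (v x t) - f (v x t0)| * |ζ x| ≤ (|A| * (L * (t - t0))) * |B| := by
            gcongr
            exact h1.trans (by gcongr)
        _ = _ := by ring
    · exact integrableOn_const hK.measure_lt_top.ne
    · refine (ae_restrict_iff' hK.measurableSet).2 (Eventually.of_forall fun x hx => ?_)
      have hd : HasDerivAt (fun t => f (v x t) * ζ x) (f' (v x t0) * deriv (v x) t0 * ζ x) t0 :=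
        ((hf (v x t0)).comp t0 (h.dt x (hKΩ hx) t0 ht0).hasDerivAt).mul_const _
      have := hd.hasDerivWithinAt (s := Ioi t0)
      rw [hasDerivWithinAt_iff_tendsto_slope, e] at this
      exact this
  refine key.congr' ?_
  filter_upwards [hnear] with t ht
  simp only [slope_def_field]
  rw [integral_div, integral_sub (hIntg t ⟨ht0.1.trans ht.1, ht.2.le⟩) (hIntg t0 ⟨ht0.1, ht0.2.le⟩)]

lemma pd_zero_off {K : Set (Fin d → ℝ)} (hK : IsClosed K) {ζ : (Fin d → ℝ) → ℝ}
    (hz : ∀ x ∉ K, ζ x = 0) (i : Fin d) {x : Fin d → ℝ} (hx : x ∉ K) : pd i ζ x = 0 := by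
  have : ζ =ᶠ[𝓝 x] fun _ => 0 := by
    filter_upwards [hK.isOpen_compl.mem_nhds hx] with y hy using hz y hy
  unfold pd; rw [this.fderiv_eq]; simp

lemma ibp (hΩ : IsOpen Ω) {u ζ : (Fin d → ℝ) → ℝ} (hu : ∀ x ∈ Ω, ContDiffAt ℝ 2 u x)
    (hζ : ContDiff ℝ 1 ζ) {K : Set (Fin d → ℝ)} (hK : IsCompact K) (hKΩ : K ⊆ Ω)
    (hz : ∀ x ∉ K, ζ x = 0) :
    ∫ x in K, lap u x * ζ x = - ∫ x in K, ∑ i, pd i u x * pd i ζ x := by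
  have hpc : ∀ i, ContinuousOn (pd i u) K := fun i x hx =>
    (pd_differentiableAt i (hu x (hKΩ hx))).continuousAt.continuousWithinAt
  have hppc : ∀ i, ContinuousOn (pd i (pd i u)) K := fun i x hx => by
    have h1 := pd_differentiableAt i (hu x (hKΩ hx))
    have : ContDiffAt ℝ 0 (fderiv ℝ (pd i u)) x := h1.fderiv_right (m := 0) (by norm_num)
    exact (this.continuousAt.clm_apply continuousAt_const).continuousWithinAt
  have hζc : ∀ i, Continuous (pd i ζ) := fun i =>
    (hζ.continuous_fderiv (by norm_num)).clm_apply continuous_const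
  have i1 : ∀ i, IntegrableOn (fun x => pd i (pd i u) x * ζ x) K := fun i =>
    ((hppc i).mul hζ.continuous.continuousOn).integrableOn_compact hK
  have i2 : ∀ i, IntegrableOn (fun x => pd i u x * pd i ζ x) K := fun i =>
    ((hpc i).mul (hζc i).continuousOn).integrableOn_compact hK
  have i3 : ∀ i, IntegrableOn (fun x => pd i u x * ζ x) K := fun i =>
    ((hpc i).mul hζ.continuous.continuousOn).integrableOn_compact hK
  have hz' : ∀ i, ∀ x ∉ K, pd i ζ x = 0 := fun i x hx => pd_zero_off hK.isClosed hz i hx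
  have main : ∀ i, ∫ x in K, pd i (pd i u) x * ζ x = - ∫ x in K, pd i u x * pd i ζ x := by
    intro i
    have s1 : Function.support (fun x => pd i (pd i u) x * ζ x) ⊆ K := fun x hx => by
      by_contra hxK; exact hx (by simp [hz x hxK])
    have s2 : Function.support (fun x => pd i u x * pd i ζ x) ⊆ K := fun x hx => by
      by_contra hxK; exact hx (by simp [hz' i x hxK])
    have s3 : Function.support (fun x => pd i u x * ζ x) ⊆ K := fun x hx => by
      by_contra hxK; exact hx (by simp [hz x hxK])
    have j1 := (integrableOn_iff_integrable_of_support_subset s1).1 (i1 i)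
    have j2 := (integrableOn_iff_integrable_of_support_subset s2).1 (i2 i)
    have j3 := (integrableOn_iff_integrable_of_support_subset s3).1 (i3 i)
    rw [setIntegral_eq_integral_of_forall_compl_eq_zero (fun x hx => by simp [hz x hx]),
      setIntegral_eq_integral_of_forall_compl_eq_zero (fun x hx => by simp [hz' i x hx])]
    have := integral_mul_fderiv_eq_neg_fderiv_mul_of_integrable (μ := volume) (f := ζ) (g := pd i u)
      (v := Pi.single i 1) (j2.congr (Eventually.of_forall fun x => mul_comm _ _))
      (j1.congr (Eventually.of_forall fun x => mul_comm _ _))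
      (j3.congr (Eventually.of_forall fun x => mul_comm _ _))
      (fun x _ => hζ.differentiable (by norm_num) x)
      (fun x hx => by
        have : x ∈ K := closure_minimal (fun y hy => by
          by_contra hyK; exact hy (hz y hyK)) hK.isClosed hx
        exact (pd_differentiableAt i (hu x (hKΩ this))).differentiableAt (by norm_num))
    calc _ = ∫ x, ζ x * pd i (pd i u) x := by congr 1; ext x; ring
      _ = _ := this
      _ = _ := by congr 2; ext x; rw [mul_comm]; rfl
  unfold lap
  simp only [Finset.sum_mul]
  rw [integral_finsetSum _ (fun i _ => i1 i), integral_finsetSum _ (fun i _ => i2 i),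
    ← Finset.sum_neg_distrib]
  exact Finset.sum_congr rfl fun i _ => main i

lemma Sol.null (h : Sol Ω T C v) (i : Fin d) {t : ℝ} :
    ∀ᵐ x : Fin d → ℝ, V Ω T v x t = 0 → P Ω T v i x t = 0 := by
  by_cases ht : t ∈ Ioo 0 T
  swap
  · exact Eventually.of_forall fun x _ => P_out' ht i
  have hmV : Measurable (fun x => V Ω T v x t) := h.measV.comp measurable_prodMk_right
  have hmP : Measurable (fun x => P Ω T v i x t) := (h.measP i).comp measurable_prodMk_right
  have hms : MeasurableSet {x | V Ω T v x t = 0 → P Ω T v i x t = 0} := by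
    have : {x | V Ω T v x t = 0 → P Ω T v i x t = 0} =
      {x | V Ω T v x t = 0}ᶜ ∪ {x | P Ω T v i x t = 0} := by
      ext x; simp [imp_iff_not_or]
    rw [this]
    exact (hmV (measurableSet_singleton 0)).compl.union (hmP (measurableSet_singleton 0))
  refine ae_mem_of_ae_add_linearMap_mem
    (LinearMap.toSpanSingleton ℝ (Fin d → ℝ) (Pi.single i 1)) volume volume hms (fun y => ?_)
  rw [ae_iff]
  refine measure_null_of_locally_null _ (fun s hs => ?_)
  have hs1 : ¬ (V Ω T v (y + s • Pi.single i 1) t = 0 → P Ω T v i (y + s • Pi.single i 1) t = 0) := hs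
  rw [Classical.not_imp] at hs1
  obtain ⟨h1, h2⟩ := hs1
  have hy : y + s • Pi.single i 1 ∈ Ω := by
    by_contra hn; exact h2 (P_out hn i)
  rw [P_eq hy ht] at h2
  rw [V_eq hy ht] at h1
  have hd := hasDerivAt_comp_line (f := fun y => v y t) i y s
    ((h.c2At hy ht).differentiableAt (by norm_num))
  have hne := hd.eventually_ne (c := 0) h2
  refine ⟨{s}, ?_, by simp⟩
  have hcontl : Tendsto (fun s : ℝ => y + s • (Pi.single i 1 : Fin d → ℝ)) (𝓝 s)
      (𝓝 (y + s • Pi.single i 1)) := (hasDerivAt_line y _ s).continuousAt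
  have hΩev := hcontl.eventually (h.op.mem_nhds hy)
  rw [eventually_nhdsWithin_iff] at hne
  refine mem_nhdsWithin_iff_eventually.2 ?_
  filter_upwards [hne, hΩev] with r hr hrΩ hrm
  by_contra hrs
  have hrm1 : ¬ (V Ω T v (y + r • Pi.single i 1) t = 0 → P Ω T v i (y + r • Pi.single i 1) t = 0) := hrm
  rw [Classical.not_imp] at hrm1
  apply hr hrs
  have := hrm1.1
  rwa [V_eq hrΩ ht] at this

end BU

namespace BU

open Filter Topology

variable {d : ℕ}
variable {Ω : Set (Fin d → ℝ)} {T C : ℝ} {v : (Fin d → ℝ) → ℝ → ℝ}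

/-- `K` contains all the places where `|v| ≥ 1/n`. -/
structure Good (Ω : Set (Fin d → ℝ)) (T : ℝ) (v : (Fin d → ℝ) → ℝ → ℝ) (t0 : ℝ) (n : ℕ)
    (K : Set (Fin d → ℝ)) : Prop where
  cpt : IsCompact K
  sub : K ⊆ Ω
  small : ∀ x ∉ K, ∀ t ∈ Icc t0 T, (n : ℝ) * |V Ω T v x t| ≤ 1

lemma Sol.exists_good (h : Sol Ω T C v) {t0 : ℝ} (h0 : 0 < t0) (n : ℕ) :
    ∃ K, Good Ω T v t0 n K := by
  obtain ⟨K, hK, hKΩ, hs⟩ := h.exists_compact h0 (κ := 1 / ((n:ℝ) + 1)) (by positivity)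
  refine ⟨K, hK, hKΩ, fun x hx t ht => ?_⟩
  by_cases hz : x ∈ Ω ∧ t ∈ Ioo 0 T
  · rw [V_eq hz.1 hz.2]
    have h1 : |v x t| < 1 / ((n:ℝ) + 1) := by
      by_contra hc; exact hx (hs x (subset_closure hz.1) t ht (not_lt.1 hc))
    rw [lt_div_iff₀ (by positivity)] at h1
    have := abs_nonneg (v x t)
    nlinarith
  · have : V Ω T v x t = 0 := indicator_of_notMem (show (x, t) ∉ Ω ×ˢ Ioo 0 T from fun hh => hz hh) _
    rw [this]; simp

section
variable {t0 : ℝ} {n : ℕ} {K : Set (Fin d → ℝ)}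

lemma Good.gg_off (g : Good Ω T v t0 n K) {s : ℝ} (hs : s ∈ Icc t0 T) :
    ∀ x ∉ K, gg n (V Ω T v x s) = 0 := fun x hx => gg_zero (g.small x hx s hs)
lemma Good.gam_off (g : Good Ω T v t0 n K) {s : ℝ} (hs : s ∈ Icc t0 T) :
    ∀ x ∉ K, gam n (V Ω T v x s) = 0 := fun x hx => gam_zero (g.small x hx s hs)

lemma V_ev {s : ℝ} (hs : s ∈ Ioo 0 T) (hΩ : IsOpen Ω) {x : Fin d → ℝ} (hx : x ∈ Ω) :
    (fun y => V Ω T v y s) =ᶠ[𝓝 x] fun y => v y s := by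
  filter_upwards [hΩ.mem_nhds hx] with y hy using V_eq hy hs

lemma Sol.zeta_contDiff (h : Sol Ω T C v) (g : Good Ω T v t0 n K) {s : ℝ}
    (hs : s ∈ Icc t0 T) (hs' : s ∈ Ioo 0 T) : ContDiff ℝ 1 (fun x => gg n (V Ω T v x s)) := by
  rw [contDiff_iff_contDiffAt]
  intro x
  by_cases hx : x ∈ Ω
  · have h1 : ContDiffAt ℝ 1 (fun y => V Ω T v y s) x :=
      ((h.c2At hx hs').of_le (by norm_num)).congr_of_eventuallyEq (V_ev hs' h.op hx)
    exact (gg_contDiff n).contDiffAt.comp x h1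
  · have hxK : x ∉ K := fun hk => hx (g.sub hk)
    have : (fun x => gg n (V Ω T v x s)) =ᶠ[𝓝 x] fun _ => 0 := by
      filter_upwards [g.cpt.isClosed.isOpen_compl.mem_nhds hxK] with y hy using g.gg_off hs y hy
    exact contDiffAt_const.congr_of_eventuallyEq this

lemma Sol.zeta_pd (h : Sol Ω T C v) (g : Good Ω T v t0 n K) {s : ℝ}
    (hs' : s ∈ Ioo 0 T) (i : Fin d) (x : Fin d → ℝ) (hx : x ∈ K) :
    pd i (fun x => gg n (V Ω T v x s)) x = gam n (V Ω T v x s) * P Ω T v i x s := by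
  have hxΩ := g.sub hx
  have h1 : (fun x => gg n (V Ω T v x s)) =ᶠ[𝓝 x] fun x => gg n (v x s) := by
    filter_upwards [V_ev hs' h.op hxΩ] with y hy; rw [hy]
  unfold pd
  rw [h1.fderiv_eq]
  have h2 := ((h.c2At hxΩ hs').differentiableAt (by norm_num)).hasFDerivAt
  have h3 := (gg_deriv n (v x s)).comp_hasFDerivAt x h2
  rw [show (fun x => gg n (v x s)) = gg n ∘ fun y => v y s from rfl, h3.fderiv, V_eq hxΩ hs', P_eq hxΩ hs']
  simp [pd]

lemma Sol.P_cont (h : Sol Ω T C v) (hK : K ⊆ Ω) {t : ℝ} (ht : t ∈ Ioo 0 T) (i : Fin d) :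
    ContinuousOn (fun x => P Ω T v i x t) K := by
  have h1 : ContinuousOn (pd i (fun y => v y t)) K := fun x hx =>
    (pd_differentiableAt i (h.c2At (hK hx) ht)).continuousAt.continuousWithinAt
  exact h1.congr fun x hx => P_eq (hK hx) ht i

lemma Sol.V_cont (h : Sol Ω T C v) (hK : K ⊆ Ω) {t : ℝ} (ht : t ∈ Ioo 0 T) :
    ContinuousOn (fun x => V Ω T v x t) K := 
  ((h.contX (t := t) ⟨ht.1, ht.2.le⟩).mono (hK.trans subset_closure)).congr fun x hx => V_eq (hK hx) ht

lemma Sol.F_int (h : Sol Ω T C v) (hKc : IsCompact K) (hK : K ⊆ Ω) {t : ℝ} (ht : t ∈ Ioo 0 T) :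
    IntegrableOn (fun x => F Ω T v x t) K := by
  have hb : IntegrableOn (fun x => C * (|V Ω T v x t| + ∑ i, |P Ω T v i x t|)) K := by
    refine ContinuousOn.integrableOn_compact hKc ?_
    exact continuousOn_const.mul ((h.V_cont hK ht).abs.add
      (continuousOn_finsetSum _ fun i _ => (h.P_cont hK ht i).abs))
  have hm : Measurable (fun x => F Ω T v x t) := h.measF.comp measurable_prodMk_right
  exact Integrable.mono' hb hm.aestronglyMeasurable
    (Eventually.of_forall fun x => h.F_bound x t)

lemma Sol.key (h : Sol Ω T C v) (g : Good Ω T v t0 n K) {s t : ℝ}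
    (hs : s ∈ Icc t0 T) (hs' : s ∈ Ioo 0 T) (ht : t ∈ Ioo 0 T) :
    ∫ x in K, deriv (v x) t * gg n (V Ω T v x s) =
      ∫ x in K, (F Ω T v x t * gg n (V Ω T v x s)
        - gam n (V Ω T v x s) * ∑ i, P Ω T v i x t * P Ω T v i x s) := by
  have hζ := h.zeta_contDiff g hs hs'
  have hib := ibp h.op (u := fun y => v y t) (fun x hx => h.c2At hx ht) hζ g.cpt g.sub (g.gg_off hs)
  have hlap : ContinuousOn (fun x => lap (fun y => v y t) x) K := by
    unfold lap
    refine continuousOn_finsetSum _ fun i _ => ?_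
    intro x hx
    have h1 := pd_differentiableAt i (h.c2At (g.sub hx) ht)
    have : ContDiffAt ℝ 0 (fderiv ℝ (pd i (fun y => v y t))) x := h1.fderiv_right (m := 0) (by norm_num)
    exact (this.continuousAt.clm_apply continuousAt_const).continuousWithinAt
  have i1 : IntegrableOn (fun x => F Ω T v x t * gg n (V Ω T v x s)) K :=
    (h.F_int g.cpt g.sub ht).mul_continuousOn hζ.continuous.continuousOn g.cpt
  have i2 : IntegrableOn (fun x => lap (fun y => v y t) x * gg n (V Ω T v x s)) K :=
    (hlap.mul hζ.continuous.continuousOn).integrableOn_compact g.cpt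
  have i3 : IntegrableOn (fun x => gam n (V Ω T v x s) * ∑ i, P Ω T v i x t * P Ω T v i x s) K := by
    refine ContinuousOn.integrableOn_compact g.cpt ?_
    exact ((gam_cont n).comp_continuousOn (h.V_cont g.sub hs')).mul
      (continuousOn_finsetSum _ fun i _ => (h.P_cont g.sub ht i).mul (h.P_cont g.sub hs' i))
  rw [integral_sub i1 i3]
  have e1 : ∫ x in K, gam n (V Ω T v x s) * ∑ i, P Ω T v i x t * P Ω T v i x s
      = ∫ x in K, ∑ i, pd i (fun y => v y t) x * pd i (fun x => gg n (V Ω T v x s)) x := by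
    refine setIntegral_congr_fun g.cpt.measurableSet fun x hx => ?_
    simp only [Finset.mul_sum]
    refine Finset.sum_congr rfl fun i _ => ?_
    rw [h.zeta_pd g hs' i x hx, P_eq (g.sub hx) ht]; ring
  rw [e1, sub_eq_add_neg, ← hib, ← integral_add i1 i2]
  refine setIntegral_congr_fun g.cpt.measurableSet fun x hx => ?_
  simp only [F_eq (g.sub hx) ht]; ring

end
end BU

namespace BU

open Filter Topology

variable {d : ℕ}
variable {Ω : Set (Fin d → ℝ)} {T C : ℝ} {v : (Fin d → ℝ) → ℝ → ℝ}

/-- squared `L²` norm of the solution -/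
noncomputable def q2 (Ω : Set (Fin d → ℝ)) (T : ℝ) (v : (Fin d → ℝ) → ℝ → ℝ) (t : ℝ) : ℝ :=
  ∫ x, V Ω T v x t ^ 2

/-- truncated Dirichlet energy -/
noncomputable def en (Ω : Set (Fin d → ℝ)) (T : ℝ) (v : (Fin d → ℝ) → ℝ → ℝ) (n : ℕ) (t : ℝ) : ℝ :=
  ∫ x, gam n (V Ω T v x t) * ∑ i, P Ω T v i x t ^ 2

lemma Sol.V_bound (h : Sol Ω T C v) {t0 : ℝ} (h0 : 0 < t0) :
    ∃ M > 0, ∀ x, ∀ t ∈ Icc t0 T, |V Ω T v x t| ≤ M := by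
  obtain ⟨M, hM0, hM⟩ := h.bound h0
  refine ⟨M, hM0, fun x t ht => ?_⟩
  by_cases hz : x ∈ Ω ∧ t ∈ Ioo 0 T
  · rw [V_eq hz.1 hz.2]; exact hM x (subset_closure hz.1) t ht
  · have : V Ω T v x t = 0 := indicator_of_notMem (show (x, t) ∉ Ω ×ˢ Ioo 0 T from fun hh => hz hh) _
    rw [this]; simpa using hM0.le

lemma Sol.int_bdd (h : Sol Ω T C v) {f : (Fin d → ℝ) → ℝ} (hf : Measurable f)
    {M : ℝ} (hM : ∀ x, |f x| ≤ M) (hout : ∀ x ∉ Ω, f x = 0) : Integrable f := by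
  have hs : Function.support f ⊆ Ω := fun x hx => by
    by_contra hc; exact hx (hout x hc)
  rw [← integrableOn_iff_integrable_of_support_subset hs]
  exact IntegrableOn.of_bound h.bdd.measure_lt_top hf.aestronglyMeasurable M
    (Eventually.of_forall fun x => hM x)

lemma Sol.mV (h : Sol Ω T C v) (t : ℝ) : Measurable (fun x => V Ω T v x t) :=
  h.measV.comp measurable_prodMk_right
lemma Sol.mP (h : Sol Ω T C v) (i : Fin d) (t : ℝ) : Measurable (fun x => P Ω T v i x t) :=
  (h.measP i).comp measurable_prodMk_right
lemma Sol.mF (h : Sol Ω T C v) (t : ℝ) : Measurable (fun x => F Ω T v x t) :=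
  h.measF.comp measurable_prodMk_right

lemma Sol.V_int2 (h : Sol Ω T C v) (t : ℝ) : Integrable (fun x => V Ω T v x t ^ 2) := by
  by_cases ht : t ∈ Ioo 0 T
  · obtain ⟨M, hM0, hM⟩ := h.V_bound ht.1
    refine h.int_bdd ((h.mV t).pow_const 2) (M := M ^ 2) (fun x => ?_) (fun x hx => by simp [V_out hx])
    rw [abs_pow]
    exact pow_le_pow_left₀ (abs_nonneg _) (hM x t ⟨le_rfl, ht.2.le⟩) 2
  · simp [V_out' ht]

lemma q2_nonneg (t : ℝ) : 0 ≤ q2 Ω T v t := integral_nonneg fun x => sq_nonneg _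

lemma Sol.q2_meas (h : Sol Ω T C v) : Measurable (q2 Ω T v) := by
  have : StronglyMeasurable (fun z : (Fin d → ℝ) × ℝ => V Ω T v z.1 z.2 ^ 2) :=
    (h.measV.pow_const 2).stronglyMeasurable
  exact (StronglyMeasurable.integral_prod_left' (μ := volume) this).measurable

lemma Sol.q2_bound (h : Sol Ω T C v) {t0 : ℝ} (h0 : 0 < t0) :
    ∃ M > 0, ∀ t ∈ Icc t0 T, q2 Ω T v t ≤ M := by
  obtain ⟨M, hM0, hM⟩ := h.V_bound h0
  refine ⟨M ^ 2 * volume.real Ω + 1, by positivity, fun t ht => ?_⟩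
  have : q2 Ω T v t = ∫ x in Ω, V Ω T v x t ^ 2 := by
    unfold q2
    rw [setIntegral_eq_integral_of_forall_compl_eq_zero (fun x hx => by simp [V_out hx])]
  rw [this]
  have h2 := norm_setIntegral_le_of_norm_le_const (μ := volume) (s := Ω) (f := fun x => V Ω T v x t ^ 2)
    (C := M ^ 2) h.bdd.measure_lt_top (fun x _ => by
      rw [norm_pow]; exact pow_le_pow_left₀ (abs_nonneg _) (hM x t ht) 2)
  have := (le_abs_self _).trans h2
  linarith

lemma Sol.q2_int (h : Sol Ω T C v) {t0 : ℝ} (h0 : 0 < t0) {w : ℝ → ℝ} (hw : Continuous w) :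
    IntegrableOn (fun t => w t * q2 Ω T v t) (Icc t0 T) := by
  obtain ⟨M, hM0, hM⟩ := h.q2_bound h0
  have h1 : IntegrableOn (q2 Ω T v) (Icc t0 T) :=
    IntegrableOn.of_bound measure_Icc_lt_top h.q2_meas.aestronglyMeasurable M
      ((ae_restrict_iff' measurableSet_Icc).2 (Eventually.of_forall fun t ht => by
        rw [Real.norm_eq_abs, abs_of_nonneg (q2_nonneg t)]; exact hM t ht))
  exact h1.continuousOn_mul hw.continuousOn isCompact_Icc

lemma Sol.en_meas (h : Sol Ω T C v) (n : ℕ) : Measurable (en Ω T v n) := by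
  have : StronglyMeasurable (fun z : (Fin d → ℝ) × ℝ =>
      gam n (V Ω T v z.1 z.2) * ∑ i, P Ω T v i z.1 z.2 ^ 2) :=
    (((gam_cont n).measurable.comp h.measV).mul
      (Finset.measurable_fun_sum _ fun i _ => (h.measP i).pow_const 2)).stronglyMeasurable
  exact (StronglyMeasurable.integral_prod_left' (μ := volume) this).measurable

lemma en_nonneg (n : ℕ) (t : ℝ) : 0 ≤ en Ω T v n t := 
  integral_nonneg fun x => mul_nonneg (gam_nonneg _ _) (Finset.sum_nonneg fun i _ => sq_nonneg _)

lemma Sol.pointwise (h : Sol Ω T C v) (n : ℕ) (x : Fin d → ℝ) (t : ℝ) :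
    F Ω T v x t * gg n (V Ω T v x t) - gam n (V Ω T v x t) * ∑ i, P Ω T v i x t * P Ω T v i x t
     ≤ - (1 / 2) * (gam n (V Ω T v x t) * ∑ i, P Ω T v i x t ^ 2)
       + (C + d * C ^ 2 / 2) * V Ω T v x t ^ 2 := by
  have hF := h.F_bound x t
  have hg := gg_le n (V Ω T v x t)
  have g0 := gam_nonneg n (V Ω T v x t)
  have g1 := gam_le_one n (V Ω T v x t)
  have hC := h.C0
  set a := V Ω T v x t
  set γ := gam n a
  set p := fun i => P Ω T v i x t with hp
  have h1 : F Ω T v x t * gg n a ≤ C * (|a| + ∑ i, |p i|) * (|a| * γ) := by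
    refine (le_abs_self _).trans ?_
    rw [abs_mul]
    exact mul_le_mul hF hg (abs_nonneg _) (by have := Finset.sum_nonneg (fun i (_ : i ∈ Finset.univ) => abs_nonneg (p i)); have := abs_nonneg a; positivity)
  have h2 : C * (|a| + ∑ i, |p i|) * (|a| * γ) = γ * (C * a ^ 2) + ∑ i, γ * (|p i| * (C * |a|)) := by
    rw [← Finset.mul_sum, ← Finset.sum_mul, ← sq_abs a]; ring
  have h3 : ∑ i, γ * (|p i| * (C * |a|)) ≤ ∑ i, γ * (1/2 * p i ^ 2 + C ^ 2 * a ^ 2 / 2) := by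
    refine Finset.sum_le_sum fun i _ => mul_le_mul_of_nonneg_left ?_ g0
    have := sq_nonneg (|p i| - C * |a|)
    have e1 := sq_abs (p i)
    have e2 := sq_abs a
    nlinarith
  have h4 : ∑ i, γ * (1/2 * p i ^ 2 + C ^ 2 * a ^ 2 / 2) = 1/2 * (γ * ∑ i, p i ^ 2) + γ * (d * C ^ 2 / 2 * a ^ 2) := by
    rw [← Finset.mul_sum, Finset.sum_add_distrib, ← Finset.mul_sum]; simp; ring
  have h5 : ∑ i, p i * p i = ∑ i, p i ^ 2 := Finset.sum_congr rfl fun i _ => by ring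
  have h6 : γ * (d * C ^ 2 / 2 * a ^ 2) ≤ d * C ^ 2 / 2 * a ^ 2 := mul_le_of_le_one_left (by positivity) g1
  have h7 : γ * (C * a ^ 2) ≤ C * a ^ 2 := mul_le_of_le_one_left (by positivity) g1
  change F Ω T v x t * gg n a - γ * ∑ i, p i * p i ≤ - (1 / 2) * (γ * ∑ i, p i ^ 2) + _
  rw [h5]
  linarith

lemma Sol.energy_n (h : Sol Ω T C v) {t0 : ℝ} (ht0 : t0 ∈ Ioo 0 T) {W W' : ℝ → ℝ}
    (hW : ∀ t, HasDerivAt W (W' t) t) (hW' : Continuous W') (hW0 : ∀ t, 0 ≤ W t) (n m : ℕ) :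
    ∫ t in t0..T, min (W t * en Ω T v n t) m ≤
      W t0 * q2 Ω T v t0 + ∫ t in t0..T, (|W' t| + 2 * (C + d * C ^ 2 / 2) * W t) * q2 Ω T v t := by
  obtain ⟨K, g⟩ := h.exists_good ht0.1 n
  have hKc := g.sub.trans subset_closure
  have hWc : Continuous W := continuous_iff_continuousAt.2 fun s => (hW s).continuousAt
  set C1 := C + d * C ^ 2 / 2 with hC1
  have hC1' : 0 ≤ C1 := by have := h.C0; positivity
  have hcont : ContinuousOn (fun t => W t * ∫ x in K, GG n (v x t) * 1) (Icc t0 T) :=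
    hWc.continuousOn.mul (h.contInt ht0.1 g.cpt g.sub (GG_cont n) continuousOn_const)
  have hder : ∀ t ∈ Ioo t0 T, HasDerivWithinAt (fun t => W t * ∫ x in K, GG n (v x t) * 1)
      (W' t * (∫ x in K, GG n (v x t) * 1) + W t * ∫ x in K, gg n (v x t) * deriv (v x) t * 1) (Ioi t) t :=
    fun t ht => (hW t).hasDerivWithinAt.mul
      (h.right_deriv ⟨ht0.1.trans ht.1, ht.2⟩ g.cpt g.sub (GG_deriv n) (gg_cont n) continuousOn_const)
  have hA : ∀ t ∈ Ioo 0 T, 0 ≤ ∫ x in K, GG n (v x t) * 1 ∧ ∫ x in K, GG n (v x t) * 1 ≤ q2 Ω T v t / 2 := by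
    intro t ht
    refine ⟨setIntegral_nonneg g.cpt.measurableSet fun x _ => by simpa using (GG_bounds n (v x t)).1, ?_⟩
    have i1 : IntegrableOn (fun x => GG n (v x t) * 1) K :=
      (((GG_cont n).comp_continuousOn ((h.contX ⟨ht.1, ht.2.le⟩).mono hKc)).mul continuousOn_const).integrableOn_compact g.cpt
    calc ∫ x in K, GG n (v x t) * 1 ≤ ∫ x in K, V Ω T v x t ^ 2 / 2 := by
          refine setIntegral_mono_on i1 ((h.V_int2 t).div_const 2).integrableOn g.cpt.measurableSet fun x hx => ?_
          rw [V_eq (g.sub hx) ht, mul_one]; exact (GG_bounds n (v x t)).2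
      _ ≤ ∫ x, V Ω T v x t ^ 2 / 2 := setIntegral_le_integral ((h.V_int2 t).div_const 2)
          (Eventually.of_forall fun x => by positivity)
      _ = _ := by rw [integral_div]; rfl
  have hB : ∀ t ∈ Ioo t0 T, ∫ x in K, gg n (v x t) * deriv (v x) t * 1 ≤
      - (1/2) * en Ω T v n t + C1 * q2 Ω T v t := by
    intro t ht
    have ht' : t ∈ Ioo 0 T := ⟨ht0.1.trans ht.1, ht.2⟩
    have hti : t ∈ Icc t0 T := ⟨ht.1.le, ht.2.le⟩
    have e1 : ∫ x in K, gg n (v x t) * deriv (v x) t * 1 = ∫ x in K, deriv (v x) t * gg n (V Ω T v x t) := by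
      refine setIntegral_congr_fun g.cpt.measurableSet fun x hx => ?_
      simp only [V_eq (g.sub hx) ht']; ring
    rw [e1, h.key g hti ht' ht']
    have hVc := h.V_cont g.sub ht'
    have c3 : IntegrableOn (fun x => gam n (V Ω T v x t) * ∑ i, P Ω T v i x t ^ 2) K := by
      refine ContinuousOn.integrableOn_compact g.cpt ?_
      exact ((gam_cont n).comp_continuousOn hVc).mul
        (continuousOn_finsetSum _ fun i _ => (h.P_cont g.sub ht' i).pow 2)
    have c4 : IntegrableOn (fun x => gam n (V Ω T v x t) * ∑ i, P Ω T v i x t * P Ω T v i x t) K := by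
      refine c3.congr_fun (fun x _ => ?_) g.cpt.measurableSet
      simp only [pow_two]
    have c1 : IntegrableOn (fun x => F Ω T v x t * gg n (V Ω T v x t)) K :=
      (h.F_int g.cpt g.sub ht').mul_continuousOn (h.zeta_contDiff g hti ht').continuous.continuousOn g.cpt
    have c2 := (h.V_int2 t).integrableOn (s := K)
    calc _ ≤ ∫ x in K, (- (1 / 2) * (gam n (V Ω T v x t) * ∑ i, P Ω T v i x t ^ 2)
       + (C + d * C ^ 2 / 2) * V Ω T v x t ^ 2) :=
          integral_mono (c1.sub c4) ((c3.const_mul _).add (c2.const_mul _)) fun x => h.pointwise n x t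
      _ = - (1/2) * (∫ x in K, gam n (V Ω T v x t) * ∑ i, P Ω T v i x t ^ 2) + C1 * ∫ x in K, V Ω T v x t ^ 2 := by
          rw [integral_add (c3.const_mul _) (c2.const_mul _), integral_const_mul, integral_const_mul]
      _ ≤ _ := by
          rw [setIntegral_eq_integral_of_forall_compl_eq_zero (fun x hx => by rw [g.gam_off hti x hx, zero_mul])]
          have : ∫ x in K, V Ω T v x t ^ 2 ≤ q2 Ω T v t := setIntegral_le_integral (h.V_int2 t)
            (Eventually.of_forall fun x => by positivity)
          have := mul_le_mul_of_nonneg_left this hC1'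
          unfold en; linarith
  have hφ1 : IntegrableOn (fun t => (|W' t| + 2 * C1 * W t) * q2 Ω T v t) (Icc t0 T) :=
    h.q2_int ht0.1 (by fun_prop)
  have hφ2 : IntegrableOn (fun t => min (W t * en Ω T v n t) m) (Icc t0 T) := by
    refine IntegrableOn.of_bound measure_Icc_lt_top
      ((hWc.measurable.mul (h.en_meas n)).min measurable_const).aestronglyMeasurable m ?_
    refine Eventually.of_forall fun t => ?_
    rw [Real.norm_eq_abs, abs_of_nonneg (le_min (mul_nonneg (hW0 t) (en_nonneg n t)) (by positivity))]
    exact min_le_right _ _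
  have main := intervalIntegral.sub_le_integral_of_hasDeriv_right_of_le ht0.2.le hcont hder
    (φ := fun t => (1/2) * ((|W' t| + 2 * C1 * W t) * q2 Ω T v t) - (1/2) * min (W t * en Ω T v n t) m)
    ((hφ1.const_mul _).sub (hφ2.const_mul _)) (fun t ht => by
      have ht' : t ∈ Ioo 0 T := ⟨ht0.1.trans ht.1, ht.2⟩
      have a1 := hA t ht'
      have b1 := hB t ht
      have k1 : W' t * (∫ x in K, GG n (v x t) * 1) ≤ |W' t| * (q2 Ω T v t / 2) :=
        mul_le_mul (le_abs_self _) a1.2 a1.1 (abs_nonneg _)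
      have k2 := mul_le_mul_of_nonneg_left b1 (hW0 t)
      have k3 := min_le_left (W t * en Ω T v n t) (m:ℝ)
      linarith)
  have hIT : ∫ x in K, GG n (v x T) * 1 = 0 := by
    rw [setIntegral_congr_fun (g := fun _ => (0:ℝ)) g.cpt.measurableSet (fun x hx => by
      simp [h.fin x (hKc hx), GG_zero])]
    simp
  have j1 := (intervalIntegrable_iff_integrableOn_Icc_of_le ht0.2.le).2 hφ1
  have j2 := (intervalIntegrable_iff_integrableOn_Icc_of_le ht0.2.le).2 hφ2
  rw [intervalIntegral.integral_sub (j1.const_mul _) (j2.const_mul _), intervalIntegral.integral_const_mul,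
    intervalIntegral.integral_const_mul, hIT] at main
  have := mul_le_mul_of_nonneg_left (hA t0 ht0).2 (hW0 t0)
  linarith

end BU

namespace BU

open Filter Topology

variable {d : ℕ}
variable {Ω : Set (Fin d → ℝ)} {T C : ℝ} {v : (Fin d → ℝ) → ℝ → ℝ}

lemma fatou_le {α : Type*} [MeasurableSpace α] {μ : Measure α} {f : ℕ → α → ENNReal} {g : α → ENNReal}
    {B : ENNReal} (hf : ∀ n, Measurable (f n)) (hg : ∀ᵐ a ∂μ, g a ≤ liminf (fun n => f n a) atTop)
    (hB : ∀ n, ∫⁻ a, f n a ∂μ ≤ B) : ∫⁻ a, g a ∂μ ≤ B :=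
  (lintegral_mono_ae hg).trans ((lintegral_liminf_le hf).trans
    (liminf_le_of_le (by isBoundedDefault) (fun b hb => by
      obtain ⟨n, hn⟩ := hb.exists; exact hn.trans (hB n))))

/-- Dirichlet energy -/
noncomputable def e2 (Ω : Set (Fin d → ℝ)) (T : ℝ) (v : (Fin d → ℝ) → ℝ → ℝ) (t : ℝ) : ℝ :=
  ∫ x, ∑ i, P Ω T v i x t ^ 2

lemma Sol.measSum (h : Sol Ω T C v) :
    Measurable (fun z : (Fin d → ℝ) × ℝ => ∑ i, P Ω T v i z.1 z.2 ^ 2) :=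
  Finset.measurable_fun_sum _ fun i _ => (h.measP i).pow_const 2

lemma Sol.mSum (h : Sol Ω T C v) (t : ℝ) : Measurable (fun x => ∑ i, P Ω T v i x t ^ 2) :=
  Finset.measurable_fun_sum _ fun i _ => (h.mP i t).pow_const 2

lemma Sol.en_lint (h : Sol Ω T C v) (n : ℕ) {t : ℝ} (ht : t ∈ Ioo 0 T) :
    ENNReal.ofReal (en Ω T v n t) = ∫⁻ x, ENNReal.ofReal (gam n (V Ω T v x t) * ∑ i, P Ω T v i x t ^ 2) := by
  obtain ⟨K, g⟩ := h.exists_good ht.1 n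
  have hti : t ∈ Icc t T := ⟨le_rfl, ht.2.le⟩
  have c3 : IntegrableOn (fun x => gam n (V Ω T v x t) * ∑ i, P Ω T v i x t ^ 2) K := by
    refine ContinuousOn.integrableOn_compact g.cpt ?_
    exact ((gam_cont n).comp_continuousOn (h.V_cont g.sub ht)).mul
      (continuousOn_finsetSum _ fun i _ => (h.P_cont g.sub ht i).pow 2)
  rw [integrableOn_iff_integrable_of_support_subset (fun x hx => by
    by_contra hxK; exact hx (by simp [g.gam_off hti x hxK]))] at c3
  exact ofReal_integral_eq_lintegral_ofReal c3 (Eventually.of_forall fun x =>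
    mul_nonneg (gam_nonneg _ _) (Finset.sum_nonneg fun i _ => sq_nonneg _))

lemma Sol.energy_lint (h : Sol Ω T C v) {t0 : ℝ} (ht0 : t0 ∈ Ioo 0 T) {W W' : ℝ → ℝ}
    (hW : ∀ t, HasDerivAt W (W' t) t) (hW' : Continuous W') (hW0 : ∀ t, 0 ≤ W t) :
    ∫⁻ t in Ioo t0 T, ENNReal.ofReal (W t) * ∫⁻ x, ENNReal.ofReal (∑ i, P Ω T v i x t ^ 2) ≤
      ENNReal.ofReal (W t0 * q2 Ω T v t0 +
        ∫ t in t0..T, (|W' t| + 2 * (C + d * C ^ 2 / 2) * W t) * q2 Ω T v t) := by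
  have hWc : Continuous W := continuous_iff_continuousAt.2 fun s => (hW s).continuousAt
  set B := ENNReal.ofReal (W t0 * q2 Ω T v t0 +
        ∫ t in t0..T, (|W' t| + 2 * (C + d * C ^ 2 / 2) * W t) * q2 Ω T v t)
  have step : ∀ n : ℕ, ∫⁻ t in Ioo t0 T, ENNReal.ofReal (W t * en Ω T v n t) ≤ B := by
    intro n
    refine fatou_le (f := fun (m : ℕ) t => ENNReal.ofReal (min (W t * en Ω T v n t) m)) ?_ ?_ ?_
    · exact fun m => ((hWc.measurable.mul (h.en_meas n)).min measurable_const).ennreal_ofReal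
    · refine Eventually.of_forall fun t => ?_
      refine le_of_eq (Tendsto.liminf_eq ?_).symm
      obtain ⟨N, hN⟩ := exists_nat_ge (W t * en Ω T v n t)
      refine tendsto_const_nhds.congr' ?_
      filter_upwards [eventually_ge_atTop N] with m hm
      rw [min_eq_left (hN.trans (by exact_mod_cast hm))]
    · intro m
      have hnn : ∀ t, 0 ≤ min (W t * en Ω T v n t) m := fun t =>
        le_min (mul_nonneg (hW0 t) (en_nonneg n t)) (by positivity)
      have hφ2 : IntegrableOn (fun t => min (W t * en Ω T v n t) m) (Ioo t0 T) := by
        refine IntegrableOn.of_bound measure_Ioo_lt_top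
          ((hWc.measurable.mul (h.en_meas n)).min measurable_const).aestronglyMeasurable m ?_
        refine Eventually.of_forall fun t => ?_
        rw [Real.norm_eq_abs, abs_of_nonneg (hnn t)]
        exact min_le_right _ _
      rw [← ofReal_integral_eq_lintegral_ofReal hφ2 (Eventually.of_forall hnn)]
      refine ENNReal.ofReal_le_ofReal ?_
      rw [← integral_Ioc_eq_integral_Ioo, ← intervalIntegral.integral_of_le ht0.2.le]
      exact h.energy_n ht0 hW hW' hW0 n m
  refine fatou_le (f := fun (n : ℕ) t => ENNReal.ofReal (W t * en Ω T v n t)) ?_ ?_ step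
  · exact fun n => (hWc.measurable.mul (h.en_meas n)).ennreal_ofReal
  · refine (ae_restrict_iff' measurableSet_Ioo).2 (Eventually.of_forall fun t ht => ?_)
    have ht' : t ∈ Ioo 0 T := ⟨ht0.1.trans ht.1, ht.2⟩
    have hms : Measurable fun x => ∑ i, P Ω T v i x t ^ 2 := h.mSum t
    have e1 : ∀ n : ℕ, ENNReal.ofReal (W t * en Ω T v n t) =
        ∫⁻ x, ENNReal.ofReal (W t) * ENNReal.ofReal (gam n (V Ω T v x t) * ∑ i, P Ω T v i x t ^ 2) := by
      intro n
      rw [ENNReal.ofReal_mul (hW0 t), h.en_lint n ht', lintegral_const_mul]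
      exact (((gam_cont n).measurable.comp (h.mV t)).mul hms).ennreal_ofReal
    simp only [e1]
    rw [← lintegral_const_mul _ hms.ennreal_ofReal]
    refine le_trans (lintegral_mono_ae ?_) (lintegral_liminf_le fun n =>
      ((((gam_cont n).measurable.comp (h.mV t)).mul hms).ennreal_ofReal).const_mul _)
    have hnull := ae_all_iff.2 fun i => h.null (t := t) i
    filter_upwards [hnull] with x hx
    by_cases hV : V Ω T v x t = 0
    · have : ∑ i, P Ω T v i x t ^ 2 = 0 := Finset.sum_eq_zero fun i _ => by rw [hx i hV]; simp
      rw [this]; simp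
    · refine le_of_eq (Tendsto.liminf_eq ?_).symm
      refine ENNReal.Tendsto.const_mul ?_ (Or.inr ENNReal.ofReal_ne_top)
      refine ENNReal.tendsto_ofReal ?_
      simpa using (gam_tendsto hV).mul_const (∑ i, P Ω T v i x t ^ 2)

lemma e2_nonneg (t : ℝ) : 0 ≤ e2 Ω T v t :=
  integral_nonneg fun x => Finset.sum_nonneg fun i _ => sq_nonneg _

lemma Sol.e2_meas (h : Sol Ω T C v) : Measurable (e2 Ω T v) :=
  (StronglyMeasurable.integral_prod_left' (μ := volume) h.measSum.stronglyMeasurable).measurable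

lemma Sol.lint_meas (h : Sol Ω T C v) :
    Measurable (fun t => ∫⁻ x, ENNReal.ofReal (∑ i, P Ω T v i x t ^ 2)) :=
  Measurable.lintegral_prod_left' (f := fun z : (Fin d → ℝ) × ℝ => ENNReal.ofReal (∑ i, P Ω T v i z.1 z.2 ^ 2))
    h.measSum.ennreal_ofReal

lemma Sol.grad_ae (h : Sol Ω T C v) {t0 : ℝ} (ht0 : t0 ∈ Ioo 0 T) :
    ∀ᵐ t ∂(volume.restrict (Ioo t0 T)), Integrable (fun x => ∑ i, P Ω T v i x t ^ 2) := by
  have h1 := h.energy_lint ht0 (W := fun _ => 1) (W' := fun _ => 0) (fun t => hasDerivAt_const t 1)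
    continuous_const (fun _ => zero_le_one)
  have h2 := lt_of_le_of_lt h1 ENNReal.ofReal_lt_top
  simp only [ENNReal.ofReal_one, one_mul] at h2
  filter_upwards [ae_lt_top h.lint_meas h2.ne] with t ht
  have hms : Measurable fun x => ∑ i, P Ω T v i x t ^ 2 := h.mSum t
  refine ⟨hms.aestronglyMeasurable, ?_⟩
  rw [hasFiniteIntegral_iff_ofReal (Eventually.of_forall fun x => Finset.sum_nonneg fun i _ => sq_nonneg _)]
  exact ht

lemma Sol.energy_aux (h : Sol Ω T C v) {t0 : ℝ} (ht0 : t0 ∈ Ioo 0 T) {W W' : ℝ → ℝ}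
    (hW : ∀ t, HasDerivAt W (W' t) t) (hW' : Continuous W') (hW0 : ∀ t, 0 ≤ W t) :
    ∫⁻ t in Ioo t0 T, ENNReal.ofReal (W t * e2 Ω T v t) ≤
      ENNReal.ofReal (W t0 * q2 Ω T v t0 +
        ∫ t in t0..T, (|W' t| + 2 * (C + d * C ^ 2 / 2) * W t) * q2 Ω T v t) := by
  refine le_trans (le_of_eq (lintegral_congr_ae ?_)) (h.energy_lint ht0 hW hW' hW0)
  filter_upwards [h.grad_ae ht0] with t ht
  rw [ENNReal.ofReal_mul (hW0 t), e2, ofReal_integral_eq_lintegral_ofReal ht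
    (Eventually.of_forall fun x => Finset.sum_nonneg fun i _ => sq_nonneg _)]

lemma Sol.e2_int (h : Sol Ω T C v) {t0 : ℝ} (ht0 : t0 ∈ Ioo 0 T) :
    IntegrableOn (e2 Ω T v) (Ioo t0 T) := by
  have h1 := h.energy_aux ht0 (W := fun _ => 1) (W' := fun _ => 0) (fun t => hasDerivAt_const t 1)
    continuous_const (fun _ => zero_le_one)
  have h2 := lt_of_le_of_lt h1 ENNReal.ofReal_lt_top
  simp only [one_mul] at h2
  refine ⟨h.e2_meas.aestronglyMeasurable, ?_⟩
  rw [hasFiniteIntegral_iff_ofReal (Eventually.of_forall fun x => e2_nonneg x)]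
  exact h2

lemma Sol.energy (h : Sol Ω T C v) {t0 : ℝ} (ht0 : t0 ∈ Ioo 0 T) {W W' : ℝ → ℝ}
    (hW : ∀ t, HasDerivAt W (W' t) t) (hW' : Continuous W') (hW0 : ∀ t, 0 ≤ W t) :
    ∫ t in Ioo t0 T, W t * e2 Ω T v t ≤ W t0 * q2 Ω T v t0 +
        ∫ t in Ioo t0 T, (|W' t| + 2 * (C + d * C ^ 2 / 2) * W t) * q2 Ω T v t := by
  have hWc : Continuous W := continuous_iff_continuousAt.2 fun s => (hW s).continuousAt
  have h1 := h.energy_aux ht0 hW hW' hW0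
  have hm : AEStronglyMeasurable (fun t => W t * e2 Ω T v t) (volume.restrict (Ioo t0 T)) :=
    (hWc.measurable.mul h.e2_meas).aestronglyMeasurable
  rw [integral_eq_lintegral_of_nonneg_ae (Eventually.of_forall fun t => mul_nonneg (hW0 t) (e2_nonneg t)) hm]
  rw [intervalIntegral.integral_of_le ht0.2.le, integral_Ioc_eq_integral_Ioo] at h1
  refine ENNReal.toReal_le_of_le_ofReal ?_ h1
  have hC := h.C0
  have hA : 0 ≤ ∫ t in Ioo t0 T, (|W' t| + 2 * (C + d * C ^ 2 / 2) * W t) * q2 Ω T v t :=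
    integral_nonneg fun t => mul_nonneg (by have := hW0 t; positivity) (q2_nonneg t)
  have := mul_nonneg (hW0 t0) (q2_nonneg (Ω := Ω) (T := T) (v := v) t0)
  linarith

end BU

namespace BU

open Filter Topology

variable {d : ℕ}
variable {Ω : Set (Fin d → ℝ)} {T C : ℝ} {v : (Fin d → ℝ) → ℝ → ℝ}

noncomputable def Qf (Ω : Set (Fin d → ℝ)) (T : ℝ) (v : (Fin d → ℝ) → ℝ → ℝ) (t s : ℝ) : ℝ :=
  ∫ x, V Ω T v x t * V Ω T v x s
noncomputable def Df (Ω : Set (Fin d → ℝ)) (T : ℝ) (v : (Fin d → ℝ) → ℝ → ℝ) (t s : ℝ) : ℝ :=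
  ∫ x, ∑ i, P Ω T v i x t * P Ω T v i x s
noncomputable def Rf (Ω : Set (Fin d → ℝ)) (T : ℝ) (v : (Fin d → ℝ) → ℝ → ℝ) (t s : ℝ) : ℝ :=
  ∫ x, F Ω T v x t * V Ω T v x s
noncomputable def Qn (Ω : Set (Fin d → ℝ)) (T : ℝ) (v : (Fin d → ℝ) → ℝ → ℝ) (n : ℕ) (t s : ℝ) : ℝ :=
  ∫ x, V Ω T v x t * gg n (V Ω T v x s)
noncomputable def Dn (Ω : Set (Fin d → ℝ)) (T : ℝ) (v : (Fin d → ℝ) → ℝ → ℝ) (n : ℕ) (t s : ℝ) : ℝ :=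
  ∫ x, gam n (V Ω T v x s) * ∑ i, P Ω T v i x t * P Ω T v i x s
noncomputable def Rn (Ω : Set (Fin d → ℝ)) (T : ℝ) (v : (Fin d → ℝ) → ℝ → ℝ) (n : ℕ) (t s : ℝ) : ℝ :=
  ∫ x, F Ω T v x t * gg n (V Ω T v x s)

lemma Sol.F_sq (h : Sol Ω T C v) (x : Fin d → ℝ) (t : ℝ) :
    F Ω T v x t ^ 2 ≤ C ^ 2 * (1 + d) * (V Ω T v x t ^ 2 + ∑ i, P Ω T v i x t ^ 2) := by
  have hF := h.F_bound x t
  set a := V Ω T v x t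
  set p := fun i => P Ω T v i x t
  change |F Ω T v x t| ≤ C * (|a| + ∑ i, |p i|) at hF
  change F Ω T v x t ^ 2 ≤ C ^ 2 * (1 + d) * (a ^ 2 + ∑ i, p i ^ 2)
  have h1 : F Ω T v x t ^ 2 ≤ (C * (|a| + ∑ i, |p i|)) ^ 2 := by
    rw [← sq_abs]; exact pow_le_pow_left₀ (abs_nonneg _) hF 2
  have h2 : (∑ i, |p i|) ^ 2 ≤ d * ∑ i, p i ^ 2 := by
    have := sq_sum_le_card_mul_sum_sq (s := (Finset.univ : Finset (Fin d))) (f := fun i => |p i|)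
    simpa using this
  have h3 : 2 * |a| * ∑ i, |p i| ≤ d * a ^ 2 + ∑ i, p i ^ 2 := by
    have : ∑ i, 2 * |a| * |p i| ≤ ∑ i, (a ^ 2 + p i ^ 2) := Finset.sum_le_sum fun i _ => by
      have := sq_nonneg (|a| - |p i|)
      nlinarith [sq_abs a, sq_abs (p i)]
    rw [← Finset.mul_sum, Finset.sum_add_distrib] at this
    simpa using this
  have h4 : (|a| + ∑ i, |p i|) ^ 2 ≤ (1 + d) * (a ^ 2 + ∑ i, p i ^ 2) := by
    nlinarith [sq_abs a]
  calc _ ≤ _ := h1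
    _ = C ^ 2 * (|a| + ∑ i, |p i|) ^ 2 := by ring
    _ ≤ C ^ 2 * ((1 + d) * (a ^ 2 + ∑ i, p i ^ 2)) := by gcongr
    _ = _ := by ring

lemma young (a b : ℝ) : |a * b| ≤ (a ^ 2 + b ^ 2) / 2 := by
  rw [abs_mul]; nlinarith [sq_nonneg (|a| - |b|), sq_abs a, sq_abs b]

lemma sum_young (p r : Fin d → ℝ) : |∑ i, p i * r i| ≤ (∑ i, p i ^ 2 + ∑ i, r i ^ 2) / 2 := by
  refine (Finset.abs_sum_le_sum_abs _ _).trans ?_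
  rw [← Finset.sum_add_distrib, Finset.sum_div]
  exact Finset.sum_le_sum fun i _ => young _ _

lemma gg_sq (n : ℕ) (a : ℝ) : gg n a ^ 2 ≤ a ^ 2 := sq_le_sq.2 (gg_le' n a)

lemma gsum_young (n : ℕ) (a : ℝ) (p r : Fin d → ℝ) :
    |gam n a * ∑ i, p i * r i| ≤ (∑ i, p i ^ 2 + ∑ i, r i ^ 2) / 2 := by
  rw [abs_mul, abs_of_nonneg (gam_nonneg n a)]
  exact (mul_le_of_le_one_left (abs_nonneg _) (gam_le_one n a)).trans (sum_young p r)

/-- a time of finite energy -/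
def Fin2 (Ω : Set (Fin d → ℝ)) (T : ℝ) (v : (Fin d → ℝ) → ℝ → ℝ) (t : ℝ) : Prop :=
  Integrable (fun x => ∑ i, P Ω T v i x t ^ 2)

lemma Sol.F_sq_int (h : Sol Ω T C v) {t : ℝ} (ht : Fin2 Ω T v t) :
    Integrable (fun x => F Ω T v x t ^ 2) := by
  have hb : Integrable (fun x => C ^ 2 * (1 + d) * (V Ω T v x t ^ 2 + ∑ i, P Ω T v i x t ^ 2)) :=
    ((h.V_int2 t).add ht).const_mul _
  refine hb.mono' ((h.mF t).pow_const 2).aestronglyMeasurable (Eventually.of_forall fun x => ?_)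
  rw [Real.norm_eq_abs, abs_of_nonneg (sq_nonneg _)]
  exact h.F_sq x t

lemma Sol.F_sq_le (h : Sol Ω T C v) {t : ℝ} (ht : Fin2 Ω T v t) :
    ∫ x, F Ω T v x t ^ 2 ≤ C ^ 2 * (1 + d) * (q2 Ω T v t + e2 Ω T v t) := by
  unfold q2 e2
  rw [← integral_add (h.V_int2 t) ht, ← integral_const_mul]
  exact integral_mono (h.F_sq_int ht) (((h.V_int2 t).add ht).const_mul _) fun x => h.F_sq x t

lemma Sol.Qn_le (h : Sol Ω T C v) (n : ℕ) (t s : ℝ) :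
    |Qn Ω T v n t s| ≤ (q2 Ω T v t + q2 Ω T v s) / 2 := by
  unfold Qn q2
  rw [← integral_add (h.V_int2 t) (h.V_int2 s), ← integral_div, ← Real.norm_eq_abs]
  refine norm_integral_le_of_norm_le (((h.V_int2 t).add (h.V_int2 s)).div_const 2)
    (Eventually.of_forall fun x => ?_)
  refine (young _ _).trans ?_
  have := gg_sq n (V Ω T v x s)
  linarith

lemma Sol.Dn_le (n : ℕ) {t s : ℝ} (ht : Fin2 Ω T v t) (hs : Fin2 Ω T v s) :
    |Dn Ω T v n t s| ≤ (e2 Ω T v t + e2 Ω T v s) / 2 := by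
  unfold Dn e2
  rw [← integral_add ht hs, ← integral_div, ← Real.norm_eq_abs]
  refine norm_integral_le_of_norm_le ((ht.add hs).div_const 2)
    (Eventually.of_forall fun x => ?_)
  exact gsum_young _ _ _ _

lemma Sol.Rn_le (h : Sol Ω T C v) (n : ℕ) {t : ℝ} (s : ℝ) (ht : Fin2 Ω T v t) :
    |Rn Ω T v n t s| ≤ (C ^ 2 * (1 + d) * (q2 Ω T v t + e2 Ω T v t) + q2 Ω T v s) / 2 := by
  have h1 : |Rn Ω T v n t s| ≤ (∫ x, F Ω T v x t ^ 2 + V Ω T v x s ^ 2) / 2 := by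
    unfold Rn
    rw [← integral_div, ← Real.norm_eq_abs]
    refine norm_integral_le_of_norm_le (((h.F_sq_int ht).add (h.V_int2 s)).div_const 2)
      (Eventually.of_forall fun x => ?_)
    refine (young _ _).trans ?_
    have := gg_sq n (V Ω T v x s)
    linarith
  rw [integral_add (h.F_sq_int ht) (h.V_int2 s)] at h1
  have := h.F_sq_le ht
  unfold q2 at *; linarith

lemma Sol.Qn_tendsto (h : Sol Ω T C v) (t s : ℝ) :
    Tendsto (fun n => Qn Ω T v n t s) atTop (𝓝 (Qf Ω T v t s)) := by
  refine tendsto_integral_of_dominated_convergence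
    (fun x => (V Ω T v x t ^ 2 + V Ω T v x s ^ 2) / 2) (fun n => ?_)
    (((h.V_int2 t).add (h.V_int2 s)).div_const 2) (fun n => Eventually.of_forall fun x => ?_)
    (Eventually.of_forall fun x => (gg_tendsto _).const_mul _)
  · exact ((h.mV t).mul ((gg_cont n).measurable.comp (h.mV s))).aestronglyMeasurable
  · refine (young _ _).trans ?_
    have := gg_sq n (V Ω T v x s)
    linarith

lemma Sol.mPP (h : Sol Ω T C v) (t s : ℝ) :
    Measurable (fun x => ∑ i, P Ω T v i x t * P Ω T v i x s) :=
  Finset.measurable_fun_sum _ fun i _ => (h.mP i t).mul (h.mP i s)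

lemma Sol.Dn_tendsto (h : Sol Ω T C v) {t s : ℝ} (ht : Fin2 Ω T v t) (hs : Fin2 Ω T v s) :
    Tendsto (fun n => Dn Ω T v n t s) atTop (𝓝 (Df Ω T v t s)) := by
  refine tendsto_integral_of_dominated_convergence
    (fun x => (∑ i, P Ω T v i x t ^ 2 + ∑ i, P Ω T v i x s ^ 2) / 2) (fun n => ?_)
    ((ht.add hs).div_const 2) (fun n => Eventually.of_forall fun x => gsum_young _ _ _ _) ?_
  · exact (((gam_cont n).measurable.comp (h.mV s)).mul (h.mPP t s)).aestronglyMeasurable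
  · have hnull := ae_all_iff.2 fun i => h.null (t := s) i
    filter_upwards [hnull] with x hx
    by_cases hV : V Ω T v x s = 0
    · have : ∑ i, P Ω T v i x t * P Ω T v i x s = 0 := Finset.sum_eq_zero fun i _ => by rw [hx i hV]; simp
      rw [this]; simp
    · simpa using (gam_tendsto hV).mul_const (∑ i, P Ω T v i x t * P Ω T v i x s)

lemma Sol.Rn_tendsto (h : Sol Ω T C v) {t : ℝ} (s : ℝ) (ht : Fin2 Ω T v t) :
    Tendsto (fun n => Rn Ω T v n t s) atTop (𝓝 (Rf Ω T v t s)) := by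
  refine tendsto_integral_of_dominated_convergence
    (fun x => (F Ω T v x t ^ 2 + V Ω T v x s ^ 2) / 2) (fun n => ?_)
    (((h.F_sq_int ht).add (h.V_int2 s)).div_const 2) (fun n => Eventually.of_forall fun x => ?_)
    (Eventually.of_forall fun x => (gg_tendsto _).const_mul _)
  · exact ((h.mF t).mul ((gg_cont n).measurable.comp (h.mV s))).aestronglyMeasurable
  · refine (young _ _).trans ?_
    have := gg_sq n (V Ω T v x s)
    linarith

lemma Sol.mQn (h : Sol Ω T C v) (n : ℕ) (s : ℝ) : Measurable (fun t => Qn Ω T v n t s) := by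
  have : Measurable (fun z : (Fin d → ℝ) × ℝ => V Ω T v z.1 z.2 * gg n (V Ω T v z.1 s)) :=
    h.measV.mul ((gg_cont n).measurable.comp ((h.mV s).comp measurable_fst))
  exact (StronglyMeasurable.integral_prod_left' (μ := volume) this.stronglyMeasurable).measurable

lemma Sol.mRn (h : Sol Ω T C v) (n : ℕ) (s : ℝ) : Measurable (fun t => Rn Ω T v n t s) := by
  have : Measurable (fun z : (Fin d → ℝ) × ℝ => F Ω T v z.1 z.2 * gg n (V Ω T v z.1 s)) :=
    h.measF.mul ((gg_cont n).measurable.comp ((h.mV s).comp measurable_fst))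
  exact (StronglyMeasurable.integral_prod_left' (μ := volume) this.stronglyMeasurable).measurable

lemma Sol.mDn (h : Sol Ω T C v) (n : ℕ) (s : ℝ) : Measurable (fun t => Dn Ω T v n t s) := by
  have : Measurable (fun z : (Fin d → ℝ) × ℝ => gam n (V Ω T v z.1 s) * ∑ i, P Ω T v i z.1 z.2 * P Ω T v i z.1 s) :=
    ((gam_cont n).measurable.comp ((h.mV s).comp measurable_fst)).mul
      (Finset.measurable_fun_sum _ fun i _ => (h.measP i).mul ((h.mP i s).comp measurable_fst))
  exact (StronglyMeasurable.integral_prod_left' (μ := volume) this.stronglyMeasurable).measurable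

end BU

namespace BU

open Filter Topology

variable {d : ℕ}
variable {Ω : Set (Fin d → ℝ)} {T C : ℝ} {v : (Fin d → ℝ) → ℝ → ℝ}

lemma Sol.F3_bound (h : Sol Ω T C v) {t0 : ℝ} (ht0 : t0 ∈ Ioo 0 T) {s : ℝ} (hs2 : Fin2 Ω T v s)
    {ω ω' : ℝ → ℝ} {A : ℝ} (hA : ∀ t ∈ Icc t0 T, |ω t| ≤ A ∧ |ω' t| ≤ A) (n : ℕ) :
    ∀ᵐ t ∂(volume.restrict (Ioo t0 T)),
      ‖ω' t * Qn Ω T v n t s + ω t * (Rn Ω T v n t s - Dn Ω T v n t s)‖ ≤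
      A * (((q2 Ω T v t + q2 Ω T v s) / 2) + ((C ^ 2 * (1 + d) * (q2 Ω T v t + e2 Ω T v t) + q2 Ω T v s) / 2
        + (e2 Ω T v t + e2 Ω T v s) / 2)) := by
  filter_upwards [h.grad_ae ht0, ae_restrict_mem measurableSet_Ioo] with t ht htm
  have hA' := hA t (Ioo_subset_Icc_self htm)
  have a0 : 0 ≤ A := (abs_nonneg _).trans hA'.1
  have b1 := h.Qn_le n t s
  have b2 := Sol.Dn_le n ht hs2
  have b3 := h.Rn_le n s ht
  rw [mul_add]
  refine (norm_add_le _ _).trans (add_le_add ?_ ?_)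
  · rw [Real.norm_eq_abs, abs_mul]
    exact mul_le_mul hA'.2 b1 (abs_nonneg _) a0
  · rw [Real.norm_eq_abs, abs_mul]
    exact mul_le_mul hA'.1 ((abs_sub _ _).trans (add_le_add b3 b2)) (abs_nonneg _) a0

lemma Sol.F3_bound_int (h : Sol Ω T C v) {t0 : ℝ} (ht0 : t0 ∈ Ioo 0 T) (s A : ℝ) :
    IntegrableOn (fun t => A * (((q2 Ω T v t + q2 Ω T v s) / 2) + ((C ^ 2 * (1 + d) * (q2 Ω T v t + e2 Ω T v t) + q2 Ω T v s) / 2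
        + (e2 Ω T v t + e2 Ω T v s) / 2))) (Ioo t0 T) := by
  have h1 : IntegrableOn (q2 Ω T v) (Ioo t0 T) := by
    have := (h.q2_int ht0.1 (w := fun _ => 1) continuous_const).mono_set Ioo_subset_Icc_self
    simpa using this
  have h2 := h.e2_int ht0
  have hc : ∀ c : ℝ, IntegrableOn (fun _ : ℝ => c) (Ioo t0 T) := fun c =>
    integrableOn_const measure_Ioo_lt_top.ne
  exact ((((h1.add (hc _)).div_const 2)).add (((((h1.add h2).const_mul _).add (hc _)).div_const 2).add
    ((h2.add (hc _)).div_const 2))).const_mul A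

lemma Sol.F3 (h : Sol Ω T C v) {t0 : ℝ} (ht0 : t0 ∈ Ioo 0 T) {s : ℝ} (hs : s ∈ Ioo t0 T)
    (hs2 : Fin2 Ω T v s) {ω ω' : ℝ → ℝ}
    (hω : ∀ t, HasDerivAt ω (ω' t) t) (hω' : Continuous ω') {t1 t2 : ℝ} (h01 : t0 ≤ t1)
    (h12 : t1 ≤ t2) (h2T : t2 ≤ T) :
    ω t2 * Qf Ω T v t2 s - ω t1 * Qf Ω T v t1 s =
      ∫ t in t1..t2, (ω' t * Qf Ω T v t s + ω t * (Rf Ω T v t s - Df Ω T v t s)) := by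
  have hωc : Continuous ω := continuous_iff_continuousAt.2 fun s => (hω s).continuousAt
  have hsT : s ∈ Ioo 0 T := ⟨ht0.1.trans hs.1, hs.2⟩
  have hsI : s ∈ Icc t0 T := Ioo_subset_Icc_self hs
  obtain ⟨A1, hA1⟩ := (isCompact_Icc (a := t0) (b := T)).exists_bound_of_continuousOn hωc.continuousOn
  obtain ⟨A2, hA2⟩ := (isCompact_Icc (a := t0) (b := T)).exists_bound_of_continuousOn hω'.continuousOn
  have hA : ∀ t ∈ Icc t0 T, |ω t| ≤ max A1 A2 ∧ |ω' t| ≤ max A1 A2 := fun t ht =>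
    ⟨(hA1 t ht).trans (le_max_left _ _), (hA2 t ht).trans (le_max_right _ _)⟩
  have hsub : Ioo t1 t2 ⊆ Ioo t0 T := Ioo_subset_Ioo h01 h2T
  have hrest : volume.restrict (Ioc t1 t2) ≤ volume.restrict (Ioo t0 T) := by
    rw [restrict_Ioo_eq_restrict_Ioc.symm]
    exact Measure.restrict_mono hsub le_rfl
  have hmeas : ∀ n, Measurable (fun t => ω' t * Qn Ω T v n t s + ω t * (Rn Ω T v n t s - Dn Ω T v n t s)) :=
    fun n => (hω'.measurable.mul (h.mQn n s)).add (hωc.measurable.mul ((h.mRn n s).sub (h.mDn n s)))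
  have hbi : IntervalIntegrable (fun t => max A1 A2 * (((q2 Ω T v t + q2 Ω T v s) / 2) + ((C ^ 2 * (1 + d) * (q2 Ω T v t + e2 Ω T v t) + q2 Ω T v s) / 2
        + (e2 Ω T v t + e2 Ω T v s) / 2))) volume t1 t2 := by
    rw [intervalIntegrable_iff_integrableOn_Ioc_of_le h12]
    exact Integrable.mono_measure (h.F3_bound_int ht0 s _) hrest
  have step : ∀ n, ω t2 * Qn Ω T v n t2 s - ω t1 * Qn Ω T v n t1 s =
      ∫ t in t1..t2, (ω' t * Qn Ω T v n t s + ω t * (Rn Ω T v n t s - Dn Ω T v n t s)) := by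
    intro n
    obtain ⟨K, g⟩ := h.exists_good ht0.1 n
    have hζ := h.zeta_contDiff g hsI hsT
    have hQ : ∀ t ∈ Icc t0 T, ∫ x in K, v x t * gg n (V Ω T v x s) = Qn Ω T v n t s := by
      intro t ht
      have e0 : Qn Ω T v n t s = ∫ x in K, V Ω T v x t * gg n (V Ω T v x s) :=
        (setIntegral_eq_integral_of_forall_compl_eq_zero (fun x hx => by rw [g.gg_off hsI x hx, mul_zero])).symm
      rw [e0]
      refine setIntegral_congr_fun g.cpt.measurableSet fun x hx => ?_
      rcases eq_or_lt_of_le ht.2 with e | e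
      · have h1 : V Ω T v x t = 0 := V_out' (fun hh => absurd hh.2 (by simp [e]))
        have h2 : v x t = 0 := by rw [e]; exact h.fin x (subset_closure (g.sub hx))
        simp only [h1, h2]
      · simp only [V_eq (g.sub hx) (show t ∈ Ioo 0 T from ⟨lt_of_lt_of_le ht0.1 ht.1, e⟩)]
    have hc : ContinuousOn (fun t => ω t * ∫ x in K, v x t * gg n (V Ω T v x s)) (Icc t0 T) :=
      hωc.continuousOn.mul (h.contInt ht0.1 g.cpt g.sub (f := fun y => y) continuous_id hζ.continuous.continuousOn)
    have hd : ∀ t ∈ Ioo t0 T, HasDerivWithinAt (fun t => ω t * ∫ x in K, v x t * gg n (V Ω T v x s))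
        (ω' t * Qn Ω T v n t s + ω t * (Rn Ω T v n t s - Dn Ω T v n t s)) (Ioi t) t := by
      intro t ht
      have htT : t ∈ Ioo 0 T := ⟨ht0.1.trans ht.1, ht.2⟩
      have r1 := (hω t).hasDerivWithinAt.mul (h.right_deriv htT g.cpt g.sub (f := fun y => y) (f' := fun _ => 1)
        (fun y => hasDerivAt_id y) continuous_const hζ.continuous.continuousOn)
      rw [hQ t (Ioo_subset_Icc_self ht)] at r1
      refine r1.congr_deriv ?_
      congr 2
      simp only [one_mul]
      rw [h.key g hsI hsT htT]
      have i1 : IntegrableOn (fun x => F Ω T v x t * gg n (V Ω T v x s)) K :=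
        (h.F_int g.cpt g.sub htT).mul_continuousOn hζ.continuous.continuousOn g.cpt
      have i3 : IntegrableOn (fun x => gam n (V Ω T v x s) * ∑ i, P Ω T v i x t * P Ω T v i x s) K := by
        refine ContinuousOn.integrableOn_compact g.cpt ?_
        exact ((gam_cont n).comp_continuousOn (h.V_cont g.sub hsT)).mul
          (continuousOn_finsetSum _ fun i _ => (h.P_cont g.sub htT i).mul (h.P_cont g.sub hsT i))
      rw [integral_sub i1 i3, setIntegral_eq_integral_of_forall_compl_eq_zero (fun x hx => by rw [g.gg_off hsI x hx, mul_zero]),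
        setIntegral_eq_integral_of_forall_compl_eq_zero (fun x hx => by rw [g.gam_off hsI x hx, zero_mul])]
      rfl
    have hIntg : IntervalIntegrable (fun t => ω' t * Qn Ω T v n t s + ω t * (Rn Ω T v n t s - Dn Ω T v n t s)) volume t1 t2 := by
      rw [intervalIntegrable_iff_integrableOn_Ioc_of_le h12]
      have : IntegrableOn (fun t => ω' t * Qn Ω T v n t s + ω t * (Rn Ω T v n t s - Dn Ω T v n t s)) (Ioo t0 T) :=
        (h.F3_bound_int ht0 s _).mono' (hmeas n).aestronglyMeasurable (h.F3_bound ht0 hs2 hA n)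
      exact Integrable.mono_measure this hrest
    rw [intervalIntegral.integral_eq_sub_of_hasDeriv_right_of_le h12 (hc.mono (Icc_subset_Icc h01 h2T))
      (fun t ht => hd t (hsub ht)) hIntg, hQ t2 ⟨h01.trans h12, h2T⟩, hQ t1 ⟨h01, h12.trans h2T⟩]
  have lim1 : Tendsto (fun n => ω t2 * Qn Ω T v n t2 s - ω t1 * Qn Ω T v n t1 s) atTop
      (𝓝 (ω t2 * Qf Ω T v t2 s - ω t1 * Qf Ω T v t1 s)) :=
    ((h.Qn_tendsto t2 s).const_mul _).sub ((h.Qn_tendsto t1 s).const_mul _)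
  have lim2 : Tendsto (fun n => ∫ t in t1..t2, (ω' t * Qn Ω T v n t s + ω t * (Rn Ω T v n t s - Dn Ω T v n t s))) atTop
      (𝓝 (∫ t in t1..t2, (ω' t * Qf Ω T v t s + ω t * (Rf Ω T v t s - Df Ω T v t s)))) := by
    refine intervalIntegral.tendsto_integral_filter_of_dominated_convergence _
      (Eventually.of_forall fun n => (hmeas n).aestronglyMeasurable)
      (Eventually.of_forall fun n => ?_) hbi ?_
    · rw [uIoc_of_le h12, ← ae_restrict_iff' measurableSet_Ioc]
      exact (Measure.absolutelyContinuous_of_le hrest).ae_le (h.F3_bound ht0 hs2 hA n)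
    · rw [uIoc_of_le h12, ← ae_restrict_iff' measurableSet_Ioc]
      refine (Measure.absolutelyContinuous_of_le hrest).ae_le ?_
      filter_upwards [h.grad_ae ht0] with t ht
      exact ((h.Qn_tendsto t s).const_mul _).add
        (((h.Rn_tendsto s ht).sub (h.Dn_tendsto ht hs2)).const_mul _)
  simp only [step] at lim1
  exact tendsto_nhds_unique lim1 lim2

end BU

namespace BU

open Filter Topology

/-- the scalar data extracted from a solution -/
structure Abs (t0 T c1 C1 Mq : ℝ) (q e : ℝ → ℝ) (Q D R : ℝ → ℝ → ℝ) : Prop where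
  lt : t0 < T
  c10 : 0 ≤ c1
  C10 : 0 ≤ C1
  q0 : ∀ t, 0 ≤ q t
  e0 : ∀ t, 0 ≤ e t
  qm : Measurable q
  em : Measurable e
  qb : ∀ t ∈ Icc t0 T, q t ≤ Mq
  ei : IntegrableOn e (Ioo t0 T)
  Qm : Measurable (fun z : ℝ × ℝ => Q z.1 z.2)
  Dm : Measurable (fun z : ℝ × ℝ => D z.1 z.2)
  Rm : Measurable (fun z : ℝ × ℝ => R z.1 z.2)
  Qs : ∀ t s, Q t s = Q s t
  Ds : ∀ t s, D t s = D s t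
  Qd : ∀ s, Q s s = q s
  Qb : ∀ t s, |Q t s| ≤ √(q t) * √(q s)
  Rb : ∀ᵐ t ∂(volume.restrict (Ioo t0 T)), ∀ s, |R t s| ≤ √(c1 * (q t + e t)) * √(q s)
  Db : ∀ᵐ t ∂(volume.restrict (Ioo t0 T)), ∀ᵐ s ∂(volume.restrict (Ioo t0 T)), |D t s| ≤ (e t + e s) / 2
  QT : ∀ s, Q T s = 0
  F3 : ∀ᵐ s ∂(volume.restrict (Ioo t0 T)), ∀ ω ω' : ℝ → ℝ, (∀ t, HasDerivAt ω (ω' t) t) → Continuous ω' →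
    ∀ t1 t2, t0 ≤ t1 → t1 ≤ t2 → t2 ≤ T →
    ω t2 * Q t2 s - ω t1 * Q t1 s = ∫ t in t1..t2, (ω' t * Q t s + ω t * (R t s - D t s))
  En : ∀ W W' : ℝ → ℝ, (∀ t, HasDerivAt W (W' t) t) → Continuous W' → (∀ t, 0 ≤ W t) → W t0 = 0 →
    ∫ t in Ioo t0 T, W t * e t ≤ ∫ t in Ioo t0 T, (|W' t| + 2 * C1 * W t) * q t

section
variable {t0 T c1 C1 Mq : ℝ} {q e : ℝ → ℝ} {Q D R : ℝ → ℝ → ℝ}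

noncomputable def sg (t s : ℝ) : ℝ := if t < s then 1 else if s < t then -1 else 0

lemma sg_anti (t s : ℝ) : sg s t = - sg t s := by
  unfold sg
  rcases lt_trichotomy t s with h | h | h
  · simp [h, h.not_gt]
  · simp [h]
  · simp [h, h.not_gt]

lemma sg_abs (t s : ℝ) : |sg t s| ≤ 1 := by
  unfold sg; split_ifs <;> simp

lemma sg_meas : Measurable (fun z : ℝ × ℝ => sg z.1 z.2) := by
  unfold sg
  exact Measurable.ite (measurableSet_lt measurable_fst measurable_snd) measurable_const
    (Measurable.ite (measurableSet_lt measurable_snd measurable_fst) measurable_const measurable_const)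

/-- the two-point weight -/
noncomputable def wt (t0 lam t s : ℝ) : ℝ := Real.exp (lam * ((t + s) / 2 - t0) ^ 2)

noncomputable def AA (t0 lam : ℝ) (Q D : ℝ → ℝ → ℝ) (t s : ℝ) : ℝ :=
  (s - t0) * (t - t0) * wt t0 lam t s * (lam * ((t + s) / 2 - t0) * Q t s - D t s)

noncomputable def HH (t0 lam : ℝ) (Q R : ℝ → ℝ → ℝ) (t s : ℝ) : ℝ :=
  (s - t0) * wt t0 lam t s * (Q t s + (t - t0) * R t s)

lemma wt_symm (lam t s : ℝ) : wt t0 lam t s = wt t0 lam s t := by unfold wt; rw [add_comm]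

lemma wt_deriv (lam s t : ℝ) : HasDerivAt (fun t => (t - t0) * wt t0 lam t s)
    (wt t0 lam t s + (t - t0) * (lam * ((t + s) / 2 - t0)) * wt t0 lam t s) t := by
  unfold wt
  have h1 : HasDerivAt (fun t : ℝ => (t + s) / 2 - t0) (1 / 2) t :=
    (((hasDerivAt_id t).add_const s).div_const 2).sub_const t0
  have h2 := ((h1.pow 2).const_mul lam).exp
  have h3 := ((hasDerivAt_id t).sub_const t0).mul h2
  refine h3.congr_deriv ?_
  simp; ring

lemma Abs.AA_int (h : Abs t0 T c1 C1 Mq q e Q D R) (lam : ℝ) :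
    Integrable (fun z : ℝ × ℝ => AA t0 lam Q D z.1 z.2)
      ((volume.restrict (Ioo t0 T)).prod (volume.restrict (Ioo t0 T))) := by
  set μ := volume.restrict (Ioo t0 T) with hμ
  have hfin : IsFiniteMeasure μ := ⟨by simp [hμ]⟩
  have c1' : Continuous (fun z : ℝ × ℝ => (z.2 - t0) * (z.1 - t0) * wt t0 lam z.1 z.2) := by
    unfold wt; fun_prop
  have c2' : Continuous (fun z : ℝ × ℝ => lam * ((z.1 + z.2) / 2 - t0)) := by fun_prop
  have hcpt : IsCompact (Icc t0 T ×ˢ Icc t0 T) := isCompact_Icc.prod isCompact_Icc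
  obtain ⟨A1, hA1⟩ := hcpt.exists_bound_of_continuousOn c1'.continuousOn
  obtain ⟨A2, hA2⟩ := hcpt.exists_bound_of_continuousOn c2'.continuousOn
  have hb : Integrable (fun z : ℝ × ℝ => |A1| * (|A2| * Mq + (e z.1 + e z.2) / 2)) (μ.prod μ) :=
    ((integrable_const _).add (((h.ei.comp_fst μ).add (h.ei.comp_snd μ)).div_const 2)).const_mul _
  have hD : ∀ᵐ z ∂(μ.prod μ), |D z.1 z.2| ≤ (e z.1 + e z.2) / 2 := by
    refine (Measure.ae_prod_iff_ae_ae ?_).2 h.Db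
    exact measurableSet_le h.Dm.abs (((h.em.comp measurable_fst).add (h.em.comp measurable_snd)).div_const 2)
  have hmem : ∀ᵐ z ∂(μ.prod μ), z ∈ Ioo t0 T ×ˢ Ioo t0 T := by
    rw [hμ, Measure.prod_restrict]; exact ae_restrict_mem (measurableSet_Ioo.prod measurableSet_Ioo)
  refine hb.mono' ?_ ?_
  · unfold AA
    exact (c1'.measurable.mul ((c2'.measurable.mul h.Qm).sub h.Dm)).aestronglyMeasurable
  · filter_upwards [hD, hmem] with z hz hm
    have hm' : z ∈ Icc t0 T ×ˢ Icc t0 T := ⟨Ioo_subset_Icc_self hm.1, Ioo_subset_Icc_self hm.2⟩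
    have a1 := (hA1 z hm').trans (le_abs_self _)
    have a2 := (hA2 z hm').trans (le_abs_self _)
    have hQ : |Q z.1 z.2| ≤ Mq := by
      refine (h.Qb _ _).trans ?_
      have := h.qb _ hm'.1
      have hM : 0 ≤ Mq := (h.q0 _).trans this
      calc _ ≤ √Mq * √Mq := mul_le_mul (Real.sqrt_le_sqrt this) (Real.sqrt_le_sqrt (h.qb _ hm'.2)) (Real.sqrt_nonneg _) (Real.sqrt_nonneg _)
        _ = Mq := Real.mul_self_sqrt hM
    unfold AA
    rw [norm_mul]
    refine mul_le_mul a1 ?_ (norm_nonneg _) (abs_nonneg _)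
    refine (norm_sub_le _ _).trans (add_le_add ?_ hz)
    rw [norm_mul]
    exact mul_le_mul a2 hQ (norm_nonneg _) (abs_nonneg _)

lemma Abs.HH_int (h : Abs t0 T c1 C1 Mq q e Q D R) (lam : ℝ) :
    Integrable (fun z : ℝ × ℝ => HH t0 lam Q R z.1 z.2)
      ((volume.restrict (Ioo t0 T)).prod (volume.restrict (Ioo t0 T))) := by
  set μ := volume.restrict (Ioo t0 T) with hμ
  have hfin : IsFiniteMeasure μ := ⟨by simp [hμ]⟩
  have c1' : Continuous (fun z : ℝ × ℝ => (z.2 - t0) * wt t0 lam z.1 z.2) := by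
    unfold wt; fun_prop
  have hcpt : IsCompact (Icc t0 T ×ˢ Icc t0 T) := isCompact_Icc.prod isCompact_Icc
  obtain ⟨A1, hA1⟩ := hcpt.exists_bound_of_continuousOn c1'.continuousOn
  have hb : Integrable (fun z : ℝ × ℝ => |A1| * (Mq + (T - t0) * ((c1 * (Mq + e z.1) + Mq) / 2))) (μ.prod μ) :=
    ((integrable_const _).add ((((((integrable_const _).add (h.ei.comp_fst μ)).const_mul c1).add
      (integrable_const _)).div_const 2).const_mul _)).const_mul _
  have hR : ∀ᵐ z ∂(μ.prod μ), |R z.1 z.2| ≤ √(c1 * (q z.1 + e z.1)) * √(q z.2) := by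
    refine (Measure.ae_prod_iff_ae_ae ?_).2 ?_
    · exact measurableSet_le h.Rm.abs
        ((((h.qm.comp measurable_fst).add (h.em.comp measurable_fst)).const_mul c1).sqrt.mul (h.qm.comp measurable_snd).sqrt)
    · filter_upwards [h.Rb] with t ht using Eventually.of_forall ht
  have hmem : ∀ᵐ z ∂(μ.prod μ), z ∈ Ioo t0 T ×ˢ Ioo t0 T := by
    rw [hμ, Measure.prod_restrict]; exact ae_restrict_mem (measurableSet_Ioo.prod measurableSet_Ioo)
  refine hb.mono' ?_ ?_
  · unfold HH
    exact (c1'.measurable.mul (h.Qm.add ((measurable_fst.sub_const t0).mul h.Rm))).aestronglyMeasurable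
  · filter_upwards [hR, hmem] with z hz hm
    have hm' : z ∈ Icc t0 T ×ˢ Icc t0 T := ⟨Ioo_subset_Icc_self hm.1, Ioo_subset_Icc_self hm.2⟩
    have a1 := (hA1 z hm').trans (le_abs_self _)
    have q1 := h.qb _ hm'.1
    have q2 := h.qb _ hm'.2
    have hM : 0 ≤ Mq := (h.q0 _).trans q1
    have hQ : |Q z.1 z.2| ≤ Mq := by
      refine (h.Qb _ _).trans ?_
      calc _ ≤ √Mq * √Mq := mul_le_mul (Real.sqrt_le_sqrt q1) (Real.sqrt_le_sqrt q2) (Real.sqrt_nonneg _) (Real.sqrt_nonneg _)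
        _ = Mq := Real.mul_self_sqrt hM
    have hce : 0 ≤ c1 * (q z.1 + e z.1) := mul_nonneg h.c10 (add_nonneg (h.q0 _) (h.e0 _))
    have hR2 : |R z.1 z.2| ≤ (c1 * (Mq + e z.1) + Mq) / 2 := by
      refine hz.trans ?_
      have := sq_nonneg (√(c1 * (q z.1 + e z.1)) - √(q z.2))
      have e1 := Real.sq_sqrt hce
      have e2 := Real.sq_sqrt (h.q0 z.2)
      have := mul_le_mul_of_nonneg_left q1 h.c10
      nlinarith
    unfold HH
    rw [norm_mul]
    refine mul_le_mul a1 ?_ (norm_nonneg _) (abs_nonneg _)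
    refine (norm_add_le _ _).trans (add_le_add hQ ?_)
    rw [norm_mul]
    refine mul_le_mul ?_ hR2 (norm_nonneg _) (by linarith [h.lt])
    rw [Real.norm_eq_abs, abs_of_nonneg (by linarith [hm'.1.1])]
    linarith [hm'.1.2]

lemma sg_int {μ : Measure (ℝ × ℝ)} {f : ℝ × ℝ → ℝ} (hf : Integrable f μ) :
    Integrable (fun z => sg z.1 z.2 * f z) μ :=
  hf.bdd_mul (c := 1) sg_meas.aestronglyMeasurable (Eventually.of_forall fun z => sg_abs z.1 z.2)

lemma Abs.identity (h : Abs t0 T c1 C1 Mq q e Q D R) (lam : ℝ) :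
    ∫ s in Ioo t0 T, 2 * ((s - t0) ^ 2 * Real.exp (lam * (s - t0) ^ 2) * q s) =
      ∫ z, sg z.1 z.2 * HH t0 lam Q R z.1 z.2
        ∂((volume.restrict (Ioo t0 T)).prod (volume.restrict (Ioo t0 T))) := by
  have hAi := h.AA_int lam
  have hHi := h.HH_int lam
  set μ := volume.restrict (Ioo t0 T) with hμ
  have hfin : IsFiniteMeasure μ := ⟨by simp [hμ]⟩
  have hA0 : ∫ z, sg z.1 z.2 * AA t0 lam Q D z.1 z.2 ∂(μ.prod μ) = 0 := by
    have h1 := integral_prod_swap (μ := μ) (ν := μ) (fun z : ℝ × ℝ => sg z.1 z.2 * AA t0 lam Q D z.1 z.2)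
    have h2 : ∀ z : ℝ × ℝ, sg z.swap.1 z.swap.2 * AA t0 lam Q D z.swap.1 z.swap.2
        = - (sg z.1 z.2 * AA t0 lam Q D z.1 z.2) := by
      intro z
      simp only [Prod.fst_swap, Prod.snd_swap]
      rw [sg_anti]
      unfold AA
      rw [wt_symm, h.Qs, h.Ds, add_comm z.2 z.1]; ring
    simp only [h2] at h1
    rw [integral_neg] at h1
    linarith
  have hs : ∀ᵐ s ∂μ, 2 * ((s - t0) ^ 2 * Real.exp (lam * (s - t0) ^ 2) * q s) =
      ∫ t, sg t s * (AA t0 lam Q D t s + HH t0 lam Q R t s) ∂μ := by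
    filter_upwards [h.F3, (hAi.add hHi).prod_left_ae, (sg_int (hAi.add hHi)).prod_left_ae,
      ae_restrict_mem measurableSet_Ioo] with s hF hi hi2 hsm
    have G : ∀ t, (s - t0) * ((wt t0 lam t s + (t - t0) * (lam * ((t + s) / 2 - t0)) * wt t0 lam t s) * Q t s
        + (t - t0) * wt t0 lam t s * (R t s - D t s)) = AA t0 lam Q D t s + HH t0 lam Q R t s := by
      intro t; unfold AA HH; ring
    have hF' := hF (fun t => (t - t0) * wt t0 lam t s) _ (wt_deriv lam s) (by unfold wt; fun_prop)
    have f1 := hF' t0 s le_rfl hsm.1.le hsm.2.le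
    have f2 := hF' s T hsm.1.le hsm.2.le le_rfl
    have g1 : (s - t0) * ((s - t0) * wt t0 lam s s * q s) = ∫ t in t0..s, (AA t0 lam Q D t s + HH t0 lam Q R t s) := by
      simp only [← G]
      rw [intervalIntegral.integral_const_mul, ← f1, h.Qd]; simp
    have g2 : - ((s - t0) * ((s - t0) * wt t0 lam s s * q s)) = ∫ t in s..T, (AA t0 lam Q D t s + HH t0 lam Q R t s) := by
      simp only [← G]
      rw [intervalIntegral.integral_const_mul, ← f2, h.Qd, h.QT]; ring
    have hw : wt t0 lam s s = Real.exp (lam * (s - t0) ^ 2) := by unfold wt; congr 2; ring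
    have hI : IntervalIntegrable (fun t => sg t s * (AA t0 lam Q D t s + HH t0 lam Q R t s)) volume t0 T := by
      rw [intervalIntegrable_iff_integrableOn_Ioo_of_le h.lt.le]; exact hi2
    have e1 : ∫ t, sg t s * (AA t0 lam Q D t s + HH t0 lam Q R t s) ∂μ
        = (∫ t in t0..s, sg t s * (AA t0 lam Q D t s + HH t0 lam Q R t s))
         + ∫ t in s..T, sg t s * (AA t0 lam Q D t s + HH t0 lam Q R t s) := by
      have m1 : IntervalIntegrable (fun t => sg t s * (AA t0 lam Q D t s + HH t0 lam Q R t s)) volume t0 s :=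
        hI.mono_set (by rw [uIcc_of_le hsm.1.le, uIcc_of_le h.lt.le]; exact Icc_subset_Icc le_rfl hsm.2.le)
      have m2 : IntervalIntegrable (fun t => sg t s * (AA t0 lam Q D t s + HH t0 lam Q R t s)) volume s T :=
        hI.mono_set (by rw [uIcc_of_le hsm.2.le, uIcc_of_le h.lt.le]; exact Icc_subset_Icc hsm.1.le le_rfl)
      rw [intervalIntegral.integral_add_adjacent_intervals m1 m2,
        intervalIntegral.integral_of_le h.lt.le, integral_Ioc_eq_integral_Ioo]
    have e2 : ∫ t in t0..s, sg t s * (AA t0 lam Q D t s + HH t0 lam Q R t s)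
        = ∫ t in t0..s, (AA t0 lam Q D t s + HH t0 lam Q R t s) := by
      rw [intervalIntegral.integral_of_le hsm.1.le, intervalIntegral.integral_of_le hsm.1.le,
        integral_Ioc_eq_integral_Ioo, integral_Ioc_eq_integral_Ioo]
      refine setIntegral_congr_fun measurableSet_Ioo fun t ht => ?_
      have : sg t s = 1 := by unfold sg; rw [if_pos ht.2]
      simp only [this, one_mul]
    have e3 : ∫ t in s..T, sg t s * (AA t0 lam Q D t s + HH t0 lam Q R t s)
        = - ∫ t in s..T, (AA t0 lam Q D t s + HH t0 lam Q R t s) := by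
      rw [intervalIntegral.integral_of_le hsm.2.le, intervalIntegral.integral_of_le hsm.2.le,
        integral_Ioc_eq_integral_Ioo, integral_Ioc_eq_integral_Ioo, ← integral_neg]
      refine setIntegral_congr_fun measurableSet_Ioo fun t ht => ?_
      have : sg t s = -1 := by unfold sg; rw [if_neg ht.1.not_gt, if_pos ht.1]
      simp only [this, neg_mul, one_mul]
    rw [e1, e2, e3, ← g1, ← g2, hw]; ring
  rw [integral_congr_ae hs]
  have hsum := integral_prod_symm _ (sg_int (hAi.add hHi))
  simp only [Pi.add_apply] at hsum
  rw [← hsum]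
  simp only [mul_add]
  rw [integral_add (sg_int hAi) (sg_int hHi), hA0, zero_add]

end
end BU

namespace BU

open Filter Topology

section
variable {t0 T c1 C1 Mq : ℝ} {q e : ℝ → ℝ} {Q D R : ℝ → ℝ → ℝ}

/-- the Gaussian kernel -/
noncomputable def gk (lam t s : ℝ) : ℝ := Real.exp (-(lam / 4) * (t - s) ^ 2)

lemma gk_symm (lam t s : ℝ) : gk lam t s = gk lam s t := by
  unfold gk; congr 1; ring

lemma gk_pos (lam t s : ℝ) : 0 < gk lam t s := Real.exp_pos _

lemma gk_le {lam : ℝ} (hl : 0 < lam) (t s : ℝ) : gk lam t s ≤ 1 := by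
  unfold gk
  rw [Real.exp_le_one_iff]
  have := mul_nonneg (show 0 ≤ lam / 4 by positivity) (sq_nonneg (t - s))
  linarith

lemma gk_int {lam : ℝ} (hl : 0 < lam) (t : ℝ) (S : Set ℝ) :
    ∫ s in S, gk lam t s ≤ √(Real.pi / (lam / 4)) := by
  have hi : Integrable (fun s => gk lam t s) := by
    have := (integrable_exp_neg_mul_sq (show 0 < lam / 4 by positivity)).comp_sub_left t
    exact this
  calc _ ≤ ∫ s, gk lam t s := setIntegral_le_integral hi (ae_of_all _ fun s => (gk_pos _ _ _).le)
    _ = ∫ s, Real.exp (-(lam / 4) * s ^ 2) := integral_sub_left_eq_self (fun s => Real.exp (-(lam / 4) * s ^ 2)) volume t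
    _ = _ := integral_gaussian _

lemma gk_prod {lam : ℝ} (hl : 0 < lam) {g : ℝ → ℝ} (hg0 : ∀ t, 0 ≤ g t)
    (hg : IntegrableOn g (Ioo t0 T)) :
    Integrable (fun z : ℝ × ℝ => g z.1 * gk lam z.1 z.2)
      ((volume.restrict (Ioo t0 T)).prod (volume.restrict (Ioo t0 T))) ∧
    ∫ z, g z.1 * gk lam z.1 z.2 ∂((volume.restrict (Ioo t0 T)).prod (volume.restrict (Ioo t0 T)))
      ≤ √(Real.pi / (lam / 4)) * ∫ t in Ioo t0 T, g t := by
  set μ := volume.restrict (Ioo t0 T) with hμ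
  have hfin : IsFiniteMeasure μ := ⟨by simp [hμ]⟩
  have hk : Continuous (fun z : ℝ × ℝ => gk lam z.1 z.2) := by unfold gk; fun_prop
  have hi : Integrable (fun z : ℝ × ℝ => g z.1 * gk lam z.1 z.2) (μ.prod μ) := by
    refine (hg.comp_fst μ).mul_bdd (c := 1) hk.aestronglyMeasurable (ae_of_all _ fun z => ?_)
    rw [Real.norm_eq_abs, abs_of_pos (gk_pos _ _ _)]; exact gk_le hl _ _
  refine ⟨hi, ?_⟩
  rw [integral_prod _ hi, ← integral_const_mul]
  refine integral_mono hi.integral_prod_left (Integrable.const_mul hg _) fun t => ?_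
  simp only
  rw [integral_const_mul, mul_comm]
  exact mul_le_mul_of_nonneg_right (gk_int hl _ _) (hg0 t)

lemma gk_prod' {lam : ℝ} (hl : 0 < lam) {g : ℝ → ℝ} (hg0 : ∀ t, 0 ≤ g t)
    (hg : IntegrableOn g (Ioo t0 T)) :
    Integrable (fun z : ℝ × ℝ => g z.2 * gk lam z.1 z.2)
      ((volume.restrict (Ioo t0 T)).prod (volume.restrict (Ioo t0 T))) ∧
    ∫ z, g z.2 * gk lam z.1 z.2 ∂((volume.restrict (Ioo t0 T)).prod (volume.restrict (Ioo t0 T)))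
      ≤ √(Real.pi / (lam / 4)) * ∫ t in Ioo t0 T, g t := by
  obtain ⟨h1, h2⟩ := gk_prod (t0 := t0) (T := T) hl hg0 hg
  have he : (fun z : ℝ × ℝ => g z.2 * gk lam z.1 z.2) = (fun z : ℝ × ℝ => g z.1 * gk lam z.1 z.2) ∘ Prod.swap := by
    ext z; simp [gk_symm lam z.1 z.2]
  refine ⟨by rw [he]; exact h1.swap, ?_⟩
  rw [he]
  refine le_trans (le_of_eq ?_) h2
  exact integral_prod_swap (fun z : ℝ × ℝ => g z.1 * gk lam z.1 z.2)

lemma wt_split (lam t s : ℝ) : wt t0 lam t s =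
    Real.exp (lam * (t - t0) ^ 2 / 2) * Real.exp (lam * (s - t0) ^ 2 / 2) * gk lam t s := by
  unfold wt gk; rw [← Real.exp_add, ← Real.exp_add]; congr 1; ring

lemma Abs.wq_int (h : Abs t0 T c1 C1 Mq q e Q D R) {w : ℝ → ℝ} (hw : Continuous w) :
    IntegrableOn (fun t => w t * q t) (Ioo t0 T) := by
  obtain ⟨A, hA⟩ := (isCompact_Icc (a := t0) (b := T)).exists_bound_of_continuousOn hw.continuousOn
  refine Measure.integrableOn_of_bounded (M := |A| * Mq) (by simp) (hw.measurable.mul h.qm).aestronglyMeasurable ?_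
  filter_upwards [ae_restrict_mem measurableSet_Ioo] with t ht
  have ht' := Ioo_subset_Icc_self ht
  rw [norm_mul]
  refine mul_le_mul ((hA t ht').trans (le_abs_self _)) ?_ (norm_nonneg _) (abs_nonneg _)
  rw [Real.norm_eq_abs, abs_of_nonneg (h.q0 t)]; exact h.qb t ht'

lemma Abs.we_int (h : Abs t0 T c1 C1 Mq q e Q D R) {w : ℝ → ℝ} (hw : Continuous w) :
    IntegrableOn (fun t => w t * e t) (Ioo t0 T) := by
  obtain ⟨A, hA⟩ := (isCompact_Icc (a := t0) (b := T)).exists_bound_of_continuousOn hw.continuousOn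
  refine Integrable.bdd_mul (c := A) h.ei hw.aestronglyMeasurable ?_
  filter_upwards [ae_restrict_mem measurableSet_Ioo] with t ht
  exact hA t (Ioo_subset_Icc_self ht)

lemma Abs.schur_pt {lam κ t s qt qs et Qv Rv : ℝ} (hκ : 0 < κ)
    (ht : t0 ≤ t) (hs : t0 ≤ s) (hc : 0 ≤ c1) (hqt : 0 ≤ qt) (hqs : 0 ≤ qs) (het : 0 ≤ et)
    (hQ : |Qv| ≤ √qt * √qs) (hR : |Rv| ≤ √(c1 * (qt + et)) * √qs) :
    |(s - t0) * wt t0 lam t s * (Qv + (t - t0) * Rv)| ≤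
      (2 * κ)⁻¹ * (((s - t0) ^ 2 * Real.exp (lam * (s - t0) ^ 2) * qs) * gk lam t s) +
      κ / 2 * ((2 * (Real.exp (lam * (t - t0) ^ 2) * qt + Real.exp (lam * (t - t0) ^ 2) * (t - t0) ^ 2 * c1 * (qt + et)))
        * gk lam t s) := by
  have hs' : 0 ≤ s - t0 := by linarith
  have ht' : 0 ≤ t - t0 := by linarith
  set k := gk lam t s
  have hk : 0 < k := gk_pos _ _ _
  set A := Real.exp (lam * (t - t0) ^ 2 / 2) with hA
  set B := Real.exp (lam * (s - t0) ^ 2 / 2) with hB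
  have hA2 : Real.exp (lam * (t - t0) ^ 2) = A ^ 2 := by rw [hA, ← Real.exp_nat_mul]; congr 1; push_cast; ring
  have hB2 : Real.exp (lam * (s - t0) ^ 2) = B ^ 2 := by rw [hB, ← Real.exp_nat_mul]; congr 1; push_cast; ring
  have hA0 : 0 < A := Real.exp_pos _
  have hB0 : 0 < B := Real.exp_pos _
  rw [wt_split, hA2, hB2]
  set x := √qt
  set y := √qs
  set r := √(c1 * (qt + et))
  have hx2 : qt = x ^ 2 := (Real.sq_sqrt hqt).symm
  have hy2 : qs = y ^ 2 := (Real.sq_sqrt hqs).symm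
  have hr2 : c1 * (qt + et) = r ^ 2 := (Real.sq_sqrt (by positivity)).symm
  have hx : 0 ≤ x := Real.sqrt_nonneg _
  have hy : 0 ≤ y := Real.sqrt_nonneg _
  have hr : 0 ≤ r := Real.sqrt_nonneg _
  have h1 : |(s - t0) * (A * B * k) * (Qv + (t - t0) * Rv)| ≤ ((s - t0) * B * y) * (A * (x + (t - t0) * r)) * k := by
    rw [abs_mul, abs_of_nonneg (by positivity : 0 ≤ (s - t0) * (A * B * k))]
    have : |Qv + (t - t0) * Rv| ≤ (x + (t - t0) * r) * y := by
      refine (abs_add_le _ _).trans ?_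
      rw [abs_mul, abs_of_nonneg ht']
      nlinarith [mul_le_mul_of_nonneg_left hR ht']
    calc _ ≤ (s - t0) * (A * B * k) * ((x + (t - t0) * r) * y) := mul_le_mul_of_nonneg_left this (by positivity)
      _ = _ := by ring
  refine h1.trans ?_
  have e1 : A ^ 2 * (t - t0) ^ 2 * c1 * (qt + et) = A ^ 2 * (t - t0) ^ 2 * r ^ 2 := by rw [← hr2]; ring
  rw [e1, hy2, hx2]
  set a := (s - t0) * B * y
  set z := (t - t0) * r with hz
  have e2 : (s - t0) ^ 2 * B ^ 2 * y ^ 2 = a ^ 2 := by ring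
  have e3 : A ^ 2 * (t - t0) ^ 2 * r ^ 2 = A ^ 2 * z ^ 2 := by rw [hz]; ring
  rw [e2, e3]
  have h2 : a * (A * (x + z)) ≤ (2 * κ)⁻¹ * a ^ 2 + κ / 2 * (A * (x + z)) ^ 2 := by
    set b := A * (x + z)
    have : (2 * κ)⁻¹ * a ^ 2 + κ / 2 * b ^ 2 - a * b = (2 * κ)⁻¹ * (a - κ * b) ^ 2 := by field_simp; ring
    have : 0 ≤ (2 * κ)⁻¹ * (a - κ * b) ^ 2 := by positivity
    linarith
  have h3 : (A * (x + z)) ^ 2 ≤ 2 * (A ^ 2 * x ^ 2 + A ^ 2 * z ^ 2) := by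
    nlinarith [mul_nonneg (sq_nonneg A) (sq_nonneg (x - z))]
  have h4 : a * (A * (x + z)) ≤ (2 * κ)⁻¹ * a ^ 2 + κ / 2 * (2 * (A ^ 2 * x ^ 2 + A ^ 2 * z ^ 2)) :=
    h2.trans (by gcongr)
  calc _ ≤ ((2 * κ)⁻¹ * a ^ 2 + κ / 2 * (2 * (A ^ 2 * x ^ 2 + A ^ 2 * z ^ 2))) * k := by gcongr
    _ = _ := by ring

lemma Abs.schur (h : Abs t0 T c1 C1 Mq q e Q D R) {lam : ℝ} (hl : 0 < lam) :
    ∫ s in Ioo t0 T, (s - t0) ^ 2 * Real.exp (lam * (s - t0) ^ 2) * q s ≤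
      10 / lam * ∫ t in Ioo t0 T, (Real.exp (lam * (t - t0) ^ 2) * q t
        + Real.exp (lam * (t - t0) ^ 2) * (t - t0) ^ 2 * c1 * (q t + e t)) := by
  set μ := volume.restrict (Ioo t0 T) with hμ
  have hfin : IsFiniteMeasure μ := ⟨by simp [hμ]⟩
  set κ := √(Real.pi / (lam / 4)) with hκ
  have hκ0 : 0 < κ := Real.sqrt_pos.2 (div_pos Real.pi_pos (by positivity))
  have hκ2 : κ ^ 2 = 4 * Real.pi / lam := by
    rw [hκ, Real.sq_sqrt (div_pos Real.pi_pos (by positivity)).le]; field_simp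
  set f : ℝ → ℝ := fun s => (s - t0) ^ 2 * Real.exp (lam * (s - t0) ^ 2) * q s with hf
  set g : ℝ → ℝ := fun t => (Real.exp (lam * (t - t0) ^ 2) * q t
        + Real.exp (lam * (t - t0) ^ 2) * (t - t0) ^ 2 * c1 * (q t + e t)) with hg
  have hf0 : ∀ s, 0 ≤ f s := fun s => mul_nonneg (by positivity) (h.q0 s)
  have hg0 : ∀ s, 0 ≤ g s := fun s => by
    have := h.q0 s; have := h.e0 s; have := h.c10
    simp only [hg]; positivity
  have fi : IntegrableOn f (Ioo t0 T) := h.wq_int (w := fun s => (s - t0) ^ 2 * Real.exp (lam * (s - t0) ^ 2)) (by fun_prop)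
  have gi : IntegrableOn g (Ioo t0 T) := by
    refine Integrable.add (h.wq_int (w := fun s => Real.exp (lam * (s - t0) ^ 2)) (by fun_prop)) ?_
    simp only [mul_add]
    exact Integrable.add (h.wq_int (w := fun s => Real.exp (lam * (s - t0) ^ 2) * (s - t0) ^ 2 * c1) (by fun_prop))
      (h.we_int (w := fun s => Real.exp (lam * (s - t0) ^ 2) * (s - t0) ^ 2 * c1) (by fun_prop))
  have hid := h.identity lam
  rw [integral_const_mul] at hid
  have hR : ∀ᵐ z ∂(μ.prod μ), |R z.1 z.2| ≤ √(c1 * (q z.1 + e z.1)) * √(q z.2) := by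
    refine (Measure.ae_prod_iff_ae_ae ?_).2 (h.Rb.mono fun t ht => ae_of_all _ ht)
    refine measurableSet_le h.Rm.abs ?_
    have := h.qm; have := h.em
    fun_prop
  have hmem : ∀ᵐ z ∂(μ.prod μ), z ∈ Ioo t0 T ×ˢ Ioo t0 T := by
    rw [hμ, Measure.prod_restrict]; exact ae_restrict_mem (measurableSet_Ioo.prod measurableSet_Ioo)
  obtain ⟨i1, b1⟩ := gk_prod' (t0 := t0) (T := T) hl hf0 fi
  obtain ⟨i2, b2⟩ := gk_prod (t0 := t0) (T := T) hl (g := fun t => 2 * g t) (fun t => by have := hg0 t; positivity) (Integrable.const_mul gi 2)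
  have hle : ∫ z, sg z.1 z.2 * HH t0 lam Q R z.1 z.2 ∂(μ.prod μ) ≤
      ∫ z, ((2 * κ)⁻¹ * (f z.2 * gk lam z.1 z.2) + κ / 2 * ((2 * g z.1) * gk lam z.1 z.2)) ∂(μ.prod μ) := by
    refine integral_mono_ae (sg_int (h.HH_int lam)) ((i1.const_mul _).add (i2.const_mul _)) ?_
    filter_upwards [hR, hmem] with z hz hm
    refine (le_abs_self _).trans ?_
    rw [abs_mul]
    refine (mul_le_of_le_one_left (abs_nonneg _) (sg_abs _ _)).trans ?_
    exact Abs.schur_pt hκ0 hm.1.1.le hm.2.1.le h.c10 (h.q0 _) (h.q0 _) (h.e0 _) (h.Qb _ _) hz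
  rw [← hid, integral_add (i1.const_mul _) (i2.const_mul _), integral_const_mul, integral_const_mul] at hle
  rw [integral_const_mul] at b2
  set X := ∫ s in Ioo t0 T, f s
  set Y := ∫ s in Ioo t0 T, g s
  have hY : 0 ≤ Y := integral_nonneg hg0
  have p1 := mul_le_mul_of_nonneg_left b1 (by positivity : 0 ≤ (2 * κ)⁻¹)
  have p2 := mul_le_mul_of_nonneg_left b2 (by positivity : 0 ≤ κ / 2)
  have e1 : (2 * κ)⁻¹ * (κ * X) = X / 2 := by field_simp
  have e2 : κ / 2 * (κ * (2 * Y)) = 4 * Real.pi / lam * Y := by rw [← hκ2]; ring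
  have hX : 2 * X ≤ X / 2 + 4 * Real.pi / lam * Y := by
    have hh : 2 * X ≤ _ := hle
    linarith [p1.trans_eq e1, p2.trans_eq e2]
  have : 4 * Real.pi / lam * Y ≤ 15 / lam * Y := by
    refine mul_le_mul_of_nonneg_right ?_ hY
    gcongr
    linarith [Real.pi_lt_d2]
  have e3 : 15 / lam * Y = 3 / 2 * (10 / lam * Y) := by ring
  linarith

end

end BU

namespace BU

open Filter Topology

section
variable {t0 T c1 C1 Mq : ℝ} {q e : ℝ → ℝ} {Q D R : ℝ → ℝ → ℝ}

lemma Abs.energyW (h : Abs t0 T c1 C1 Mq q e Q D R) {lam : ℝ} (hl : 0 < lam) :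
    ∫ s in Ioo t0 T, (s - t0) ^ 2 * Real.exp (lam * (s - t0) ^ 2) * e s ≤
      (∫ s in Ioo t0 T, Real.exp (lam * (s - t0) ^ 2) * q s) + (1 + 2 * lam * (T - t0) + 2 * C1) *
      ∫ s in Ioo t0 T, (s - t0) ^ 2 * Real.exp (lam * (s - t0) ^ 2) * q s := by
  have hd : ∀ t, HasDerivAt (fun t => (t - t0) ^ 2 * Real.exp (lam * (t - t0) ^ 2))
      (2 * (t - t0) * Real.exp (lam * (t - t0) ^ 2) +
        (t - t0) ^ 2 * (Real.exp (lam * (t - t0) ^ 2) * (lam * (2 * (t - t0))))) t := by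
    intro t
    have h1 : HasDerivAt (fun t : ℝ => (t - t0) ^ 2) (2 * (t - t0)) t := by
      have := ((hasDerivAt_id t).sub_const t0).pow 2
      refine this.congr_deriv ?_
      simp
    exact h1.mul (h1.const_mul lam).exp
  have hE := h.En _ _ hd (by fun_prop) (fun t => by positivity) (by simp)
  refine hE.trans ?_
  have i1 := h.wq_int (w := fun s => Real.exp (lam * (s - t0) ^ 2)) (by fun_prop)
  have i2 := h.wq_int (w := fun s => (s - t0) ^ 2 * Real.exp (lam * (s - t0) ^ 2)) (by fun_prop)
  rw [← integral_const_mul, ← integral_add i1 (i2.const_mul _)]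
  refine setIntegral_mono_on ?_ (i1.add (i2.const_mul _)) measurableSet_Ioo fun t ht => ?_
  · exact h.wq_int (by fun_prop)
  have hs : 0 < t - t0 := by linarith [ht.1]
  have hs' : t - t0 ≤ T - t0 := by linarith [ht.2]
  set E := Real.exp (lam * (t - t0) ^ 2)
  have hE0 : 0 < E := Real.exp_pos _
  set σ := t - t0
  rw [abs_of_nonneg (by positivity)]
  have key : 2 * σ * E + σ ^ 2 * (E * (lam * (2 * σ))) + 2 * C1 * (σ ^ 2 * E) ≤
      E + (1 + 2 * lam * (T - t0) + 2 * C1) * (σ ^ 2 * E) := by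
    have k1 : 2 * σ * E ≤ (1 + σ ^ 2) * E := mul_le_mul_of_nonneg_right (by nlinarith [sq_nonneg (σ - 1)]) hE0.le
    have k2 : (2 * lam * (σ ^ 2 * E)) * σ ≤ (2 * lam * (σ ^ 2 * E)) * (T - t0) := 
      mul_le_mul_of_nonneg_left hs' (by positivity)
    nlinarith
  calc _ ≤ (E + (1 + 2 * lam * (T - t0) + 2 * C1) * (σ ^ 2 * E)) * q t := mul_le_mul_of_nonneg_right key (h.q0 t)
    _ = _ := by ring

lemma Abs.main1 (h : Abs t0 T c1 C1 Mq q e Q D R) (hsm : 20 * c1 * (T - t0) ≤ 1 / 4) {lam : ℝ} (hl : 0 < lam)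
    (hl1 : 40 * c1 * (2 + 2 * C1) ≤ lam) :
    ∫ s in Ioo t0 T, (s - t0) ^ 2 * Real.exp (lam * (s - t0) ^ 2) * q s ≤
      20 * (1 + c1) / lam * ∫ s in Ioo t0 T, Real.exp (lam * (s - t0) ^ 2) * q s := by
  have hS := h.schur hl
  have hE := h.energyW hl
  have hc := h.c10
  have i1 := h.wq_int (w := fun s => Real.exp (lam * (s - t0) ^ 2)) (by fun_prop)
  have i2 := h.wq_int (w := fun s => (s - t0) ^ 2 * Real.exp (lam * (s - t0) ^ 2)) (by fun_prop)
  have i3 := h.we_int (w := fun s => (s - t0) ^ 2 * Real.exp (lam * (s - t0) ^ 2)) (by fun_prop)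
  have e1 : ∫ t in Ioo t0 T, (Real.exp (lam * (t - t0) ^ 2) * q t
        + Real.exp (lam * (t - t0) ^ 2) * (t - t0) ^ 2 * c1 * (q t + e t)) =
      (∫ s in Ioo t0 T, Real.exp (lam * (s - t0) ^ 2) * q s) + 
      (c1 * (∫ s in Ioo t0 T, (s - t0) ^ 2 * Real.exp (lam * (s - t0) ^ 2) * q s) +
       c1 * (∫ s in Ioo t0 T, (s - t0) ^ 2 * Real.exp (lam * (s - t0) ^ 2) * e s)) := by
    rw [← integral_const_mul, ← integral_const_mul, ← integral_add (i2.const_mul _) (i3.const_mul _),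
      ← integral_add (f := fun s => Real.exp (lam * (s - t0) ^ 2) * q s) (g := fun s =>
        c1 * ((s - t0) ^ 2 * Real.exp (lam * (s - t0) ^ 2) * q s) +
          c1 * ((s - t0) ^ 2 * Real.exp (lam * (s - t0) ^ 2) * e s)) i1 ((i2.const_mul _).add (i3.const_mul _))]
    congr 1; ext t; ring
  rw [e1] at hS
  have hX0 : 0 ≤ ∫ s in Ioo t0 T, (s - t0) ^ 2 * Real.exp (lam * (s - t0) ^ 2) * q s :=
    integral_nonneg fun s => mul_nonneg (by positivity) (h.q0 s)
  set X := ∫ s in Ioo t0 T, (s - t0) ^ 2 * Real.exp (lam * (s - t0) ^ 2) * q s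
  set Y := ∫ s in Ioo t0 T, (s - t0) ^ 2 * Real.exp (lam * (s - t0) ^ 2) * e s
  set N := ∫ s in Ioo t0 T, Real.exp (lam * (s - t0) ^ 2) * q s
  have p1 := mul_le_mul_of_nonneg_left (mul_le_mul_of_nonneg_left hE hc) (by positivity : 0 ≤ 10 / lam)
  have p2 : X ≤ 10 / lam * ((1 + c1) * N) + (10 * c1 * (2 + 2 * C1) / lam) * X + (20 * c1 * (T - t0)) * X := by
    have : 10 / lam * (c1 * (N + (1 + 2 * lam * (T - t0) + 2 * C1) * X)) =
        10 / lam * (c1 * N) + (10 * c1 * (1 + 2 * C1) / lam) * X + (20 * c1 * (T - t0)) * X := by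
      field_simp; ring
    calc X ≤ _ := hS
      _ ≤ 10 / lam * N + 10 / lam * (c1 * X) + 10 / lam * (c1 * (N + (1 + 2 * lam * (T - t0) + 2 * C1) * X)) := by
        linarith
      _ = _ := by rw [this]; ring
  have p3 : 10 * c1 * (2 + 2 * C1) / lam ≤ 1 / 4 := by rw [div_le_iff₀ hl]; linarith
  have p4 := mul_le_mul_of_nonneg_right p3 hX0
  have p5 := mul_le_mul_of_nonneg_right hsm hX0
  have e4 : 20 * (1 + c1) / lam * N = 2 * (10 / lam * ((1 + c1) * N)) := by ring
  rw [e4]; linarith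

lemma Abs.main2 (h : Abs t0 T c1 C1 Mq q e Q D R) (hsm : 20 * c1 * (T - t0) ≤ 1 / 4) {δ lam : ℝ} (hδ : 0 < δ)
    (hl : 0 < lam) (hl1 : 40 * c1 * (2 + 2 * C1) ≤ lam) (hl2 : 20 * (1 + c1) ≤ lam)
    (hl3 : 40 * (1 + c1) ≤ lam * δ ^ 2) :
    ∫ s in Ioo t0 T, (s - t0) ^ 2 * Real.exp (lam * (s - t0) ^ 2) * q s ≤
      2 * ((T - t0) * Mq) * Real.exp (lam * δ ^ 2) := by
  have hM := h.main1 hsm hl hl1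
  have hc := h.c10
  have hMq : 0 ≤ Mq := (h.q0 t0).trans (h.qb t0 ⟨le_rfl, h.lt.le⟩)
  have i1 := h.wq_int (w := fun s => Real.exp (lam * (s - t0) ^ 2)) (by fun_prop)
  have i2 := h.wq_int (w := fun s => (s - t0) ^ 2 * Real.exp (lam * (s - t0) ^ 2)) (by fun_prop)
  have hN : ∫ s in Ioo t0 T, Real.exp (lam * (s - t0) ^ 2) * q s ≤ 
      (δ ^ 2)⁻¹ * (∫ s in Ioo t0 T, (s - t0) ^ 2 * Real.exp (lam * (s - t0) ^ 2) * q s) +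
      (T - t0) * (Mq * Real.exp (lam * δ ^ 2)) := by
    have ec : ∫ s in Ioo t0 T, Mq * Real.exp (lam * δ ^ 2) = (T - t0) * (Mq * Real.exp (lam * δ ^ 2)) := by
      rw [setIntegral_const]; simp [Measure.real, h.lt.le]
    have hci : IntegrableOn (fun _ : ℝ => Mq * Real.exp (lam * δ ^ 2)) (Ioo t0 T) := integrableOn_const (by simp)
    rw [← ec, ← integral_const_mul, ← integral_add (i2.const_mul _) hci]
    refine setIntegral_mono_on i1 ((i2.const_mul _).add hci) measurableSet_Ioo fun s hs => ?_
    have hσ : 0 < s - t0 := by linarith [hs.1]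
    have hq := h.q0 s
    rcases le_total (s - t0) δ with h1 | h1
    · have a1 : Real.exp (lam * (s - t0) ^ 2) * q s ≤ Real.exp (lam * δ ^ 2) * Mq := by
        have := h.qb s (Ioo_subset_Icc_self hs)
        gcongr
      have a2 : 0 ≤ (δ ^ 2)⁻¹ * ((s - t0) ^ 2 * Real.exp (lam * (s - t0) ^ 2) * q s) := by positivity
      linarith
    · have a1 : 1 ≤ (δ ^ 2)⁻¹ * (s - t0) ^ 2 := by
        rw [← div_eq_inv_mul, one_le_div (by positivity)]; gcongr
      have a2 := mul_le_mul_of_nonneg_right a1 (by positivity : 0 ≤ Real.exp (lam * (s - t0) ^ 2) * q s)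
      have a3 : 0 ≤ Mq * Real.exp (lam * δ ^ 2) := by positivity
      nlinarith
  have hX0 : 0 ≤ ∫ s in Ioo t0 T, (s - t0) ^ 2 * Real.exp (lam * (s - t0) ^ 2) * q s :=
    integral_nonneg fun s => mul_nonneg (by positivity) (h.q0 s)
  set X := ∫ s in Ioo t0 T, (s - t0) ^ 2 * Real.exp (lam * (s - t0) ^ 2) * q s
  set N := ∫ s in Ioo t0 T, Real.exp (lam * (s - t0) ^ 2) * q s
  set K := Real.exp (lam * δ ^ 2)
  have hK : 0 < K := Real.exp_pos _
  have p1 := mul_le_mul_of_nonneg_left hN (by positivity : 0 ≤ 20 * (1 + c1) / lam)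
  have p2 : 20 * (1 + c1) / lam * ((δ ^ 2)⁻¹ * X) ≤ 1 / 2 * X := by
    rw [← mul_assoc]
    refine mul_le_mul_of_nonneg_right ?_ hX0
    rw [← div_eq_mul_inv, div_div, div_le_iff₀ (by positivity)]; linarith
  have hl0 : 0 ≤ (T - t0) * (Mq * K) := mul_nonneg (by linarith [h.lt]) (by positivity)
  have p3 : 20 * (1 + c1) / lam * ((T - t0) * (Mq * K)) ≤ (T - t0) * (Mq * K) := by
    refine mul_le_of_le_one_left hl0 ?_
    rw [div_le_one hl]; exact hl2
  rw [mul_add (20 * (1 + c1) / lam)] at p1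
  linarith

lemma Abs.main3 (h : Abs t0 T c1 C1 Mq q e Q D R) (hsm : 20 * c1 * (T - t0) ≤ 1 / 4) {δ : ℝ} (hδ : 0 < δ) :
    ∀ᵐ t ∂(volume.restrict (Ioo (t0 + 2 * δ) T)), q t = 0 := by
  set J := ∫ s in Ioo (t0 + 2 * δ) T, (s - t0) ^ 2 * q s with hJ
  have hsub : Ioo (t0 + 2 * δ) T ⊆ Ioo t0 T := Ioo_subset_Ioo (by linarith) le_rfl
  have i0 := (h.wq_int (w := fun s => (s - t0) ^ 2) (by fun_prop)).mono_set hsub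
  have hJ0 : 0 ≤ J := integral_nonneg fun s => mul_nonneg (by positivity) (h.q0 s)
  have hev : ∀ᶠ lam : ℝ in atTop, J ≤ 2 * ((T - t0) * Mq) * Real.exp (-(lam * (3 * δ ^ 2))) := by
    have hc := h.c10
    filter_upwards [eventually_gt_atTop 0, eventually_ge_atTop (40 * c1 * (2 + 2 * C1)),
      eventually_ge_atTop (20 * (1 + c1)), eventually_ge_atTop (40 * (1 + c1) / δ ^ 2)] with lam l0 l1 l2 l3
    have hm := h.main2 hsm hδ l0 l1 l2 (by rwa [div_le_iff₀ (by positivity)] at l3)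
    have i2 := h.wq_int (w := fun s => (s - t0) ^ 2 * Real.exp (lam * (s - t0) ^ 2)) (by fun_prop)
    have h1 : Real.exp (lam * (4 * δ ^ 2)) * J ≤ ∫ s in Ioo t0 T, (s - t0) ^ 2 * Real.exp (lam * (s - t0) ^ 2) * q s := by
      calc _ = ∫ s in Ioo (t0 + 2 * δ) T, Real.exp (lam * (4 * δ ^ 2)) * ((s - t0) ^ 2 * q s) := by
            rw [integral_const_mul]
        _ ≤ ∫ s in Ioo (t0 + 2 * δ) T, (s - t0) ^ 2 * Real.exp (lam * (s - t0) ^ 2) * q s := by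
            refine setIntegral_mono_on (i0.const_mul _) (i2.mono_set hsub) measurableSet_Ioo fun s hs => ?_
            have hq := h.q0 s
            have hs1 : 2 * δ ≤ s - t0 := by linarith [hs.1]
            have : Real.exp (lam * (4 * δ ^ 2)) ≤ Real.exp (lam * (s - t0) ^ 2) := by
              refine Real.exp_le_exp.2 (mul_le_mul_of_nonneg_left ?_ l0.le)
              nlinarith
            have := mul_le_mul_of_nonneg_right this (by positivity : 0 ≤ (s - t0) ^ 2 * q s)
            linarith
        _ ≤ _ := setIntegral_mono_set i2 (ae_of_all _ fun s => mul_nonneg (by positivity) (h.q0 s)) hsub.eventuallyLE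
    have h2 := h1.trans hm
    have h3 : J = Real.exp (-(lam * (4 * δ ^ 2))) * (Real.exp (lam * (4 * δ ^ 2)) * J) := by
      rw [← mul_assoc, ← Real.exp_add]; simp
    calc J = _ := h3
      _ ≤ Real.exp (-(lam * (4 * δ ^ 2))) * (2 * ((T - t0) * Mq) * Real.exp (lam * δ ^ 2)) :=
        mul_le_mul_of_nonneg_left h2 (Real.exp_pos _).le
      _ = 2 * ((T - t0) * Mq) * (Real.exp (-(lam * (4 * δ ^ 2))) * Real.exp (lam * δ ^ 2)) := by ring
      _ = _ := by rw [← Real.exp_add]; congr 2; ring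
  have hlim : Tendsto (fun lam : ℝ => 2 * ((T - t0) * Mq) * Real.exp (-(lam * (3 * δ ^ 2)))) atTop (𝓝 (2 * ((T - t0) * Mq) * 0)) := by
    refine Tendsto.const_mul _ (Real.tendsto_exp_neg_atTop_nhds_zero.comp ?_)
    exact tendsto_id.atTop_mul_const (by positivity)
  have hJz : J = 0 := le_antisymm (by simpa using ge_of_tendsto hlim hev) hJ0
  rw [hJ, integral_eq_zero_iff_of_nonneg (fun s => mul_nonneg (by positivity) (h.q0 s)) i0] at hJz
  filter_upwards [hJz, ae_restrict_mem measurableSet_Ioo] with t h1 ht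
  have : t - t0 ≠ 0 := by have := ht.1; intro h0; linarith
  simpa [this] using h1

end

end BU

namespace BU

open Filter Topology

lemma cs_int {α : Type*} [MeasurableSpace α] {μ : Measure α} {f g : α → ℝ}
    (hf : Integrable (fun x => f x ^ 2) μ) (hg : Integrable (fun x => g x ^ 2) μ) :
    |∫ x, f x * g x ∂μ| ≤ √(∫ x, f x ^ 2 ∂μ) * √(∫ x, g x ^ 2 ∂μ) := by
  set A := ∫ x, f x ^ 2 ∂μ
  set B := ∫ x, g x ^ 2 ∂μ
  set X := ∫ x, f x * g x ∂μ with hX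
  have hA : 0 ≤ A := integral_nonneg fun x => sq_nonneg _
  have key : ∀ l : ℝ, 0 ≤ A * (l * l) + (2 * X) * l + B := by
    intro l
    have h1 : |∫ x, l * (f x * g x) ∂μ| ≤ ∫ x, (l ^ 2 * f x ^ 2 + g x ^ 2) / 2 ∂μ := by
      rw [← Real.norm_eq_abs]
      refine norm_integral_le_of_norm_le (((hf.const_mul _).add hg).div_const 2) (ae_of_all _ fun x => ?_)
      have := young (l * f x) (g x)
      rw [Real.norm_eq_abs]
      calc _ = |l * f x * g x| := by rw [mul_assoc]
        _ ≤ _ := this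
        _ = _ := by ring
    rw [integral_const_mul, integral_div, integral_add (hf.const_mul _) hg, integral_const_mul] at h1
    have := (neg_abs_le _).trans' (neg_le_neg h1)
    linarith
  have hd := discrim_le_zero key
  unfold discrim at hd
  rw [← Real.sqrt_mul hA]
  exact Real.abs_le_sqrt (by linarith)

variable {d : ℕ}
variable {Ω : Set (Fin d → ℝ)} {T C : ℝ} {v : (Fin d → ℝ) → ℝ → ℝ}

lemma Sol.mQf (h : Sol Ω T C v) : Measurable (fun z : ℝ × ℝ => Qf Ω T v z.1 z.2) := by
  have h1 : Measurable (fun z : (Fin d → ℝ) × (ℝ × ℝ) => V Ω T v z.1 z.2.1) :=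
    h.measV.comp (measurable_fst.prodMk measurable_snd.fst)
  have h2 : Measurable (fun z : (Fin d → ℝ) × (ℝ × ℝ) => V Ω T v z.1 z.2.2) :=
    h.measV.comp (measurable_fst.prodMk measurable_snd.snd)
  exact (StronglyMeasurable.integral_prod_left' (μ := volume) (h1.mul h2).stronglyMeasurable).measurable

lemma Sol.mRf (h : Sol Ω T C v) : Measurable (fun z : ℝ × ℝ => Rf Ω T v z.1 z.2) := by
  have h1 : Measurable (fun z : (Fin d → ℝ) × (ℝ × ℝ) => F Ω T v z.1 z.2.1) :=
    h.measF.comp (measurable_fst.prodMk measurable_snd.fst)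
  have h2 : Measurable (fun z : (Fin d → ℝ) × (ℝ × ℝ) => V Ω T v z.1 z.2.2) :=
    h.measV.comp (measurable_fst.prodMk measurable_snd.snd)
  exact (StronglyMeasurable.integral_prod_left' (μ := volume) (h1.mul h2).stronglyMeasurable).measurable

lemma Sol.mDf (h : Sol Ω T C v) : Measurable (fun z : ℝ × ℝ => Df Ω T v z.1 z.2) := by
  have h1 : ∀ i, Measurable (fun z : (Fin d → ℝ) × (ℝ × ℝ) => P Ω T v i z.1 z.2.1) := fun i =>
    (h.measP i).comp (measurable_fst.prodMk measurable_snd.fst)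
  have h2 : ∀ i, Measurable (fun z : (Fin d → ℝ) × (ℝ × ℝ) => P Ω T v i z.1 z.2.2) := fun i =>
    (h.measP i).comp (measurable_fst.prodMk measurable_snd.snd)
  have h3 : Measurable (fun z : (Fin d → ℝ) × (ℝ × ℝ) => ∑ i, P Ω T v i z.1 z.2.1 * P Ω T v i z.1 z.2.2) :=
    Finset.measurable_fun_sum _ fun i _ => (h1 i).mul (h2 i)
  exact (StronglyMeasurable.integral_prod_left' (μ := volume) h3.stronglyMeasurable).measurable

lemma Sol.abs (h : Sol Ω T C v) {t0 : ℝ} (ht0 : t0 ∈ Ioo 0 T) :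
    ∃ Mq, Abs t0 T (C ^ 2 * (1 + d)) (C + d * C ^ 2 / 2) Mq (q2 Ω T v) (e2 Ω T v) (Qf Ω T v) (Df Ω T v) (Rf Ω T v) := by
  obtain ⟨M, hM0, hM⟩ := h.q2_bound ht0.1
  have hC := h.C0
  refine ⟨M, ⟨ht0.2, by positivity, by positivity, q2_nonneg, e2_nonneg, h.q2_meas, h.e2_meas, hM, h.e2_int ht0,
    h.mQf, h.mDf, h.mRf, ?_, ?_, ?_, ?_, ?_, ?_, ?_, ?_, ?_⟩⟩
  · intro t s; unfold Qf; congr 1; ext x; ring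
  · intro t s; unfold Df; congr 1; ext x; exact Finset.sum_congr rfl fun i _ => mul_comm _ _
  · intro s; unfold Qf q2; congr 1; ext x; ring
  · intro t s; exact cs_int (h.V_int2 t) (h.V_int2 s)
  · filter_upwards [h.grad_ae ht0] with t ht s
    refine (cs_int (h.F_sq_int ht) (h.V_int2 s)).trans ?_
    exact mul_le_mul_of_nonneg_right (Real.sqrt_le_sqrt (h.F_sq_le ht)) (Real.sqrt_nonneg _)
  · filter_upwards [h.grad_ae ht0] with t ht
    filter_upwards [h.grad_ae ht0] with s hs
    unfold Df e2
    rw [← integral_add ht hs, ← integral_div, ← Real.norm_eq_abs]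
    exact norm_integral_le_of_norm_le ((ht.add hs).div_const 2) (Eventually.of_forall fun x => sum_young _ _)
  · intro s; unfold Qf
    have : ∀ x, V Ω T v x T = 0 := fun x => V_out' (by simp)
    simp [this]
  · filter_upwards [h.grad_ae ht0, ae_restrict_mem measurableSet_Ioo] with s hs hsm ω ω' hω hω' t1 t2 h1 h2 h3
    exact h.F3 ht0 hsm hs hω hω' h1 h2 h3
  · intro W W' hW hW' hW0 hWt
    have := h.energy ht0 hW hW' hW0
    rwa [hWt, zero_mul, zero_add] at this

lemma Sol.step (h : Sol Ω T C v) {t0 : ℝ} (ht0 : t0 ∈ Ioo 0 T)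
    (hsm : 20 * (C ^ 2 * (1 + d)) * (T - t0) ≤ 1 / 4) {x : Fin d → ℝ} (hx : x ∈ Ω) {t : ℝ} (ht : t ∈ Ioo t0 T) :
    v x t = 0 := by
  obtain ⟨M, hA⟩ := h.abs ht0
  have hδ : 0 < (t - t0) / 4 := by linarith [ht.1]
  have hq := hA.main3 hsm hδ
  set t1 := t0 + 2 * ((t - t0) / 4) with ht1
  have h01 : t0 < t1 := by linarith
  have ht' : t ∈ Ioo t1 T := ⟨by linarith [ht.1], ht.2⟩
  have hz : (fun s => v x s) =ᵐ[volume.restrict (Ioo t1 T)] fun _ => 0 := by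
    filter_upwards [hq, ae_restrict_mem measurableSet_Ioo] with s hs hsm
    have hs0 : s ∈ Ioo 0 T := ⟨by linarith [hsm.1, ht0.1], hsm.2⟩
    unfold q2 at hs
    rw [integral_eq_zero_iff_of_nonneg (fun x => sq_nonneg _) (h.V_int2 s)] at hs
    have h2 : (fun y => v y s) =ᵐ[volume.restrict Ω] fun _ => 0 := by
      filter_upwards [ae_restrict_of_ae hs, ae_restrict_mem h.op.measurableSet] with y hy hyΩ
      rw [← V_eq (T := T) (v := v) hyΩ hs0]
      simpa using hy
    exact Measure.eqOn_open_of_ae_eq h2 h.op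
      ((h.contX ⟨hs0.1, hs0.2.le⟩).mono subset_closure) continuousOn_const hx
  exact Measure.eqOn_open_of_ae_eq hz isOpen_Ioo
    ((h.contT (subset_closure hx)).mono fun s hs => ⟨by linarith [hs.1, ht0.1], hs.2.le⟩) continuousOn_const ht'

lemma Sol.restrict (h : Sol Ω T C v) {T' : ℝ} (h0 : 0 < T') (hT : T' ≤ T) (hz : ∀ x ∈ Ω, v x T' = 0) :
    Sol Ω T' C v where
  op := h.op
  bdd := h.bdd
  T0 := h0
  C0 := h.C0
  cont := h.cont.mono (prod_mono_right (Ioc_subset_Ioc_right hT))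
  c2 := fun t ht => h.c2 t ⟨ht.1, ht.2.trans_le hT⟩
  dt := fun x hx t ht => h.dt x hx t ⟨ht.1, ht.2.trans_le hT⟩
  bd := fun x hx t ht => h.bd x hx t ⟨ht.1, ht.2.trans hT⟩
  eq := fun x hx t ht => h.eq x hx t ⟨ht.1, ht.2.trans_le hT⟩
  fin := fun x hx => by
    by_cases hxΩ : x ∈ Ω
    · exact hz x hxΩ
    · exact h.bd x (by rw [h.op.frontier_eq]; exact ⟨hx, hxΩ⟩) T' ⟨h0, hT⟩

lemma Sol.zero_aux (l : ℝ) (hl : 0 < l) (hsm : 20 * (C ^ 2 * (1 + d)) * l ≤ 1 / 4) (n : ℕ) :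
    ∀ T : ℝ, T ≤ n * (l / 2) → Sol Ω T C v → ∀ x ∈ Ω, ∀ t ∈ Ioo 0 T, v x t = 0 := by
  have near : ∀ T : ℝ, Sol Ω T C v → ∀ x ∈ Ω, ∀ t ∈ Ioo 0 T, T - l < t → v x t = 0 := by
    intro T h x hx t ht hlt
    have h1 : max (T - l) (t / 2) < t := max_lt hlt (by linarith [ht.1])
    refine h.step (t0 := max (T - l) (t / 2)) ⟨lt_max_of_lt_right (by linarith [ht.1]), h1.trans ht.2⟩ ?_ hx ⟨h1, ht.2⟩
    refine le_trans (mul_le_mul_of_nonneg_left ?_ (by have := h.C0; positivity)) hsm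
    have := le_max_left (T - l) (t / 2)
    linarith
  induction n with
  | zero => intro T hT h; have := h.T0; simp at hT; linarith
  | succ n ih =>
    intro T hT h x hx t ht
    rcases lt_or_ge (T - l) t with h1 | h1
    · exact near T h x hx t ht h1
    · have hT' : T - l / 2 ∈ Ioo 0 T := ⟨by linarith [ht.1], by linarith⟩
      refine ih (T - l / 2) ?_ (h.restrict hT'.1 hT'.2.le fun y hy => near T h y hy _ hT' (by linarith)) x hx t
        ⟨ht.1, by linarith⟩
      push_cast at hT; linarith

lemma Sol.zero (h : Sol Ω T C v) : ∀ x ∈ Ω, ∀ t ∈ Ioo 0 T, v x t = 0 := by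
  have hC := h.C0
  have hl : 0 < (80 * (C ^ 2 * (1 + d)) + 1)⁻¹ := by positivity
  set l := (80 * (C ^ 2 * (1 + d)) + 1)⁻¹ with hl'
  obtain ⟨n, hn⟩ := exists_nat_ge (T / (l / 2))
  refine Sol.zero_aux l hl ?_ n T ?_ h
  · rw [hl', ← div_eq_mul_inv, div_le_iff₀ (by positivity)]; linarith
  · rwa [div_le_iff₀ (by positivity)] at hn

end BU

namespace BU

open Filter Topology

variable {d : ℕ}
variable {Ω : Set (Fin d → ℝ)} {T C : ℝ} {v : (Fin d → ℝ) → ℝ → ℝ}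

lemma zero_end {f : ℝ → ℝ} (hT : 0 < T) (hf : ContinuousOn f (Ioc 0 T)) (h0 : ∀ t ∈ Ioo 0 T, f t = 0) : f T = 0 := by
  have h1 : EqOn f (fun _ => 0) (Ioo 0 T) := h0
  refine h1.of_subset_closure hf continuousOn_const Ioo_subset_Ioc_self ?_ ⟨hT, le_rfl⟩
  rw [closure_Ioo hT.ne]; exact Ioc_subset_Icc_self

lemma core (hΩo : IsOpen Ω) (hΩb : Bornology.IsBounded Ω) (hT : 0 < T)
    (hcont : ContinuousOn (fun q : (Fin d → ℝ) × ℝ => v q.1 q.2) (closure Ω ×ˢ Set.Ioc 0 T))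
    (hc2 : ∀ t ∈ Set.Ioo (0:ℝ) T, ContDiffOn ℝ 2 (fun x => v x t) Ω)
    (hdt : ∀ x ∈ Ω, ∀ t ∈ Set.Ioo (0:ℝ) T, DifferentiableAt ℝ (v x) t)
    (hbd : ∀ x ∈ frontier Ω, ∀ t ∈ Set.Ioo (0:ℝ) T, v x t = 0)
    (heq : ∃ C : ℝ, ∀ x ∈ Ω, ∀ t ∈ Set.Ioo (0:ℝ) T,
      |deriv (v x) t - lap (fun y => v y t) x| ≤ C * (|v x t| + ∑ i, |pd i (fun y => v y t) x|)) :
    (∀ x ∈ Ω, v x T = 0) ↔ ∀ x ∈ Ω, ∀ t ∈ Set.Ioo (0:ℝ) T, v x t = 0 := by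
  obtain ⟨C, hC⟩ := heq
  have hct : ∀ x ∈ closure Ω, ContinuousOn (v x) (Ioc 0 T) := fun x hx =>
    hcont.comp (f := fun t : ℝ => (x, t)) (by fun_prop) fun t ht => ⟨hx, ht⟩
  have hbd' : ∀ x ∈ frontier Ω, ∀ t ∈ Set.Ioc (0:ℝ) T, v x t = 0 := by
    intro x hx t ht
    rcases ht.2.lt_or_eq with h1 | h1
    · exact hbd x hx t ⟨ht.1, h1⟩
    · rw [h1]; exact zero_end hT (hct x (frontier_subset_closure hx)) (hbd x hx)
  constructor
  · intro hfin
    have hS : Sol Ω T (max C 0) v :=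
      { op := hΩo
        bdd := hΩb
        T0 := hT
        C0 := le_max_right _ _
        cont := hcont
        c2 := hc2
        dt := hdt
        bd := hbd'
        eq := fun x hx t ht => (hC x hx t ht).trans
          (mul_le_mul_of_nonneg_right (le_max_left _ _) (by positivity))
        fin := fun x hx => by
          by_cases hxΩ : x ∈ Ω
          · exact hfin x hxΩ
          · exact hbd' x (by rw [hΩo.frontier_eq]; exact ⟨hx, hxΩ⟩) T ⟨hT, le_rfl⟩ }
    exact hS.zero
  · intro h x hx
    exact zero_end hT (hct x (subset_closure hx)) (h x hx)

lemma part1 (hΩo : IsOpen Ω) (hΩb : Bornology.IsBounded Ω) (hT : 0 < T)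
    {a : (Fin d → ℝ) → ℝ → ℝ} {b : (Fin d → ℝ) → ℝ → Fin d → ℝ}
    (hab : ∃ C : ℝ, ∀ x ∈ Ω, ∀ t ∈ Set.Ioo (0:ℝ) T, |a x t| ≤ C ∧ ‖b x t‖ ≤ C)
    (hcont : ContinuousOn (fun q : (Fin d → ℝ) × ℝ => v q.1 q.2) (closure Ω ×ˢ Set.Ioc 0 T))
    (hc2 : ∀ t ∈ Set.Ioo (0:ℝ) T, ContDiffOn ℝ 2 (fun x => v x t) Ω)
    (hdt : ∀ x ∈ Ω, ∀ t ∈ Set.Ioo (0:ℝ) T, DifferentiableAt ℝ (v x) t)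
    (hbd : ∀ x ∈ frontier Ω, ∀ t ∈ Set.Ioo (0:ℝ) T, v x t = 0)
    (heq : ∀ x ∈ Ω, ∀ t ∈ Set.Ioo (0:ℝ) T,
        deriv (v x) t = lap (fun y => v y t) x + a x t * v x t
          + ∑ i, b x t i * pd i (fun y => v y t) x) :
    (∀ x ∈ Ω, v x T = 0) ↔ ∀ x ∈ Ω, ∀ t ∈ Set.Ioo (0:ℝ) T, v x t = 0 := by
  refine core hΩo hΩb hT hcont hc2 hdt hbd ?_
  obtain ⟨C, hC⟩ := hab
  refine ⟨C, fun x hx t ht => ?_⟩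
  obtain ⟨ha, hb⟩ := hC x hx t ht
  have e1 : deriv (v x) t - lap (fun y => v y t) x = a x t * v x t + ∑ i, b x t i * pd i (fun y => v y t) x := by
    rw [heq x hx t ht]; ring
  rw [e1, mul_add, Finset.mul_sum]
  refine (abs_add_le _ _).trans (add_le_add ?_ ((Finset.abs_sum_le_sum_abs _ _).trans
    (Finset.sum_le_sum fun i _ => ?_)))
  · rw [abs_mul]; exact mul_le_mul_of_nonneg_right ha (abs_nonneg _)
  · rw [abs_mul]; exact mul_le_mul_of_nonneg_right ((norm_le_pi_norm (b x t) i).trans hb) (abs_nonneg _)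

lemma pd_mul {i : Fin d} {f g : (Fin d → ℝ) → ℝ} {x : Fin d → ℝ} (hf : DifferentiableAt ℝ f x)
    (hg : DifferentiableAt ℝ g x) : pd i (fun y => f y * g y) x = f x * pd i g x + g x * pd i f x := by
  unfold pd
  rw [fderiv_fun_mul hf hg]; simp

lemma part2 (hΩo : IsOpen Ω) (hΩb : Bornology.IsBounded Ω) (hT : 0 < T)
    {a : (Fin d → ℝ) → ℝ → ℝ} {b : (Fin d → ℝ) → ℝ → Fin d → ℝ}
    (hab : ∃ C : ℝ, ∀ x ∈ Ω, ∀ t ∈ Set.Ioo (0:ℝ) T, |a x t| ≤ C ∧ ‖b x t‖ ≤ C)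
    (hdb : ∃ C : ℝ, ∀ x ∈ Ω, ∀ t ∈ Set.Ioo (0:ℝ) T, ∀ i j : Fin d,
        DifferentiableAt ℝ (fun y => b y t j) x ∧ |pd i (fun y => b y t j) x| ≤ C)
    {ψ : (Fin d → ℝ) → ℝ → ℝ}
    (hcont : ContinuousOn (fun q : (Fin d → ℝ) × ℝ => ψ q.1 q.2) (closure Ω ×ˢ Set.Ico 0 T))
    (hc2 : ∀ s ∈ Set.Ioo (0:ℝ) T, ContDiffOn ℝ 2 (fun x => ψ x s) Ω)
    (hdt : ∀ x ∈ Ω, ∀ t ∈ Set.Ioo (0:ℝ) T, DifferentiableAt ℝ (ψ x) t)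
    (hbd : ∀ x ∈ frontier Ω, ∀ s ∈ Set.Ioo (0:ℝ) T, ψ x s = 0)
    (heq : ∀ x ∈ Ω, ∀ s ∈ Set.Ioo (0:ℝ) T,
        deriv (ψ x) s = -(lap (fun y => ψ y s) x) - a x s * ψ x s
          + ∑ i, pd i (fun y => b y s i * ψ y s) x) :
    (∀ x ∈ Ω, ψ x 0 = 0) ↔ ∀ x ∈ Ω, ∀ s ∈ Set.Ioo (0:ℝ) T, ψ x s = 0 := by
  have hflip : ∀ t ∈ Ioo (0:ℝ) T, T - t ∈ Ioo (0:ℝ) T := fun t ht => ⟨by linarith [ht.2], by linarith [ht.1]⟩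
  have hmain := core (v := fun x t => ψ x (T - t)) hΩo hΩb hT
    (hcont.comp (f := fun q : (Fin d → ℝ) × ℝ => (q.1, T - q.2)) (by fun_prop)
      fun q hq => ⟨hq.1, by simpa using hq.2.2, by simpa using hq.2.1⟩)
    (fun t ht => hc2 _ (hflip t ht))
    (fun x hx t ht => (hdt x hx _ (hflip t ht)).comp t (by fun_prop))
    (fun x hx t ht => hbd x hx _ (hflip t ht)) ?_
  · simp only [sub_self] at hmain
    rw [hmain]
    constructor
    · intro h x hx s hs
      have := h x hx _ (hflip s hs)
      simpa using this
    · intro h x hx t ht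
      exact h x hx _ (hflip t ht)
  · obtain ⟨C, hC⟩ := hab
    obtain ⟨C', hC'⟩ := hdb
    refine ⟨|C| + d * |C'|, fun x hx t ht => ?_⟩
    have hs := hflip t ht
    set s := T - t with hst
    obtain ⟨ha, hb⟩ := hC x hx s hs
    have hψ : DifferentiableAt ℝ (fun y => ψ y s) x :=
      ((hc2 s hs).differentiableOn two_ne_zero).differentiableAt (hΩo.mem_nhds hx)
    have ed : deriv (fun t => ψ x (T - t)) t = - deriv (ψ x) s := by
      rw [hst]; exact deriv_comp_const_sub (f := ψ x) T t
    have e1 : deriv (fun t => ψ x (T - t)) t - lap (fun y => ψ y s) x =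
        a x s * ψ x s - ∑ i, (b x s i * pd i (fun y => ψ y s) x + ψ x s * pd i (fun y => b y s i) x) := by
      rw [ed, heq x hx s hs]
      have : ∀ i, pd i (fun y => b y s i * ψ y s) x =
          b x s i * pd i (fun y => ψ y s) x + ψ x s * pd i (fun y => b y s i) x := fun i =>
        pd_mul (hC' x hx s hs i i).1 hψ
      simp only [this]; ring
    change |deriv (fun t => ψ x (T - t)) t - lap (fun y => ψ y s) x| ≤ _
    rw [e1]
    have h1 : |a x s * ψ x s| ≤ |C| * |ψ x s| := by
      rw [abs_mul]; exact mul_le_mul_of_nonneg_right (ha.trans (le_abs_self _)) (abs_nonneg _)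
    have h2 : |∑ i, (b x s i * pd i (fun y => ψ y s) x + ψ x s * pd i (fun y => b y s i) x)| ≤
        |C| * ∑ i, |pd i (fun y => ψ y s) x| + d * |C'| * |ψ x s| := by
      calc _ ≤ ∑ i, |b x s i * pd i (fun y => ψ y s) x + ψ x s * pd i (fun y => b y s i) x| :=
            Finset.abs_sum_le_sum_abs _ _
        _ ≤ ∑ i : Fin d, (|C| * |pd i (fun y => ψ y s) x| + |C'| * |ψ x s|) := by
            refine Finset.sum_le_sum fun i _ => (abs_add_le _ _).trans (add_le_add ?_ ?_)
            · rw [abs_mul]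
              exact mul_le_mul_of_nonneg_right (((norm_le_pi_norm (b x s) i).trans hb).trans (le_abs_self _)) (abs_nonneg _)
            · rw [abs_mul, mul_comm]
              exact mul_le_mul_of_nonneg_right ((hC' x hx s hs i i).2.trans (le_abs_self _)) (abs_nonneg _)
        _ = _ := by rw [Finset.sum_add_distrib, ← Finset.mul_sum]; simp; ring
    have h3 : 0 ≤ d * |C'| * ∑ i, |pd i (fun y => ψ y s) x| := by positivity
    refine (abs_sub _ _).trans ((add_le_add h1 h2).trans ?_)
    linarith

end BU

/-- Proposition `prop-backward-uniqueness`: backward uniqueness for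
the linear parabolic equation (part 1) and for its adjoint equation (part 2). -/
theorem backward_uniqueness_linear_and_adjoint
    (d : ℕ) (γ : NNReal) (hγ0 : 0 < γ) (hγ1 : γ ≤ 1)
    (Ω : Set (Fin d → ℝ)) (hΩo : IsOpen Ω) (hΩc : IsConnected Ω)
    (hΩb : Bornology.IsBounded Ω) (hΩreg : HasC2HolderBoundary Ω γ)
    (T : ℝ) (hT : 0 < T)
    (a : (Fin d → ℝ) → ℝ → ℝ) (b : (Fin d → ℝ) → ℝ → Fin d → ℝ)
    (hab : ∃ C : ℝ, ∀ x ∈ Ω, ∀ t ∈ Set.Ioo (0:ℝ) T, |a x t| ≤ C ∧ ‖b x t‖ ≤ C) :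
    -- part (1): the linear parabolic equation
    (∀ v : (Fin d → ℝ) → ℝ → ℝ,
      ContinuousOn (fun q : (Fin d → ℝ) × ℝ => v q.1 q.2) (closure Ω ×ˢ Set.Ioc 0 T) →
      (∀ t ∈ Set.Ioc (0:ℝ) T, ContDiffOn ℝ 2 (fun x => v x t) Ω) →
      (∀ x ∈ Ω, ContDiffOn ℝ 1 (v x) (Set.Ioc 0 T)) →
      (∀ x ∈ frontier Ω, ∀ t ∈ Set.Ioo (0:ℝ) T, v x t = 0) →
      (∀ x ∈ Ω, ∀ t ∈ Set.Ioo (0:ℝ) T,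
        deriv (v x) t = lap (fun y => v y t) x + a x t * v x t
          + ∑ i, b x t i * pd i (fun y => v y t) x) →
      ((∀ x ∈ Ω, v x T = 0) ↔ ∀ x ∈ Ω, ∀ t ∈ Set.Ioo (0:ℝ) T, v x t = 0)) ∧
    -- part (2): the adjoint equation, assuming moreover `D_{x_i} b ∈ L^∞`
    ((∃ C : ℝ, ∀ x ∈ Ω, ∀ t ∈ Set.Ioo (0:ℝ) T, ∀ i j : Fin d,
        DifferentiableAt ℝ (fun y => b y t j) x ∧ |pd i (fun y => b y t j) x| ≤ C) →
      ∀ ψ : (Fin d → ℝ) → ℝ → ℝ,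
      ContinuousOn (fun q : (Fin d → ℝ) × ℝ => ψ q.1 q.2) (closure Ω ×ˢ Set.Ico 0 T) →
      (∀ s ∈ Set.Ioo (0:ℝ) T, ContDiffOn ℝ 2 (fun x => ψ x s) Ω) →
      (∀ x ∈ Ω, ContDiffOn ℝ 1 (ψ x) (Set.Ico 0 T)) →
      (∀ x ∈ frontier Ω, ∀ s ∈ Set.Ioo (0:ℝ) T, ψ x s = 0) →
      (∀ x ∈ Ω, ∀ s ∈ Set.Ioo (0:ℝ) T,
        deriv (ψ x) s = -(lap (fun y => ψ y s) x) - a x s * ψ x s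
          + ∑ i, pd i (fun y => b y s i * ψ y s) x) →
      ((∀ x ∈ Ω, ψ x 0 = 0) ↔ ∀ x ∈ Ω, ∀ s ∈ Set.Ioo (0:ℝ) T, ψ x s = 0)) := by
  refine ⟨fun v hcont hc2 hdt hbd heq => ?_, fun hdb ψ hcont hc2 hdt hbd heq => ?_⟩
  · exact BU.part1 hΩo hΩb hT hab hcont (fun t ht => hc2 t ⟨ht.1, ht.2.le⟩)
      (fun x hx t ht => ((hdt x hx).differentiableOn one_ne_zero).differentiableAt
        (Ioc_mem_nhds ht.1 ht.2)) hbd heq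
  · exact BU.part2 hΩo hΩb hT hab hdb hcont hc2
      (fun x hx t ht => ((hdt x hx).differentiableOn one_ne_zero).differentiableAt
        (Ico_mem_nhds ht.1 ht.2)) hbd heq
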